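/- arXiv:2312.11204 — 2 statements merged into one kernel-verified Lean document; each statement's English description precedes it below -/
import Mathlib

section
/- Assume g is odd. Then for every θ ∈ K ∪ {∞}, the hyperelliptic curve X_θ has no K-rational point: there is no (s, t) ∈ K² with a s² = b (t^{g+1} − A_θ)(t^{g+1} − B_θ) and no (S, T) ∈ K² with a S² = b (1 − A_θ T^{g+1})(1 − B_θ T^{g+1}). Moreover X_θ admits no zero-cycle of degree 1: there do not exist an integer r ≥ 1, finite field extensions L₁, …, L_r of K, and integers n₁, …, n_r with n₁[L₁:K] + ⋯ + n_r[L_r:K] = 1, such that for each i the curve X_θ has an L_i-point. -/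
open NumberField IsDedekindDomain

universe u

/-- `D_θ = a^{2h+1} b^{2h+1} θ^{g+1} − 1`. -/
def Dval {F : Type*} [Field F] (a b : F) (h g : ℕ) (θ : F) : F :=
  a ^ (2 * h + 1) * b ^ (2 * h + 1) * θ ^ (g + 1) - 1

/-- `C_θ = a^{2h+1} θ^{g+1} − 1`. -/
def Cval {F : Type*} [Field F] (a : F) (h g : ℕ) (θ : F) : F :=
  a ^ (2 * h + 1) * θ ^ (g + 1) - 1

/-- `A_θ = a^{4h+3} θ^{2g+2} + b c² d D_θ²`. -/
def Aval {F : Type*} [Field F] (a b c d : F) (h g : ℕ) (θ : F) : F :=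
  a ^ (4 * h + 3) * θ ^ (2 * g + 2) + b * c ^ 2 * d * (Dval a b h g θ) ^ 2

/-- `B_θ = a^{4h+3} θ^{2g+2} + (b c² d + 2c) D_θ²`. -/
def Bval {F : Type*} [Field F] (a b c d : F) (h g : ℕ) (θ : F) : F :=
  a ^ (4 * h + 3) * θ ^ (2 * g + 2) + (b * c ^ 2 * d + 2 * c) * (Dval a b h g θ) ^ 2

/-- `D_∞ = a^{2h+1} b^{2h+1}`. -/
def Dinf {F : Type*} [Field F] (a b : F) (h : ℕ) : F := a ^ (2 * h + 1) * b ^ (2 * h + 1)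

/-- `C_∞ = a^{2h+1}`. -/
def Cinf {F : Type*} [Field F] (a : F) (h : ℕ) : F := a ^ (2 * h + 1)

/-- `A_∞ = a^{4h+3} + b c² d D_∞²`. -/
def Ainf {F : Type*} [Field F] (a b c d : F) (h : ℕ) : F :=
  a ^ (4 * h + 3) + b * c ^ 2 * d * (Dinf a b h) ^ 2

/-- `B_∞ = a^{4h+3} + (b c² d + 2c) D_∞²`. -/
def Binf {F : Type*} [Field F] (a b c d : F) (h : ℕ) : F :=
  a ^ (4 * h + 3) + (b * c ^ 2 * d + 2 * c) * (Dinf a b h) ^ 2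

/-- The image of `x ∈ 𝓞 K` in the completion of `K` at the finite place `π`. -/
noncomputable def intToAdicCompletion {K : Type*} [Field K] [NumberField K]
    (π : HeightOneSpectrum (𝓞 K)) (x : 𝓞 K) : π.adicCompletion K :=
  algebraMap K (π.adicCompletion K) (algebraMap (𝓞 K) K x)

/-- The arithmetic parameters `a, b, c, d` of Proposition 2.1 of Huang–Liang, for the
finite set `Ω⁰` of finite odd places of residue characteristic at most `4g²`;
`va, vb, vc, vd` are the finite places of `K` generated by `a, b, c, d`. -/
structure Params (K : Type u) [Field K] [NumberField K] (g : ℕ) (a b c d : 𝓞 K)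
    (va vb vc vd : HeightOneSpectrum (𝓞 K)) : Prop where
  span_a : va.asIdeal = Ideal.span {a}
  span_b : vb.asIdeal = Ideal.span {b}
  span_c : vc.asIdeal = Ideal.span {c}
  span_d : vd.asIdeal = Ideal.span {d}
  distinct : va ≠ vb ∧ va ≠ vc ∧ va ≠ vd ∧ vb ≠ vc ∧ vb ≠ vd ∧ vc ≠ vd
  not_dvd_two : (2 : 𝓞 K) ∉ va.asIdeal ∧ (2 : 𝓞 K) ∉ vb.asIdeal ∧
    (2 : 𝓞 K) ∉ vc.asIdeal ∧ (2 : 𝓞 K) ∉ vd.asIdeal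
  char_odd : Odd (ringChar (𝓞 K ⧸ va.asIdeal)) ∧ Odd (ringChar (𝓞 K ⧸ vb.asIdeal)) ∧
    Odd (ringChar (𝓞 K ⧸ vc.asIdeal)) ∧ Odd (ringChar (𝓞 K ⧸ vd.asIdeal))
  char_big : 4 * g ^ 2 < ringChar (𝓞 K ⧸ va.asIdeal) ∧
    4 * g ^ 2 < ringChar (𝓞 K ⧸ vb.asIdeal) ∧
    4 * g ^ 2 < ringChar (𝓞 K ⧸ vc.asIdeal) ∧
    4 * g ^ 2 < ringChar (𝓞 K ⧸ vd.asIdeal)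
  sq_ab_bad : ∀ π : HeightOneSpectrum (𝓞 K),
    ((2 : 𝓞 K) ∈ π.asIdeal ∨ ringChar (𝓞 K ⧸ π.asIdeal) ≤ 4 * g ^ 2) →
    IsSquare (intToAdicCompletion π a) ∧ IsSquare (intToAdicCompletion π b)
  pos_real : ∀ σ : K →+* ℝ, 0 < σ (algebraMap (𝓞 K) K a) ∧ 0 < σ (algebraMap (𝓞 K) K b)
  sq_two_a : IsSquare ((2 : va.adicCompletion K))
  sq_neg_one_a : IsSquare ((-1 : va.adicCompletion K))
  sq_two_b : IsSquare ((2 : vb.adicCompletion K))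
  sq_neg_one_b : IsSquare ((-1 : vb.adicCompletion K))
  cong_a : b ∣ a - 1
  cong_bcd : a ∣ b * c ^ 2 * d - 1
  c_nsq_a : ¬ IsSquare (intToAdicCompletion va c)
  c_nsq_b : ¬ IsSquare (intToAdicCompletion vb c)
  d_nsq_b : ¬ IsSquare (intToAdicCompletion vb d)
  d_sq_c : IsSquare (intToAdicCompletion vc d)
  d_sq_a : IsSquare (intToAdicCompletion va d)
  a_sq_b : IsSquare (intToAdicCompletion vb a)
  a_nsq_c : ¬ IsSquare (intToAdicCompletion vc a)
  b_sq_a : IsSquare (intToAdicCompletion va b)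
  b_nsq_c : ¬ IsSquare (intToAdicCompletion vc b)
  not_dvd : ¬ a ∣ b * c * d + 2


/-- The hyperelliptic curve glued from the charts `a s² = b (t^{g+1} − A)(t^{g+1} − B)`
and `a S² = b (1 − A T^{g+1})(1 − B T^{g+1})` has an `L`-point. -/
def XPoint {L : Type*} [Field L] (g : ℕ) (a b A B : L) : Prop :=
  (∃ s t : L, a * s ^ 2 = b * ((t ^ (g + 1) - A) * (t ^ (g + 1) - B))) ∨
  (∃ S T : L, a * S ^ 2 = b * ((1 - A * T ^ (g + 1)) * (1 - B * T ^ (g + 1))))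

/-- The curve over `K` with parameters `a, b, A, B ∈ K` admits no zero-cycle of
degree 1: there is no collection of finite field extensions `Lᵢ/K`, each carrying a
point of the curve, together with integers `nᵢ` with `∑ nᵢ [Lᵢ : K] = 1`. -/
def XNoZeroCycleDegOne (K : Type u) [Field K] (g : ℕ) (a b A B : K) : Prop :=
  ∀ (r : ℕ), 1 ≤ r → ∀ (L : Fin r → Type u) [∀ i, Field (L i)] [∀ i, Algebra K (L i)]
    [∀ i, FiniteDimensional K (L i)] (n : Fin r → ℤ),
    (∀ i, XPoint g (algebraMap K (L i) a) (algebraMap K (L i) b)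
      (algebraMap K (L i) A) (algebraMap K (L i) B)) →
    (∑ i, n i * (Module.finrank K (L i) : ℤ)) ≠ 1

open Filter Topology Complex in
theorem jacobiTheta_eq_inv_sqrt_mul (τ : ℂ) :
    jacobiTheta τ = 1 / (-I * τ) ^ (1 / 2 : ℂ) * jacobiTheta (-1 / τ) := by
  simp only [jacobiTheta_eq_jacobiTheta₂]
  rw [jacobiTheta₂_functional_equation]
  simp

open Filter Topology Complex in
theorem jacobiTheta_add_even (τ : ℂ) (k : ℕ) : jacobiTheta (τ + 2 * k) = jacobiTheta τ := by
  induction k with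
  | zero => simp
  | succ k ih =>
    rw [← ih, ← jacobiTheta_two_add (τ + 2 * k)]
    congr 1
    push_cast
    ring

open Filter Topology Complex in
theorem jacobiTheta_gauss_expand (a : ℕ) (ha : 0 < a) (x : ℝ) (hx : 0 < x) :
    jacobiTheta (1 / (2 * a) + I / ((2 * a) ^ 2 * x)) =
      ((x ^ (1 / 2 : ℝ) : ℝ) : ℂ) * ∑ r : Fin (2 * a),
        cexp (2 * Real.pi * I * ((r : ℕ) ^ 2 / (4 * a))) *
          (HurwitzZeta.cosKernel (((r : ℕ) / (2 * a) : ℝ) : UnitAddCircle) x : ℂ) := by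
  have ha' : (a : ℂ) ≠ 0 := by exact_mod_cast ha.ne'
  have haR : (0 : ℝ) < a := by exact_mod_cast ha
  have hxC : (x : ℂ) ≠ 0 := by exact_mod_cast hx.ne'
  have : NeZero (2 * a) := ⟨by omega⟩
  set τ : ℂ := 1 / (2 * a) + I / ((2 * a) ^ 2 * x) with hτ
  have hτim : 0 < τ.im := by
    have : τ = ((1 / (2 * a) : ℝ) : ℂ) + ((1 / ((2 * a) ^ 2 * x) : ℝ) : ℂ) * I := by
      rw [hτ]; push_cast; ring
    rw [this]
    simp only [add_im, ofReal_im, mul_im, ofReal_re, I_re, I_im]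
    have : 0 < 1 / ((2 * a) ^ 2 * x) := by positivity
    linarith
  have h1 := hasSum_jacobiTheta₂_term 0 hτim
  rw [← jacobiTheta_eq_jacobiTheta₂] at h1
  rw [← (Int.divModEquiv (2 * a)).symm.hasSum_iff] at h1
  have hfib : ∀ r : Fin (2 * a), HasSum
      (fun j : ℤ => jacobiTheta₂_term ((Int.divModEquiv (2 * a)).symm (j, r)) 0 τ)
      (cexp (2 * Real.pi * I * ((r : ℕ) ^ 2 / (4 * a))) *
        ((HurwitzZeta.evenKernel (((r : ℕ) / (2 * a) : ℝ) : UnitAddCircle) (1 / x) : ℝ) : ℂ)) := by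
    intro r
    have h2 := HurwitzZeta.hasSum_int_evenKernel ((r : ℕ) / (2 * a) : ℝ)
      (show 0 < 1 / x by positivity)
    have h3 := (hasSum_ofReal.mpr h2).mul_left (cexp (2 * Real.pi * I * ((r : ℕ) ^ 2 / (4 * a))))
    refine h3.congr_fun ?_
    intro j
    rw [jacobiTheta₂_term, Complex.ofReal_exp, ← Complex.exp_add, Complex.exp_eq_exp_iff_exists_int]
    refine ⟨a * j ^ 2 + j * r, ?_⟩
    simp only [Int.divModEquiv, Equiv.coe_fn_symm_mk]
    rw [hτ]
    push_cast
    field_simp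
    linear_combination (4 * (2 * a * j + (r : ℕ) : ℂ) ^ 2) * I_sq
  have h4 := ((Equiv.prodComm _ _).hasSum_iff.mpr h1).prod_fiberwise hfib
  have h5 := h4.unique (hasSum_fintype _)
  rw [h5, Finset.mul_sum]
  refine Finset.sum_congr rfl fun r _ => ?_
  rw [HurwitzZeta.evenKernel_functional_equation, one_div_one_div, one_div x,
    Real.inv_rpow hx.le, one_div, inv_inv]
  push_cast
  ring

open Filter Topology Complex in
theorem tendsto_cosKernel_atTop (u : UnitAddCircle) :
    Tendsto (HurwitzZeta.cosKernel u) atTop (𝓝 1) := by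
  obtain ⟨p, hp, h⟩ := HurwitzZeta.isBigO_atTop_cosKernel_sub u
  have h1 : Tendsto (fun x : ℝ => Real.exp (-p * x)) atTop (𝓝 0) := by
    refine Real.tendsto_exp_atBot.comp ?_
    exact tendsto_id.const_mul_atTop_of_neg (by linarith)
  have h2 := h.trans_tendsto h1
  simpa using h2.add_const 1

open Filter Topology Complex in
theorem jacobiTheta_gauss_modular (a : ℕ) (ha : 0 < a) (x : ℝ) (hx : 0 < x) :
    jacobiTheta (1 / (2 * a) + I / ((2 * a) ^ 2 * x)) =
      1 / (-I * (1 / (2 * a) + I / ((2 * a) ^ 2 * x))) ^ (1 / 2 : ℂ) *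
      (1 / (1 / (x + I / (2 * a))) ^ (1 / 2 : ℂ) * jacobiTheta (I * x - 1 / (2 * a))) := by
  have ha' : (a : ℂ) ≠ 0 := by exact_mod_cast ha.ne'
  have hxC : (x : ℂ) ≠ 0 := by exact_mod_cast hx.ne'
  have hd : (2 * a * x + I : ℂ) ≠ 0 := by
    intro h
    have := congrArg Complex.im h
    simp at this
  rw [jacobiTheta_eq_inv_sqrt_mul]
  congr 1
  rw [← jacobiTheta_add_even _ a, jacobiTheta_eq_inv_sqrt_mul]
  have e1 : (-1 / (1 / (2 * a) + I / ((2 * a) ^ 2 * x)) + 2 * a : ℂ) = I / (x + I / (2 * a)) := by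
    have h1 : (1 / (2 * a) + I / ((2 * a) ^ 2 * x) : ℂ) = (2 * a * x + I) / ((2 * a) ^ 2 * x) := by
      field_simp
    have h2 : (x + I / (2 * a) : ℂ) = (2 * a * x + I) / (2 * a) := by field_simp
    rw [h1, h2]
    field_simp
    ring
  have h2 : (x + I / (2 * a) : ℂ) ≠ 0 := by
    have : (x + I / (2 * a) : ℂ) = (2 * a * x + I) / (2 * a) := by field_simp
    rw [this]
    exact div_ne_zero hd (by simp [ha'])
  rw [e1]
  congr 3
  · rw [← mul_div_assoc, neg_mul, I_mul_I, neg_neg]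
  · rw [div_div_eq_mul_div, div_eq_iff I_ne_zero]
    linear_combination - x * I_sq

open Complex in
theorem ofReal_mul_cpow_half {r : ℝ} (hr : 0 < r) {z : ℂ} (hz : z ≠ 0) :
    ((r : ℂ) * z) ^ (1 / 2 : ℂ) = ((r ^ (1 / 2 : ℝ) : ℝ) : ℂ) * z ^ (1 / 2 : ℂ) := by
  have hr' : (r : ℂ) ≠ 0 := by exact_mod_cast hr.ne'
  rw [cpow_def_of_ne_zero (mul_ne_zero hr' hz), log_ofReal_mul hr hz, add_mul, Complex.exp_add,
    ← cpow_def_of_ne_zero hz, ofReal_log hr.le, ← cpow_def_of_ne_zero hr', ofReal_cpow hr.le]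
  push_cast
  rfl

/-- The additive character `x ↦ exp (2πi x)` on the rationals. -/
noncomputable def ratExp (x : ℚ) : ℂ := Complex.exp (2 * Real.pi * Complex.I * (x : ℂ))

theorem ratExp_add (x y : ℚ) : ratExp (x + y) = ratExp x * ratExp y := by
  rw [ratExp, ratExp, ratExp, ← Complex.exp_add]
  push_cast
  ring_nf

theorem ratExp_zero : ratExp 0 = 1 := by simp [ratExp]

theorem ratExp_eq_one_iff (x : ℚ) : ratExp x = 1 ↔ ∃ n : ℤ, x = n := by
  rw [ratExp, Complex.exp_eq_one_iff]
  have h : (2 * Real.pi * Complex.I : ℂ) ≠ 0 := Complex.two_pi_I_ne_zero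
  constructor
  · rintro ⟨n, hn⟩
    refine ⟨n, ?_⟩
    have : (x : ℂ) = n := mul_left_cancel₀ h (by rw [hn]; ring)
    exact_mod_cast this
  · rintro ⟨n, rfl⟩
    exact ⟨n, by push_cast; ring⟩

theorem ratExp_intCast (n : ℤ) : ratExp n = 1 := (ratExp_eq_one_iff _).2 ⟨n, rfl⟩

theorem ratExp_neg (x : ℚ) : ratExp (-x) = (starRingEnd ℂ) (ratExp x) := by
  rw [ratExp, ratExp, ← Complex.exp_conj]
  congr 1
  simp [map_ofNat]

/-- The common phase of the quadratic Gauss sums of even modulus. -/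
noncomputable def gaussPhase : ℂ := 1 / (-Complex.I) ^ (1 / 2 : ℂ)

theorem norm_gaussPhase : ‖gaussPhase‖ = 1 := by
  rw [gaussPhase, norm_div, norm_one, Complex.norm_cpow_of_ne_zero (by simp)]
  simp

open Filter Topology Complex in
theorem gaussSum_eq_phase (a : ℕ) (ha : 0 < a) :
    ∃ r : ℝ, 0 < r ∧ ∑ k : Fin (2 * a), ratExp (((k : ℕ) : ℚ) ^ 2 / (4 * a)) = r * gaussPhase := by
  have ha' : (a : ℂ) ≠ 0 := by exact_mod_cast ha.ne'
  have haR : (0 : ℝ) < a := by exact_mod_cast ha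
  have key : Tendsto (fun x : ℝ => (((x ^ (1 / 2 : ℝ) : ℝ) : ℂ))⁻¹ *
      jacobiTheta (1 / (2 * a) + I / ((2 * a) ^ 2 * x))) atTop
      (𝓝 (∑ k : Fin (2 * a), ratExp (((k : ℕ) : ℚ) ^ 2 / (4 * a)))) := by
    have h1 : Tendsto (fun x : ℝ => ∑ r : Fin (2 * a),
        cexp (2 * Real.pi * I * ((r : ℕ) ^ 2 / (4 * a))) *
          (HurwitzZeta.cosKernel (((r : ℕ) / (2 * a) : ℝ) : UnitAddCircle) x : ℂ)) atTop
        (𝓝 (∑ r : Fin (2 * a), cexp (2 * Real.pi * I * ((r : ℕ) ^ 2 / (4 * a))) * ((1 : ℝ) : ℂ))) :=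
      tendsto_finsetSum _ fun r _ =>
        (((continuous_ofReal.tendsto _).comp (tendsto_cosKernel_atTop _))).const_mul _
    have h2 : (∑ k : Fin (2 * a), ratExp (((k : ℕ) : ℚ) ^ 2 / (4 * a))) =
        ∑ r : Fin (2 * a), cexp (2 * Real.pi * I * ((r : ℕ) ^ 2 / (4 * a))) * ((1 : ℝ) : ℂ) := by
      refine Finset.sum_congr rfl fun r _ => ?_
      rw [ratExp]
      push_cast
      ring_nf
    rw [h2]
    refine h1.congr' ?_
    filter_upwards [eventually_gt_atTop 0] with x hx
    have hx' : ((x ^ (1 / 2 : ℝ) : ℝ) : ℂ) ≠ 0 := by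
      exact_mod_cast (Real.rpow_pos_of_pos hx _).ne'
    rw [jacobiTheta_gauss_expand a ha x hx, inv_mul_cancel_left₀ hx']
  have key2 : Tendsto (fun x : ℝ => (((x ^ (1 / 2 : ℝ) : ℝ) : ℂ))⁻¹ *
      jacobiTheta (1 / (2 * a) + I / ((2 * a) ^ 2 * x))) atTop
      (𝓝 (1 / (-I * (1 / (2 * a) + 0)) ^ (1 / 2 : ℂ) * (1 / (1 / (1 + 0)) ^ (1 / 2 : ℂ) * 1))) := by
    have hinv : Tendsto (fun x : ℝ => ((x⁻¹ : ℝ) : ℂ)) atTop (𝓝 0) := by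
      have := (continuous_ofReal.tendsto 0).comp (tendsto_inv_atTop_zero (𝕜 := ℝ))
      rw [ofReal_zero] at this
      exact this
    have hI : Tendsto (fun x : ℝ => (I / (2 * a) ^ 2) * ((x⁻¹ : ℝ) : ℂ)) atTop (𝓝 0) := by
      simpa using hinv.const_mul (I / (2 * a) ^ 2)
    have hI2 : Tendsto (fun x : ℝ => (I / (2 * a)) * ((x⁻¹ : ℝ) : ℂ)) atTop (𝓝 0) := by
      simpa using hinv.const_mul (I / (2 * a))
    have hth : Tendsto (fun x : ℝ => jacobiTheta (I * x - 1 / (2 * a))) atTop (𝓝 1) := by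
      have h0 := isBigO_at_im_infty_jacobiTheta_sub_one
      have hc : Tendsto (fun x : ℝ => (I * x - 1 / (2 * a) : ℂ)) atTop (comap im atTop) := by
        rw [tendsto_comap_iff]
        refine tendsto_id.congr fun x => ?_
        have : (1 / (2 * a) : ℂ) = ((1 / (2 * a) : ℝ) : ℂ) := by push_cast; rfl
        simp only [Function.comp, this, sub_im, mul_im, I_re, ofReal_im, I_im, ofReal_re, id]
        ring
      have h1 : Tendsto (fun τ : ℂ => Real.exp (-Real.pi * τ.im)) (comap im atTop) (𝓝 0) := by
        refine Real.tendsto_exp_atBot.comp ?_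
        exact tendsto_comap.const_mul_atTop_of_neg (by linarith [Real.pi_pos])
      simpa using ((h0.trans_tendsto h1).comp hc).add_const 1
    have hs1 : (-I * (1 / (2 * a) + 0) : ℂ) ∈ slitPlane := by
      right
      have : (-I * (1 / (2 * a) + 0) : ℂ) = ((-(1 / (2 * a)) : ℝ) : ℂ) * I := by push_cast; ring
      rw [this]
      simp [ha.ne']
    have t1 := ((tendsto_const_nhds (x := (1 / (2 * a) : ℂ))).add hI).const_mul (-I)
    have t1' := (tendsto_const_nhds (x := (1 : ℂ))).div
      (t1.cpow (tendsto_const_nhds (x := (1 / 2 : ℂ))) hs1)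
      (by rw [Ne, cpow_eq_zero_iff]; simp [ha'])
    have t2 := (tendsto_const_nhds (x := (1 : ℂ))).div
      ((tendsto_const_nhds (x := (1 : ℂ))).add hI2) (by simp)
    have t2' := (tendsto_const_nhds (x := (1 : ℂ))).div
      (t2.cpow (tendsto_const_nhds (x := (1 / 2 : ℂ))) (by simp))
      (by simp)
    refine (t1'.mul (t2'.mul hth)).congr' ?_
    filter_upwards [eventually_gt_atTop 0] with x hx
    have hx0 : ((x ^ (1 / 2 : ℝ) : ℝ) : ℂ) ≠ 0 := by
      exact_mod_cast (Real.rpow_pos_of_pos hx _).ne'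
    have hxC : (x : ℂ) ≠ 0 := by exact_mod_cast hx.ne'
    rw [jacobiTheta_gauss_modular a ha x hx]
    have e1 : (1 / (x + I / (2 * a)) : ℂ) =
        ((x⁻¹ : ℝ) : ℂ) * (1 / (1 + I / (2 * a) * ((x⁻¹ : ℝ) : ℂ))) := by
      push_cast
      rw [← one_div, one_div_mul_one_div]
      congr 1
      field_simp
    have e2 : (I / (2 * a) ^ 2 * ((x⁻¹ : ℝ) : ℂ) : ℂ) = I / ((2 * a) ^ 2 * x) := by
      push_cast
      field_simp
    have hne : (1 / (1 + I / (2 * a) * ((x⁻¹ : ℝ) : ℂ))) ≠ 0 := by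
      have h2 : (1 + I / (2 * a) * ((x⁻¹ : ℝ) : ℂ)) = 1 + (((2 * (a : ℝ))⁻¹ * x⁻¹ : ℝ) : ℂ) * I := by
        push_cast
        ring
      refine one_div_ne_zero fun h => ?_
      rw [h2] at h
      have h3 := congrArg re h
      rw [add_re, re_ofReal_mul] at h3
      simp at h3
    rw [e1, ofReal_mul_cpow_half (inv_pos.2 hx) hne, ← e2, Real.inv_rpow hx.le]
    simp only [Pi.div_apply]
    generalize (1 / (1 + I / (2 * a) * ((x⁻¹ : ℝ) : ℂ))) ^ (1 / 2 : ℂ) = w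
    generalize (-I * (1 / (2 * a) + I / (2 * a) ^ 2 * ((x⁻¹ : ℝ) : ℂ))) ^ (1 / 2 : ℂ) = w'
    generalize jacobiTheta _ = w''
    rw [ofReal_inv]
    generalize ((x ^ (1 / 2 : ℝ) : ℝ) : ℂ) = y at hx0
    field_simp
  have hlim := tendsto_nhds_unique key key2
  refine ⟨(2 * a) ^ (1 / 2 : ℝ), by positivity, ?_⟩
  rw [hlim, gaussPhase]
  have h1 : (-I * (1 / (2 * a) + 0) : ℂ) = (((2 * a)⁻¹ : ℝ) : ℂ) * (-I) := by
    push_cast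
    ring
  rw [h1, ofReal_mul_cpow_half (by positivity) (by simp), Real.inv_rpow (by positivity)]
  simp
  ring

/-- The quadratic Gauss sum of `k ^ 2 / (4 a)` over a full period, up to a positive factor. -/
theorem gaussSum_period (a : ℤ) (ha : a ≠ 0) (N : ℕ) (hN : 0 < N) (hd : 2 * a ∣ N) :
    ∃ r : ℝ, 0 < r ∧ ∑ k ∈ Finset.range N, ratExp ((k : ℚ) ^ 2 / (4 * a)) =
      r * (if 0 < a then gaussPhase else (starRingEnd ℂ) gaussPhase) := by
  have hper : ∀ (m : ℕ), 0 < m → ∀ k q : ℕ,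
      ratExp (((k + q * (2 * m) : ℕ) : ℚ) ^ 2 / (4 * m)) = ratExp ((k : ℚ) ^ 2 / (4 * m)) := by
    intro m hm k q
    have hm' : (m : ℚ) ≠ 0 := by exact_mod_cast hm.ne'
    have : (((k + q * (2 * m) : ℕ) : ℚ) ^ 2 / (4 * m)) =
        (k : ℚ) ^ 2 / (4 * m) + ((q * k + q ^ 2 * m : ℤ) : ℚ) := by
      push_cast
      field_simp
      ring
    rw [this, ratExp_add, ratExp_intCast, mul_one]
  have hpos : ∀ m : ℕ, 0 < m → ∀ q : ℕ, ∑ k ∈ Finset.range (q * (2 * m)),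
      ratExp ((k : ℚ) ^ 2 / (4 * m)) =
        q * ∑ k : Fin (2 * m), ratExp (((k : ℕ) : ℚ) ^ 2 / (4 * m)) := by
    intro m hm q
    induction q with
    | zero => simp
    | succ q ih =>
      rw [Nat.succ_mul, Finset.sum_range_add, ih]
      push_cast
      rw [add_mul, one_mul, Fin.sum_univ_eq_sum_range
        (fun k : ℕ => ratExp ((k : ℚ) ^ 2 / (4 * m))) (2 * m)]
      congr 1
      refine Finset.sum_congr rfl fun k _ => ?_
      have := hper m hm k q
      rw [← this]
      push_cast
      ring_nf
  obtain ⟨m, hm⟩ : ∃ m : ℕ, a.natAbs = m := ⟨_, rfl⟩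
  have hm0 : 0 < m := by omega
  have hdm : 2 * m ∣ N := by
    have := Int.natAbs_dvd_natAbs.2 hd
    rw [Int.natAbs_mul, hm] at this
    simpa using this
  obtain ⟨q, rfl⟩ := hdm
  have hq : 0 < q := Nat.pos_of_mul_pos_left hN
  obtain ⟨r, hr, hG⟩ := gaussSum_eq_phase m hm0
  have hS := hpos m hm0 q
  rw [hG, mul_comm q] at hS
  have hqR : (0 : ℝ) < q := by exact_mod_cast hq
  refine ⟨q * r, by positivity, ?_⟩
  split_ifs with hpa
  · have : a = m := by omega
    rw [this]
    push_cast
    rw [hS]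
    ring
  · have : a = -m := by omega
    rw [this]
    have h2 := congrArg (starRingEnd ℂ) hS
    rw [map_sum] at h2
    push_cast
    rw [map_mul, map_mul] at h2
    simp only [Complex.conj_ofReal, ← ratExp_neg, Complex.conj_natCast] at h2
    rw [mul_assoc (q : ℂ), ← h2]
    refine Finset.sum_congr rfl fun k _ => ?_
    congr 1
    rw [mul_neg, div_neg]

theorem sum_quadratic_eq_sum_perp {G : Type*} [AddCommGroup G] [Fintype G] (f : G → ℂ)
    (b : G → G → ℂ) (H : AddSubgroup G) (hb : ∀ x y z, b x (y + z) = b x y * b x z)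
    (hf : ∀ x y, f (x + y) = f x * f y * b x y) (hH : ∀ y ∈ H, f y = 1)
    [DecidablePred fun x => ∀ y ∈ H, b x y = 1] :
    ∑ x, f x = ∑ x with ∀ y ∈ H, b x y = 1, f x := by
  classical
  have hinner : ∀ x, ∑ y : H, b x (y : G) =
      if (∀ y ∈ H, b x y = 1) then (Fintype.card H : ℂ) else 0 := by
    intro x
    split_ifs with h
    · rw [Finset.sum_congr rfl (fun (y : H) _ => h (y : G) y.2)]
      simp
    · push Not at h
      obtain ⟨y, hy, hne⟩ := h
      have h1 : ∑ z : H, b x (z : G) = b x y * ∑ z : H, b x (z : G) := by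
        rw [Finset.mul_sum, ← Equiv.sum_comp (Equiv.addLeft (⟨y, hy⟩ : H))]
        refine Finset.sum_congr rfl fun z _ => ?_
        simp [hb]
      have h2 : (1 - b x y) * ∑ z : H, b x (z : G) = 0 := by linear_combination h1
      rcases mul_eq_zero.1 h2 with h3 | h3
      · exact absurd (sub_eq_zero.1 h3).symm hne
      · exact h3
  have hc : (Fintype.card H : ℂ) ≠ 0 := by exact_mod_cast Fintype.card_ne_zero
  apply mul_left_cancel₀ hc
  calc (Fintype.card H : ℂ) * ∑ x, f x = ∑ y : H, ∑ x, f (x + y) := by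
        have h1 : ∀ y : H, ∑ x, f (x + y) = ∑ x, f x := fun y =>
          Equiv.sum_comp (Equiv.addRight (y : G)) f
        simp [h1]
    _ = ∑ x, f x * ∑ y : H, b x y := by
        rw [Finset.sum_comm]
        refine Finset.sum_congr rfl fun x _ => ?_
        rw [Finset.mul_sum]
        refine Finset.sum_congr rfl fun y _ => ?_
        rw [hf, hH y y.2, mul_one]
    _ = _ := by
        rw [Finset.sum_filter, Finset.mul_sum]
        refine Finset.sum_congr rfl fun x _ => ?_
        rw [hinner]
        split_ifs <;> ring

theorem sum_comp_surjective_addMonoidHom {G S : Type*} [AddCommGroup G] [Fintype G]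
    [AddCommGroup S] [Fintype S] (φ : G →+ S) (hφ : Function.Surjective φ) (Ψ : S → ℂ) :
    ∃ n : ℕ, 0 < n ∧ ∑ x, Ψ (φ x) = n * ∑ s, Ψ s := by
  classical
  refine ⟨(Finset.univ.filter fun x => φ x = 0).card, ?_, ?_⟩
  · exact Finset.card_pos.2 ⟨0, by simp⟩
  · rw [← Finset.sum_fiberwise_of_maps_to (s := Finset.univ) (t := Finset.univ) (g := φ)
      (fun _ _ => Finset.mem_univ _), Finset.mul_sum]
    refine Finset.sum_congr rfl fun s _ => ?_
    have h1 : (Finset.univ.filter fun x => φ x = s).card =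
        (Finset.univ.filter fun x => φ x = 0).card :=
      AddMonoidHom.card_fiber_eq_of_mem_range φ (hφ s) (hφ 0)
    rw [← h1, Finset.sum_congr rfl (g := fun _ => Ψ s), Finset.sum_const, nsmul_eq_mul]
    intro x hx
    rw [(Finset.mem_filter.1 hx).2]

theorem ratExp_sum {ι : Type*} (s : Finset ι) (f : ι → ℚ) :
    ratExp (∑ i ∈ s, f i) = ∏ i ∈ s, ratExp (f i) := by
  classical
  induction s using Finset.induction_on with
  | empty => simp [ratExp_zero]
  | insert i s hi ih => rw [Finset.sum_insert hi, Finset.prod_insert hi, ratExp_add, ih]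

theorem prod_phase_eq_one {ι : Type*} [Fintype ι] (a : ι → ℤ) (ha : ∀ i, a i ≠ 0)
    (hs : ∑ i, (a i).sign = 0) :
    ∏ i, (if 0 < a i then gaussPhase else (starRingEnd ℂ) gaussPhase) = 1 := by
  have hg : gaussPhase ≠ 0 := by
    rw [← norm_ne_zero_iff, norm_gaussPhase]
    exact one_ne_zero
  have hc : (starRingEnd ℂ) gaussPhase = gaussPhase⁻¹ := by
    rw [Complex.inv_def, Complex.normSq_eq_norm_sq, norm_gaussPhase]
    simp
  have h1 : ∀ s : Finset ι,
      ∏ i ∈ s, (if 0 < a i then gaussPhase else (starRingEnd ℂ) gaussPhase) =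
        gaussPhase ^ (∑ i ∈ s, (a i).sign) := by
    classical
    intro s
    induction s using Finset.induction_on with
    | empty => simp
    | insert i s hi ih =>
      rw [Finset.prod_insert hi, Finset.sum_insert hi, ih, zpow_add₀ hg]
      congr 1
      split_ifs with h
      · rw [Int.sign_eq_one_of_pos h, zpow_one]
      · rw [Int.sign_eq_neg_one_of_neg (by have := ha i; omega), zpow_neg_one, hc]
  rw [h1, hs, zpow_zero]

theorem sum_box_pos {ι : Type*} [Fintype ι] [DecidableEq ι] (a : ι → ℤ) (ha : ∀ i, a i ≠ 0)
    (hs : ∑ i, (a i).sign = 0) (N : ℕ) [NeZero N] (hN : ∀ i, 2 * a i ∣ N) :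
    ∃ r : ℝ, 0 < r ∧
      ∑ x : ι → ZMod N, ratExp (∑ i, ((x i).val : ℚ) ^ 2 / (4 * a i)) = r := by
  have h0 : ∀ i, ∃ r : ℝ, 0 < r ∧ ∑ k : ZMod N, ratExp ((k.val : ℚ) ^ 2 / (4 * a i)) =
      r * (if 0 < a i then gaussPhase else (starRingEnd ℂ) gaussPhase) := by
    intro i
    obtain ⟨r, hr, h⟩ := gaussSum_period (a i) (ha i) N (NeZero.pos N) (hN i)
    refine ⟨r, hr, ?_⟩
    rw [← h]
    refine Finset.sum_bij (fun k _ => k.val) (fun k _ => Finset.mem_range.2 (ZMod.val_lt k))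
      (fun x _ y _ h => ZMod.val_injective N h) (fun k hk => ⟨(k : ZMod N), Finset.mem_univ _,
        ZMod.val_cast_of_lt (Finset.mem_range.1 hk)⟩) (fun k _ => rfl)
  choose r hr h using h0
  refine ⟨∏ i, r i, Finset.prod_pos fun i _ => hr i, ?_⟩
  simp_rw [ratExp_sum]
  have h1 := Finset.prod_univ_sum (fun _ : ι => (Finset.univ : Finset (ZMod N)))
    (fun i k => ratExp ((k.val : ℚ) ^ 2 / (4 * a i)))
  rw [Fintype.piFinset_univ] at h1
  rw [← h1, Finset.prod_congr rfl fun i _ => h i, Finset.prod_mul_distrib,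
    prod_phase_eq_one a ha hs, mul_one]
  push_cast
  rfl

/-- The sum of the quadratic character attached to a diagonal form of signature zero over a
finite quotient of a self-dual-type lattice is a positive real number. -/
theorem sum_quadratic_lattice_pos {ι : Type*} [Fintype ι] [DecidableEq ι] (a : ι → ℤ)
    (ha : ∀ i, a i ≠ 0) (hs : ∑ i, (a i).sign = 0) (M Λ : AddSubgroup (ι → ℚ))
    (hΛ : ∀ i, Pi.single i 1 ∈ Λ)
    (hM : ∀ w, w ∈ M ↔ ∀ z ∈ Λ, ∃ n : ℤ, ∑ i, 2 * a i * w i * z i = n)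
    (hq : ∀ z ∈ Λ, ∃ n : ℤ, ∑ i, a i * z i ^ 2 = n)
    {S : Type*} [AddCommGroup S] [Fintype S] (ρ : M →+ S) (hρ : Function.Surjective ρ)
    (hρ0 : ∀ (i : ι) (w : M), (w : ι → ℚ) = Pi.single i 1 → ρ w = 0) (Ψ : S → ℂ)
    (hΨ : ∀ w : M, Ψ (ρ w) = ratExp (∑ i, a i * (w : ι → ℚ) i ^ 2)) :
    ∃ r : ℝ, 0 < r ∧ ∑ s, Ψ s = r := by
  classical
  have haQ : ∀ i, (a i : ℚ) ≠ 0 := fun i => by exact_mod_cast ha i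
  have hΛM : ∀ z ∈ Λ, z ∈ M := by
    intro z hz
    rw [hM]
    intro y hy
    obtain ⟨n1, h1⟩ := hq _ (Λ.add_mem hz hy)
    obtain ⟨n2, h2⟩ := hq _ hz
    obtain ⟨n3, h3⟩ := hq _ hy
    refine ⟨n1 - n2 - n3, ?_⟩
    push_cast
    rw [← h1, ← h2, ← h3, ← Finset.sum_sub_distrib, ← Finset.sum_sub_distrib]
    refine Finset.sum_congr rfl fun i _ => ?_
    simp only [Pi.add_apply]
    ring
  set N : ℕ := ∏ i, 2 * (a i).natAbs with hNdef
  have hN0 : NeZero N := ⟨Finset.prod_ne_zero_iff.2 fun i _ => by have := ha i; omega⟩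
  have hN : ∀ i, 2 * a i ∣ (N : ℤ) := by
    intro i
    have h1 : 2 * (a i).natAbs ∣ N := Finset.dvd_prod_of_mem _ (Finset.mem_univ i)
    rw [← Int.natAbs_dvd_natAbs, Int.natAbs_mul]
    simpa using h1
  choose e he using hN
  have heQ : ∀ i, (N : ℚ) = 2 * a i * e i := fun i => by exact_mod_cast he i
  -- the lattice dual to the orthogonal basis
  let κ : (ι → ℤ) → (ι → ℚ) := fun k i => k i / (2 * a i)
  have hκadd : ∀ k l, κ (k + l) = κ k + κ l := by
    intro k l
    ext i
    simp only [κ, Pi.add_apply]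
    push_cast
    ring
  let lift : (ι → ZMod N) → (ι → ℤ) := fun x i => ((x i).val : ℤ)
  let red : (ι → ℤ) → (ι → ZMod N) := fun k i => (k i : ZMod N)
  have hred : ∀ x, red (lift x) = x := by
    intro x
    ext i
    simp [red, lift]
  have hredadd : ∀ k l, red (k + l) = red k + red l := by
    intro k l
    ext i
    simp [red]
  have hsingle : ∀ (i : ι) (m : ℤ), (fun j => if j = i then (m : ℚ) else 0) ∈ Λ := by
    intro i m
    have := Λ.zsmul_mem (hΛ i) m
    convert this using 1
    ext j
    by_cases h : j = i
    · subst h; simp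
    · simp [h]
  have hρsingle : ∀ (u : ι → ℤ) (h : (fun j => (u j : ℚ)) ∈ M), ρ ⟨_, h⟩ = 0 := by
    intro u h
    have h1 : (⟨_, h⟩ : M) = ∑ i, u i • (⟨Pi.single i 1, hΛM _ (hΛ i)⟩ : M) := by
      apply Subtype.ext
      ext j
      simp [Finset.sum_apply, Pi.single_apply]
    rw [h1, map_sum]
    refine Finset.sum_eq_zero fun i _ => ?_
    rw [map_zsmul, hρ0 i _ rfl, smul_zero]
  have huΛ : ∀ u : ι → ℤ, (fun j => (u j : ℚ)) ∈ Λ := by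
    intro u
    have h1 : (fun j => (u j : ℚ)) = ∑ i, u i • (Pi.single i 1 : ι → ℚ) := by
      ext j
      simp [Finset.sum_apply, Pi.single_apply]
    rw [h1]
    exact Λ.sum_mem fun i _ => Λ.zsmul_mem (hΛ i) _
  have hlift : ∀ k l : ι → ℤ, red k = red l →
      ∃ u : ι → ℤ, κ k = κ l + fun j => (u j : ℚ) := by
    intro k l h
    have h1 : ∀ i, ∃ m : ℤ, k i = l i + N * m := by
      intro i
      have h2 : ((k i : ℤ) : ZMod N) = ((l i : ℤ) : ZMod N) := congrFun h i
      rw [← sub_eq_zero, ← Int.cast_sub, ZMod.intCast_zmod_eq_zero_iff_dvd] at h2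
      obtain ⟨m, hm⟩ := h2
      exact ⟨m, by omega⟩
    choose m hm using h1
    refine ⟨fun i => e i * m i, ?_⟩
    ext i
    simp only [κ, Pi.add_apply, hm i]
    push_cast
    rw [heQ i]
    have := haQ i
    field_simp
  let q : (ι → ℚ) → ℚ := fun w => ∑ i, a i * w i ^ 2
  let B : (ι → ℚ) → (ι → ℚ) → ℚ := fun w z => ∑ i, 2 * a i * w i * z i
  have hqB : ∀ w z, q (w + z) = q w + q z + B w z := by
    intro w z
    simp only [q, B, ← Finset.sum_add_distrib]
    refine Finset.sum_congr rfl fun i _ => ?_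
    simp only [Pi.add_apply]
    ring
  have hBadd : ∀ w y z, B w (y + z) = B w y + B w z := by
    intro w y z
    simp only [B, ← Finset.sum_add_distrib]
    refine Finset.sum_congr rfl fun i _ => ?_
    simp only [Pi.add_apply]
    ring
  have hBcomm : ∀ w z, B w z = B z w := by
    intro w z
    refine Finset.sum_congr rfl fun i _ => ?_
    ring
  have hBint : ∀ (k u : ι → ℤ), ratExp (B (κ k) fun j => (u j : ℚ)) = 1 := by
    intro k u
    have : B (κ k) (fun j => (u j : ℚ)) = ((∑ i, k i * u i : ℤ) : ℚ) := by
      push_cast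
      refine Finset.sum_congr rfl fun i _ => ?_
      have := haQ i
      simp only [κ]
      field_simp
    rw [this, ratExp_intCast]
  have hqint : ∀ u ∈ Λ, ratExp (q u) = 1 := by
    intro u hu
    obtain ⟨n, hn⟩ := hq u hu
    exact (ratExp_eq_one_iff _).2 ⟨n, hn⟩
  have hBwell : ∀ k k' l l', red k = red k' → red l = red l' →
      ratExp (B (κ k) (κ l)) = ratExp (B (κ k') (κ l')) := by
    have h1 : ∀ k l l', red l = red l' →
      ratExp (B (κ k) (κ l)) = ratExp (B (κ k) (κ l')) := by
      intro k l l' h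
      obtain ⟨u, hu⟩ := hlift l l' h
      rw [hu, hBadd, ratExp_add, hBint, mul_one]
    intro k k' l l' hk hl
    rw [h1 k l l' hl, hBcomm, h1 l' k k' hk, hBcomm]
  have hqwell : ∀ k k', red k = red k' → ratExp (q (κ k)) = ratExp (q (κ k')) := by
    intro k k' h
    obtain ⟨u, hu⟩ := hlift k k' h
    rw [hu, hqB, ratExp_add, ratExp_add, hBint, hqint _ (huΛ u), mul_one, mul_one]
  have hliftadd : ∀ x y, red (lift (x + y)) = red (lift x + lift y) := by
    intro x y
    rw [hred, hredadd, hred, hred]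
  have hex : ∀ w ∈ M, ∃ k, w = κ k := by
    intro w hw
    have h1 : ∀ i, ∃ n : ℤ, 2 * a i * w i = n := by
      intro i
      obtain ⟨n, hn⟩ := (hM w).1 hw _ (hΛ i)
      refine ⟨n, ?_⟩
      rw [← hn]
      simp [Pi.single_apply]
    choose n hn using h1
    refine ⟨n, ?_⟩
    ext i
    simp only [κ, ← hn]
    have := haQ i
    field_simp
  let P : AddSubgroup (ι → ZMod N) :=
    { carrier := {x | κ (lift x) ∈ Λ}
      zero_mem' := by
        have : κ (lift 0) = 0 := by
          ext i
          simp [κ, lift]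
        simp [this, Λ.zero_mem]
      add_mem' := by
        intro x y hx hy
        obtain ⟨u, hu⟩ := hlift _ _ (hliftadd x y)
        show κ (lift (x + y)) ∈ Λ
        rw [hu, hκadd]
        exact Λ.add_mem (Λ.add_mem hx hy) (huΛ u)
      neg_mem' := by
        intro x hx
        have h1 : red (lift (-x)) = red (-lift x) := by
          rw [hred]
          ext i
          simp [red, lift]
        obtain ⟨u, hu⟩ := hlift _ _ h1
        show κ (lift (-x)) ∈ Λ
        have h2 : κ (-lift x) = -κ (lift x) := by
          ext i
          simp only [κ, Pi.neg_apply]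
          push_cast
          ring
        rw [hu, h2]
        exact Λ.add_mem (Λ.neg_mem hx) (huΛ u) }
  let Q : AddSubgroup (ι → ZMod N) :=
    { carrier := {x | ∀ y ∈ P, ratExp (B (κ (lift x)) (κ (lift y))) = 1}
      zero_mem' := by
        intro y _
        have : B (κ (lift 0)) (κ (lift y)) = 0 := by
          refine Finset.sum_eq_zero fun i _ => ?_
          simp [κ, lift]
        rw [this, ratExp_zero]
      add_mem' := by
        intro x x' hx hx' y hy
        rw [hBwell _ _ _ _ (hliftadd x x') rfl, hκadd, hBcomm, hBadd, ratExp_add, hBcomm _ (κ (lift x)),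
          hBcomm _ (κ (lift x')), hx y hy, hx' y hy, one_mul]
      neg_mem' := by
        intro x hx y hy
        have h1 : ratExp (B (κ (lift (-x))) (κ (lift y))) * ratExp (B (κ (lift x)) (κ (lift y))) = 1 := by
          rw [hBcomm, hBcomm (κ (lift x)), ← ratExp_add, ← hBadd, ← hκadd,
            hBwell _ (lift y) _ 0 rfl (by rw [← hliftadd, neg_add_cancel, hred]; ext i; simp [red])]
          have : B (κ (lift y)) (κ 0) = 0 := by
            refine Finset.sum_eq_zero fun i _ => ?_
            simp [κ]
          rw [this, ratExp_zero]
        rwa [hx y hy, mul_one] at h1 }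
  have hQM : ∀ x, x ∈ Q ↔ κ (lift x) ∈ M := by
    intro x
    constructor
    · intro hx
      rw [hM]
      intro z hz
      obtain ⟨k, rfl⟩ := hex z (hΛM z hz)
      obtain ⟨u, hu⟩ := hlift (lift (red k)) k (hred _)
      have h1 : red k ∈ P := by
        show κ (lift (red k)) ∈ Λ
        rw [hu]
        exact Λ.add_mem hz (huΛ u)
      have h2 := hx _ h1
      rw [hBwell _ (lift x) _ k rfl (hred _)] at h2
      exact (ratExp_eq_one_iff _).1 h2
    · intro hx y hy
      exact (ratExp_eq_one_iff _).2 ((hM _).1 hx _ hy)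
  let φ : Q →+ S := AddMonoidHom.mk' (fun x => ρ ⟨κ (lift x), (hQM x).1 x.2⟩) (by
    intro x y
    obtain ⟨u, hu⟩ := hlift _ _ (hliftadd x y)
    rw [← map_add, ← sub_eq_zero, ← map_sub]
    have h1 := hρsingle u (hΛM _ (huΛ u))
    rw [← h1]
    congr 1
    apply Subtype.ext
    simp only [AddSubgroup.coe_sub, AddSubgroup.coe_add]
    rw [hu, hκadd]
    abel)
  have hφ : Function.Surjective φ := by
    intro s
    obtain ⟨⟨w, hw⟩, rfl⟩ := hρ s
    obtain ⟨k, rfl⟩ := hex w hw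
    obtain ⟨u, hu⟩ := hlift (lift (red k)) k (hred _)
    have hmem : κ (lift (red k)) ∈ M := by
      rw [hu]
      exact M.add_mem hw (hΛM _ (huΛ u))
    refine ⟨⟨red k, (hQM _).2 hmem⟩, ?_⟩
    show ρ ⟨κ (lift (red k)), hmem⟩ = _
    rw [← sub_eq_zero, ← map_sub, ← hρsingle u (hΛM _ (huΛ u))]
    congr 1
    apply Subtype.ext
    simp only [AddSubgroup.coe_sub]
    rw [hu]
    abel
  obtain ⟨n, hn, hsum⟩ := sum_comp_surjective_addMonoidHom φ hφ Ψ
  have hG := sum_quadratic_eq_sum_perp (fun x => ratExp (q (κ (lift x))))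
    (fun x y => ratExp (B (κ (lift x)) (κ (lift y)))) P
    (fun x y z => by
      rw [hBwell (lift x) (lift x) _ _ rfl (hliftadd y z), hκadd, hBadd, ratExp_add])
    (fun x y => by
      rw [hqwell _ _ (hliftadd x y), hκadd, hqB, ratExp_add, ratExp_add])
    (fun y hy => hqint _ hy)
  obtain ⟨r, hr, hbox⟩ := sum_box_pos a ha hs N (fun i => ⟨e i, he i⟩)
  have hGbox : ∑ x : ι → ZMod N, ratExp (q (κ (lift x))) = r := by
    rw [← hbox]
    refine Finset.sum_congr rfl fun x _ => ?_
    congr 1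
    refine Finset.sum_congr rfl fun i _ => ?_
    have := haQ i
    simp only [κ, lift]
    push_cast
    field_simp
    ring
  have hperp : ∑ x : Q, Ψ (φ x) = r := by
    rw [← hGbox, hG, Finset.sum_subtype (p := fun x => x ∈ Q) _ (by intro x; simp [Q])]
    refine Finset.sum_congr rfl fun x _ => ?_
    exact hΨ _
  have hnR : (0 : ℝ) < n := by exact_mod_cast hn
  refine ⟨r / n, by positivity, ?_⟩
  rw [hperp] at hsum
  push_cast
  rw [hsum]
  have : (n : ℂ) ≠ 0 := by exact_mod_cast hn.ne'
  field_simp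

theorem apply_sum_smul_of_orthogonal {V κ : Type*} [AddCommGroup V] [Module ℝ V] [Fintype κ]
    (B : V →ₗ[ℝ] V →ₗ[ℝ] ℝ) (u : κ → V) (hu : ∀ i j, i ≠ j → B (u i) (u j) = 0) (c : κ → ℝ) :
    B (∑ i, c i • u i) (∑ i, c i • u i) = ∑ i, c i ^ 2 * B (u i) (u i) := by
  simp only [map_sum, LinearMap.sum_apply, map_smul, LinearMap.smul_apply, smul_eq_mul]
  refine Finset.sum_congr rfl fun i _ => ?_
  rw [Finset.sum_eq_single i]
  · ring
  · intro j _ hj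
    rw [hu j i hj]
    ring
  · simp

theorem card_pos_le_card_pos_of_orthogonal {V ι ι' : Type*} [AddCommGroup V] [Module ℝ V]
    [Fintype ι] [Fintype ι'] (B : V →ₗ[ℝ] V →ₗ[ℝ] ℝ) (v : Module.Basis ι ℝ V)
    (w : Module.Basis ι' ℝ V)
    (hv : ∀ i j, i ≠ j → B (v i) (v j) = 0) (hw : ∀ i j, i ≠ j → B (w i) (w j) = 0)
    (hw0 : ∀ i, B (w i) (w i) ≠ 0) :
    Fintype.card {i // 0 < B (v i) (v i)} ≤ Fintype.card {j // 0 < B (w j) (w j)} := by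
  classical
  have hVfin : Module.Finite ℝ V := Module.Finite.of_basis v
  let f : {i // 0 < B (v i) (v i)} ⊕ {j // ¬ 0 < B (w j) (w j)} → V :=
    Sum.elim (fun i => v i) (fun j => w j)
  have hf : LinearIndependent ℝ f := by
    rw [Fintype.linearIndependent_iff]
    intro c hc
    simp only [Fintype.sum_sum_type, f, Sum.elim_inl, Sum.elim_inr] at hc
    have hx : ∑ i : {i // 0 < B (v i) (v i)}, c (Sum.inl i) • v i =
        ∑ j : {j // ¬ 0 < B (w j) (w j)}, (-c (Sum.inr j)) • w j := by
      simp only [neg_smul, Finset.sum_neg_distrib]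
      exact eq_neg_of_add_eq_zero_left hc
    have h1 := apply_sum_smul_of_orthogonal B (fun i : {i // 0 < B (v i) (v i)} => v i)
      (fun i j hij => hv i j (fun h => hij (Subtype.ext h))) (fun i => c (Sum.inl i))
    have h2 := apply_sum_smul_of_orthogonal B (fun j : {j // ¬ 0 < B (w j) (w j)} => w j)
      (fun i j hij => hw i j (fun h => hij (Subtype.ext h))) (fun j => -c (Sum.inr j))
    rw [hx, h2] at h1
    have h3 : ∀ i : {i // 0 < B (v i) (v i)}, 0 ≤ c (Sum.inl i) ^ 2 * B (v i) (v i) :=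
      fun i => mul_nonneg (sq_nonneg _) i.2.le
    have h4 : ∀ j : {j // ¬ 0 < B (w j) (w j)}, 0 ≤ -((-c (Sum.inr j)) ^ 2 * B (w j) (w j)) :=
      fun j => by nlinarith [sq_nonneg (-c (Sum.inr j)), not_lt.1 j.2]
    have s1 := Finset.sum_nonneg fun i (_ : i ∈ Finset.univ) => h3 i
    have s2 := Finset.sum_nonneg fun i (_ : i ∈ Finset.univ) => h4 i
    rw [Finset.sum_neg_distrib] at s2
    have z1 := (Finset.sum_eq_zero_iff_of_nonneg fun i _ => h3 i).1 (by linarith)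
    have z2 := (Finset.sum_eq_zero_iff_of_nonneg fun i _ => h4 i).1
      (by rw [Finset.sum_neg_distrib]; linarith)
    rintro (i | j)
    · have := z1 i (Finset.mem_univ _)
      rcases mul_eq_zero.1 this with h | h
      · exact pow_eq_zero_iff two_ne_zero |>.1 h
      · exact absurd h i.2.ne'
    · have := neg_eq_zero.1 (z2 j (Finset.mem_univ _))
      rcases mul_eq_zero.1 this with h | h
      · exact neg_eq_zero.1 (pow_eq_zero_iff two_ne_zero |>.1 h)
      · exact absurd h (hw0 j)
  have h1 := hf.fintype_card_le_finrank
  rw [Module.finrank_eq_card_basis w, Fintype.card_sum, Fintype.card_subtype_compl] at h1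
  have h2 : Fintype.card {j // 0 < B (w j) (w j)} ≤ Fintype.card ι' := Fintype.card_subtype_le _
  omega

theorem sum_sign_eq {ι : Type*} [Fintype ι] (f : ι → ℝ) (hf : ∀ i, f i ≠ 0) :
    ∑ i, (SignType.sign (f i) : ℤ) = 2 * Fintype.card {i // 0 < f i} - Fintype.card ι := by
  classical
  have h1 : ∀ i, (SignType.sign (f i) : ℤ) = 2 * (if 0 < f i then 1 else 0) - 1 := by
    intro i
    split_ifs with h
    · simp [sign_pos h]
    · simp [sign_neg (lt_of_le_of_ne (not_lt.1 h) (hf i))]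
  simp only [h1, Finset.sum_sub_distrib, ← Finset.mul_sum]
  simp [Fintype.card_subtype]

open NumberField.mixedEmbedding in
theorem exists_linearMap_trace (K : Type*) [Field K] [NumberField K] :
    ∃ T : mixedSpace K →ₗ[ℝ] ℝ, ∀ x : K, T (mixedEmbedding K x) = ((Algebra.trace ℚ K x : ℚ) : ℝ) := by
  refine ⟨(latticeBasis K).constr ℝ
    (fun i => ((Algebra.trace ℚ K (integralBasis K i) : ℚ) : ℝ)), fun x => ?_⟩
  rw [Module.Basis.constr_apply_fintype]
  conv_rhs => rw [← (integralBasis K).sum_repr x, map_sum]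
  push_cast
  refine Finset.sum_congr rfl fun i _ => ?_
  rw [map_smul]
  simp [Module.Basis.equivFun_apply, latticeBasis_repr_apply]

open NumberField.mixedEmbedding in
theorem mixedSpace_span_basis (K : Type*) [Field K] [NumberField K] {ι : Type*} [Fintype ι]
    (e : Module.Basis ι ℚ K) :
    ⊤ ≤ Submodule.span ℝ (Set.range fun i => mixedEmbedding K (e i)) := by
  rw [← (latticeBasis K).span_eq, Submodule.span_le]
  rintro _ ⟨j, rfl⟩
  rw [latticeBasis_apply, ← e.sum_repr (integralBasis K j), map_sum]
  refine Submodule.sum_mem _ fun i _ => ?_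
  have : mixedEmbedding K (e.repr (integralBasis K j) i • e i) =
      ((e.repr (integralBasis K j) i : ℚ) : ℝ) • mixedEmbedding K (e i) := by
    rw [map_rat_smul (mixedEmbedding K)]
    rw [Rat.cast_smul_eq_qsmul]
  rw [this]
  exact Submodule.smul_mem _ _ (Submodule.subset_span ⟨i, rfl⟩)

open NumberField.mixedEmbedding in
theorem exists_sq_mixedEmbedding (K : Type*) [Field K] [NumberField K] (a : K)
    (ha : ∀ σ : K →+* ℝ, 0 < σ a) : ∃ s : mixedSpace K, s * s = mixedEmbedding K a := by
  have h2 : ∀ w : {w : InfinitePlace K // w.IsComplex}, ∃ z : ℂ, z * z = w.1.embedding a := by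
    intro w
    obtain ⟨z, hz⟩ := IsAlgClosed.exists_pow_nat_eq (w.1.embedding a) two_pos
    exact ⟨z, by rw [← sq, hz]⟩
  choose z hz using h2
  refine ⟨(fun w => Real.sqrt ((mixedEmbedding K a).1 w), z), ?_⟩
  refine Prod.ext ?_ ?_
  · ext w
    simp only [Prod.fst_mul, Pi.mul_apply]
    refine Real.mul_self_sqrt (le_of_lt ?_)
    rw [mixedEmbedding_apply_isReal]
    exact ha _
  · ext w
    simp only [Prod.snd_mul, Pi.mul_apply, mixedEmbedding_apply_isComplex]
    exact hz w

open NumberField.mixedEmbedding in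
/-- Trace forms scaled by an element that is positive at all real places have the same
signature. -/
theorem sum_sign_trace_form_eq (K : Type*) [Field K] [NumberField K] {ι ι' : Type*} [Fintype ι]
    [Fintype ι'] (l a : K) (ha : ∀ σ : K →+* ℝ, 0 < σ a) (e : Module.Basis ι ℚ K)
    (e' : Module.Basis ι' ℚ K)
    (he : ∀ i j, i ≠ j → Algebra.trace ℚ K (l * e i * e j) = 0)
    (he0 : ∀ i, Algebra.trace ℚ K (l * e i * e i) ≠ 0)
    (he' : ∀ i j, i ≠ j → Algebra.trace ℚ K (l * a * e' i * e' j) = 0)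
    (he0' : ∀ i, Algebra.trace ℚ K (l * a * e' i * e' i) ≠ 0) :
    ∑ i, (SignType.sign (Algebra.trace ℚ K (l * e i * e i)) : ℤ) =
      ∑ i, (SignType.sign (Algebra.trace ℚ K (l * a * e' i * e' i)) : ℤ) := by
  classical
  obtain ⟨T, hT⟩ := exists_linearMap_trace K
  by_cases ha0 : a = 0
  · have hempty : IsEmpty ι' := ⟨fun i => he0' i (by simp [ha0])⟩
    have h1 : Module.finrank ℚ K = 0 := by
      rw [Module.finrank_eq_card_basis e', Fintype.card_eq_zero]
    exact absurd h1 Module.finrank_pos.ne'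
  obtain ⟨s, hs⟩ := exists_sq_mixedEmbedding K a ha
  let B : mixedSpace K →ₗ[ℝ] mixedSpace K →ₗ[ℝ] ℝ :=
    LinearMap.compr₂ (LinearMap.mul ℝ (mixedSpace K))
      (T ∘ₗ LinearMap.mulLeft ℝ (mixedEmbedding K l))
  have hB : ∀ x y, B x y = T (mixedEmbedding K l * (x * y)) := fun x y => rfl
  have hfr : Module.finrank ℝ (mixedSpace K) = Module.finrank ℚ K := mixedEmbedding.finrank K
  let v := basisOfTopLeSpanOfCardEqFinrank (fun i => mixedEmbedding K (e i))
    (mixedSpace_span_basis K e) (by rw [hfr, Module.finrank_eq_card_basis e])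
  have hv : ∀ i, v i = mixedEmbedding K (e i) := fun i => by simp [v]
  let t := mixedEmbedding K a⁻¹ * s
  have hts : s * t = 1 := by
    simp only [t]
    rw [mul_left_comm, hs, ← map_mul, inv_mul_cancel₀ ha0, map_one]
  let E : mixedSpace K ≃ₗ[ℝ] mixedSpace K :=
    LinearEquiv.ofLinearMap (LinearMap.mulLeft ℝ s) (LinearMap.mulLeft ℝ t)
      (LinearMap.ext fun x => by
        rw [LinearMap.comp_apply, LinearMap.mulLeft_apply, LinearMap.mulLeft_apply, ← mul_assoc,
          hts, one_mul, LinearMap.id_apply])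
      (LinearMap.ext fun x => by
        rw [LinearMap.comp_apply, LinearMap.mulLeft_apply, LinearMap.mulLeft_apply, ← mul_assoc,
          mul_comm t, hts, one_mul, LinearMap.id_apply])
  let w := (basisOfTopLeSpanOfCardEqFinrank (fun i => mixedEmbedding K (e' i))
    (mixedSpace_span_basis K e') (by rw [hfr, Module.finrank_eq_card_basis e'])).map E
  have hw : ∀ i, w i = s * mixedEmbedding K (e' i) := fun i => by simp [w, E]
  have hBv : ∀ i j, B (v i) (v j) = ((Algebra.trace ℚ K (l * e i * e j) : ℚ) : ℝ) := by
    intro i j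
    rw [hB, hv, hv, ← map_mul, ← map_mul, hT, mul_assoc]
  have hBw : ∀ i j, B (w i) (w j) = ((Algebra.trace ℚ K (l * a * e' i * e' j) : ℚ) : ℝ) := by
    intro i j
    rw [hB, hw, hw, mul_mul_mul_comm, hs, ← map_mul, ← map_mul, ← map_mul, hT]
    congr 2
    ring
  have h1 := card_pos_le_card_pos_of_orthogonal B v w (fun i j h => by rw [hBv, he i j h]; simp)
    (fun i j h => by rw [hBw, he' i j h]; simp) (fun i => by rw [hBw]; exact_mod_cast he0' i)
  have h2 := card_pos_le_card_pos_of_orthogonal B w v (fun i j h => by rw [hBw, he' i j h]; simp)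
    (fun i j h => by rw [hBv, he i j h]; simp) (fun i => by rw [hBv]; exact_mod_cast he0 i)
  have s1 := sum_sign_eq (fun i => B (v i) (v i)) (fun i => by rw [hBv]; exact_mod_cast he0 i)
  have s2 := sum_sign_eq (fun i => B (w i) (w i)) (fun i => by rw [hBw]; exact_mod_cast he0' i)
  have hc : Fintype.card ι = Fintype.card ι' := by
    rw [← Module.finrank_eq_card_basis e, ← Module.finrank_eq_card_basis e']
  have hsgn : ∀ q : ℚ, SignType.sign (q : ℝ) = SignType.sign q := by
    intro q
    rcases lt_trichotomy q 0 with h | h | h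
    · rw [sign_neg h, sign_neg (by exact_mod_cast h)]
    · simp [h]
    · rw [sign_pos h, sign_pos (by exact_mod_cast h)]
  simp only [hBv, hsgn] at s1
  simp only [hBw, hsgn] at s2
  rw [s1, s2, hc]
  simp only [hBv, hBw] at h1 h2
  congr 3
  exact le_antisymm h1 h2

theorem exists_sq_of_sub_one_nilpotent {R : Type*} [CommRing R] [Finite R] (h2 : IsUnit (2 : R))
    {u : R} (hu : IsNilpotent (u - 1)) : ∃ v : R, v ^ 2 = u := by
  let T := {x : R // IsNilpotent (x - 1)}
  let f : T → T := fun x => ⟨x.1 ^ 2, by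
    have : x.1 ^ 2 - 1 = (x.1 + 1) * (x.1 - 1) := by ring
    rw [this]
    exact (Commute.all _ _).isNilpotent_mul_left x.2⟩
  have hf : Function.Injective f := by
    rintro ⟨x, hx⟩ ⟨y, hy⟩ h
    have h1 : x ^ 2 = y ^ 2 := congrArg Subtype.val h
    have h3 : IsNilpotent ((x - 1) + (y - 1)) := (Commute.all _ _).isNilpotent_add hx hy
    have h4 : IsUnit (x + y) := by
      have := h3.isUnit_add_left_of_commute h2 (Commute.all _ _)
      rwa [show 2 + (x - 1 + (y - 1)) = x + y by ring] at this
    have h5 : (x + y) * (x - y) = 0 := by linear_combination h1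
    exact Subtype.ext (sub_eq_zero.1 (h4.mul_right_eq_zero.1 h5))
  obtain ⟨⟨v, hv⟩, h⟩ := (Finite.injective_iff_surjective.1 hf) ⟨u, hu⟩
  exact ⟨v, congrArg Subtype.val h⟩

open Polynomial in
theorem FiniteField.exists_sq_sub_mul_sq {F : Type*} [Field F] [Finite F] (h2 : (2 : F) ≠ 0)
    {a : F} (ha : a ≠ 0) (n : F) : ∃ x y : F, x ^ 2 - a * y ^ 2 = n := by
  classical
  have := Fintype.ofFinite F
  have hodd : Fintype.card F % 2 = 1 := FiniteField.odd_card_of_char_ne_two (fun h => h2 (by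
    have := ringChar.Nat.cast_ringChar (R := F)
    rw [h] at this
    exact_mod_cast this))
  obtain ⟨x, y, h⟩ := FiniteField.exists_root_sum_quadratic (f := X ^ 2 - C n)
    (g := C (-a) * X ^ 2) (degree_X_pow_sub_C two_pos n)
    (degree_C_mul_X_pow 2 (neg_ne_zero.2 ha)) hodd
  refine ⟨x, y, ?_⟩
  simp only [eval_sub, eval_pow, eval_X, eval_C, eval_mul] at h
  linear_combination h

theorem exists_sq_sub_mul_sq {R : Type*} [CommRing R] [Finite R] (h2 : IsUnit (2 : R))
    {a n : R} (ha : IsUnit a) (hn : IsUnit n) : ∃ x y : R, x ^ 2 - a * y ^ 2 = n := by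
  let q := IsArtinianRing.quotNilradicalEquivPi R
  have hfield : ∀ I : MaximalSpectrum R, ∃ x y : R ⧸ I.asIdeal,
      x ^ 2 - Ideal.Quotient.mk I.asIdeal a * y ^ 2 = Ideal.Quotient.mk I.asIdeal n := by
    intro I
    have := I.isMaximal
    let _ := Ideal.Quotient.field I.asIdeal
    have : Finite (R ⧸ I.asIdeal) := Finite.of_surjective _ Ideal.Quotient.mk_surjective
    have h2' : (2 : R ⧸ I.asIdeal) ≠ 0 := by
      have := (h2.map (Ideal.Quotient.mk I.asIdeal)).ne_zero
      rwa [map_ofNat] at this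
    exact FiniteField.exists_sq_sub_mul_sq h2' (ha.map (Ideal.Quotient.mk I.asIdeal)).ne_zero _
  choose x y hxy using hfield
  obtain ⟨x0, hx0⟩ := Ideal.Quotient.mk_surjective (q.symm x)
  obtain ⟨y0, hy0⟩ := Ideal.Quotient.mk_surjective (q.symm y)
  have h1 : Ideal.Quotient.mk (nilradical R) (x0 ^ 2 - a * y0 ^ 2) =
      Ideal.Quotient.mk (nilradical R) n := by
    apply q.injective
    rw [map_sub, map_mul, map_pow, map_pow, hx0, hy0, map_sub, map_mul, map_pow, map_pow,
      AlgEquiv.apply_symm_apply, AlgEquiv.apply_symm_apply]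
    ext I
    exact hxy I
  rw [Ideal.Quotient.eq, mem_nilradical] at h1
  obtain ⟨n', hn'⟩ := hn.exists_right_inv
  obtain ⟨v, hv⟩ := exists_sq_of_sub_one_nilpotent h2 (u := n' * (x0 ^ 2 - a * y0 ^ 2)) (by
    have : n' * (x0 ^ 2 - a * y0 ^ 2) - 1 = n' * (x0 ^ 2 - a * y0 ^ 2 - n) := by
      linear_combination hn'
    rw [this]
    exact (Commute.all _ _).isNilpotent_mul_left h1)
  have hvu : IsUnit v := by
    have h3 : IsUnit (n' * (x0 ^ 2 - a * y0 ^ 2)) := by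
      have h4 : IsNilpotent (n' * (x0 ^ 2 - a * y0 ^ 2) - 1) := by
        have : n' * (x0 ^ 2 - a * y0 ^ 2) - 1 = n' * (x0 ^ 2 - a * y0 ^ 2 - n) := by
          linear_combination hn'
        rw [this]
        exact (Commute.all _ _).isNilpotent_mul_left h1
      have := h4.isUnit_add_left_of_commute isUnit_one (Commute.all _ _)
      rwa [add_sub_cancel] at this
    rw [← hv] at h3
    exact (isUnit_pow_iff two_ne_zero).1 h3
  obtain ⟨w, hw⟩ := hvu.exists_right_inv
  refine ⟨x0 * w, y0 * w, ?_⟩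
  have hw2 : v ^ 2 * w ^ 2 = 1 := by rw [← mul_pow, hw, one_pow]
  have h3 : n * v ^ 2 = x0 ^ 2 - a * y0 ^ 2 := by rw [hv, ← mul_assoc, hn', one_mul]
  linear_combination n * hw2 - w ^ 2 * h3

theorem sum_comp_norm_mul {R : Type*} [CommRing R] [Fintype R] (h2 : IsUnit (2 : R))
    {a n : R} (ha : IsUnit a) (hn : IsUnit n) (f : R → ℂ) :
    ∑ w : R × R, f (n * (w.1 ^ 2 - a * w.2 ^ 2)) = ∑ w : R × R, f (w.1 ^ 2 - a * w.2 ^ 2) := by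
  obtain ⟨x, y, hxy⟩ := exists_sq_sub_mul_sq h2 ha hn
  let φ : R × R → R × R := fun w => (x * w.1 + a * y * w.2, x * w.2 + y * w.1)
  have hφ : Function.Bijective φ := by
    rw [← Finite.injective_iff_bijective]
    rintro ⟨u, v⟩ ⟨u', v'⟩ h
    have h1 : x * u + a * y * v = x * u' + a * y * v' := congrArg Prod.fst h
    have h3 : x * v + y * u = x * v' + y * u' := congrArg Prod.snd h
    refine Prod.ext (hn.mul_left_cancel ?_) (hn.mul_left_cancel ?_) <;> dsimp only <;> rw [← hxy]
    · linear_combination x * h1 - a * y * h3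
    · linear_combination x * h3 - y * h1
  rw [← Function.Bijective.sum_comp hφ fun w => f (w.1 ^ 2 - a * w.2 ^ 2)]
  refine Finset.sum_congr rfl fun w _ => ?_
  congr 1
  simp only [φ]
  rw [← hxy]
  ring

theorem sum_sq_add_sum_nonsquare_mul_sq {F : Type*} [Field F] [Fintype F] (h2 : (2 : F) ≠ 0)
    {n : F} (hn : ¬ IsSquare n) (ψ : F → ℂ) (hψ : ∑ x, ψ x = 0) :
    ∑ x, ψ (x ^ 2) + ∑ x, ψ (n * x ^ 2) = 0 := by
  classical
  have hn0 : n ≠ 0 := by rintro rfl; exact hn ⟨0, by simp⟩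
  have hchar : ringChar F ≠ 2 := fun h => h2 (by
    have := ringChar.Nat.cast_ringChar (R := F)
    rw [h] at this
    exact_mod_cast this)
  have hcount : ∀ g : F → ℂ, ∑ x, g (x ^ 2) = ∑ z, ((quadraticChar F z + 1 : ℤ) : ℂ) * g z := by
    intro g
    rw [← Finset.sum_fiberwise_of_maps_to (s := Finset.univ) (t := Finset.univ)
      (g := fun x : F => x ^ 2) (fun _ _ => Finset.mem_univ _)]
    refine Finset.sum_congr rfl fun z _ => ?_
    rw [← quadraticChar_card_sqrts hchar z, Finset.sum_congr rfl (g := fun _ => g z),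
      Finset.sum_const, nsmul_eq_mul]
    · congr 2
      congr 1
      ext x
      simp
    · intro x hx
      rw [(Finset.mem_filter.1 hx).2]
  have h1 := hcount ψ
  have h3 := hcount fun z => ψ (n * z)
  have h4 : ∑ z, ((quadraticChar F z + 1 : ℤ) : ℂ) * ψ (n * z) =
      ∑ z, ((-quadraticChar F z + 1 : ℤ) : ℂ) * ψ z := by
    rw [← Equiv.sum_comp (Equiv.mulLeft₀ n hn0) fun z => ((-quadraticChar F z + 1 : ℤ) : ℂ) * ψ z]
    refine Finset.sum_congr rfl fun z _ => ?_
    rw [Equiv.mulLeft₀_apply, map_mul, quadraticChar_neg_one_iff_not_isSquare.2 hn]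
    simp
  rw [h1, h3, h4, ← Finset.sum_add_distrib]
  have : ∀ z, ((quadraticChar F z + 1 : ℤ) : ℂ) * ψ z + ((-quadraticChar F z + 1 : ℤ) : ℂ) * ψ z =
      2 * ψ z := by
    intro z
    push_cast
    ring
  rw [Finset.sum_congr rfl fun z _ => this z, ← Finset.mul_sum, hψ, mul_zero]

theorem sum_binary_form_prod {k R : Type*} [Field k] [Fintype k] [CommRing R] [Fintype R]
    (ψ : AddChar (k × R) ℂ) (a n : k × R) (ha : a.1 = 0) :
    ∑ w : (k × R) × (k × R), ψ (n * (w.1 ^ 2 - a * w.2 ^ 2)) =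
      ((Fintype.card k : ℂ) * ∑ x : k, ψ (n.1 * x ^ 2, 0)) *
        ∑ w : R × R, ψ (0, n.2 * (w.1 ^ 2 - a.2 * w.2 ^ 2)) := by
  have h1 : ∀ w : (k × R) × (k × R), ψ (n * (w.1 ^ 2 - a * w.2 ^ 2)) =
      ψ (n.1 * w.1.1 ^ 2, 0) * ψ (0, n.2 * (w.1.2 ^ 2 - a.2 * w.2.2 ^ 2)) := by
    intro w
    rw [← AddChar.map_add_eq_mul]
    congr 1
    ext <;> simp [ha]
  simp only [h1, Fintype.sum_prod_type, Finset.mul_sum, Finset.sum_mul]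
  simp only [← Finset.mul_sum, ← Finset.sum_mul]
  simp only [Finset.sum_const, Finset.card_univ, nsmul_eq_mul]
  simp only [Finset.mul_sum, Finset.sum_mul]
  refine Finset.sum_congr rfl fun x _ => ?_
  refine Finset.sum_congr rfl fun y _ => ?_
  refine Finset.sum_congr rfl fun z _ => ?_
  ring

/-- Two binary quadratic forms of the same discriminant `a` over a finite ring with a residue
field `k` in which `a` vanishes cannot both have positive character sums if one represents a
square unit and the other a nonsquare unit in `k`. -/
theorem not_both_sums_pos {R k R' : Type*} [CommRing R] [Fintype R] [Field k] [Fintype k]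
    [CommRing R'] [Fintype R'] (e : R ≃+* k × R') (h2 : IsUnit (2 : R)) (a n t m m' : R)
    (ha1 : (e a).1 = 0) (ha2 : IsUnit (e a).2) (hn : IsUnit n) (hnsq : ¬ IsSquare (e n).1)
    (hm : 4 * m = t ^ 2 - a) (hm' : 4 * (n * m') = t ^ 2 - a) (ψ : AddChar R ℂ)
    (hψ : ∃ x : k, ψ (e.symm (x, 0)) ≠ 1) (r r' : ℝ) (hr : 0 < r) (hr' : 0 < r')
    (hS : ∑ w : R × R, ψ (w.1 ^ 2 + t * w.1 * w.2 + m * w.2 ^ 2) = r)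
    (hS' : ∑ w : R × R, ψ (n * w.1 ^ 2 + t * w.1 * w.2 + m' * w.2 ^ 2) = r') : False := by
  classical
  obtain ⟨i, hi⟩ := h2.exists_right_inv
  have hcomplete : ∀ u μ : R, IsUnit u → 4 * (u * μ) = t ^ 2 - a →
      ∑ w : R × R, ψ (u * w.1 ^ 2 + t * w.1 * w.2 + μ * w.2 ^ 2) =
        ∑ w : R × R, ψ (u * (w.1 ^ 2 - a * w.2 ^ 2)) := by
    intro u μ hu hμ
    obtain ⟨v, hv⟩ := hu.exists_right_inv
    let φ : R × R → R × R := fun w => (w.1 + t * i * v * w.2, i * v * w.2)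
    have hφ : Function.Bijective φ := by
      rw [← Finite.injective_iff_bijective]
      rintro ⟨x, y⟩ ⟨x', y'⟩ h
      have h1 : x + t * i * v * y = x' + t * i * v * y' := congrArg Prod.fst h
      have h3 : i * v * y = i * v * y' := congrArg Prod.snd h
      refine Prod.ext ?_ ?_ <;> dsimp only
      · linear_combination h1 - t * h3
      · linear_combination 2 * u * h3 - (u * v * (y - y')) * hi - (y - y') * hv
    rw [← Function.Bijective.sum_comp hφ fun w => ψ (u * (w.1 ^ 2 - a * w.2 ^ 2))]
    refine Finset.sum_congr rfl fun w _ => ?_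
    congr 1
    simp only [φ]
    have e2 : 4 * i ^ 2 = 1 := by linear_combination (2 * i + 1) * hi
    have e3 : u ^ 2 * v ^ 2 = 1 := by linear_combination (u * v + 1) * hv
    have e4 : u * (i * v) ^ 2 * (t ^ 2 - a) = μ := by
      rw [← hμ]
      linear_combination μ * (u ^ 2 * v ^ 2) * e2 + μ * e3
    linear_combination (-w.2 ^ 2) * e4 - t * w.1 * w.2 * (hi + 2 * i * hv)
  have h1 := hcomplete 1 m isUnit_one (by rw [one_mul, hm])
  have h3 := hcomplete n m' hn hm'
  simp only [one_mul] at h1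
  rw [hS] at h1
  rw [hS'] at h3
  let ψ' : AddChar (k × R') ℂ := ψ.compAddMonoidHom (e.symm : k × R' →+ R)
  have hψ' : ∀ x, ψ' x = ψ (e.symm x) := fun x => rfl
  have htrans : ∀ u : R, ∑ w : R × R, ψ (u * (w.1 ^ 2 - a * w.2 ^ 2)) =
      ∑ w : (k × R') × (k × R'), ψ' (e u * (w.1 ^ 2 - e a * w.2 ^ 2)) := by
    intro u
    rw [← Equiv.sum_comp (e.toEquiv.prodCongr e.toEquiv)]
    refine Finset.sum_congr rfl fun w _ => ?_
    rw [hψ']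
    congr 1
    simp
  have h4 := htrans 1
  simp only [one_mul] at h4
  rw [h4, sum_binary_form_prod ψ' (e a) (e 1) ha1] at h1
  rw [htrans n, sum_binary_form_prod ψ' (e a) (e n) ha1] at h3
  have hu2 : IsUnit (2 : R') := by
    have := ((h2.map e).map (RingHom.snd k R'))
    rwa [map_ofNat, map_ofNat] at this
  have hk2 : (2 : k) ≠ 0 := by
    have := ((h2.map e).map (RingHom.fst k R')).ne_zero
    rwa [map_ofNat, map_ofNat] at this
  have hnu : IsUnit (e n).2 := (hn.map e).map (RingHom.snd k R')
  rw [sum_comp_norm_mul hu2 ha2 hnu fun z => ψ' (0, z)] at h3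
  simp only [map_one, Prod.fst_one, Prod.snd_one, one_mul] at h1
  have hsum0 : ∑ x : k, ψ' (x, 0) = 0 := by
    have := AddChar.sum_eq_zero_of_ne_one (ψ := ψ'.compAddMonoidHom (AddMonoidHom.inl k R'))
      (AddChar.ne_one_iff.2 (by obtain ⟨x, hx⟩ := hψ; exact ⟨x, hx⟩))
    exact this
  have h5 := sum_sq_add_sum_nonsquare_mul_sq hk2 hnsq (fun z => ψ' (z, 0)) hsum0
  have h6 : (r : ℂ) + r' = 0 := by
    rw [h1, h3, ← add_mul, ← mul_add, h5]
    ring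
  have h7 : r + r' = 0 := by exact_mod_cast h6
  linarith

theorem apply_sum_smul_sum_smul_of_orthogonal {V κ : Type*} [AddCommGroup V] [Module ℚ V]
    [Fintype κ] (B : V →ₗ[ℚ] V →ₗ[ℚ] ℚ) (u : κ → V) (hu : ∀ i j, i ≠ j → B (u i) (u j) = 0)
    (c c' : κ → ℚ) :
    B (∑ i, c i • u i) (∑ i, c' i • u i) = ∑ i, c i * c' i * B (u i) (u i) := by
  simp only [map_sum, LinearMap.sum_apply, map_smul, LinearMap.smul_apply, smul_eq_mul]
  refine Finset.sum_congr rfl fun i _ => ?_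
  rw [Finset.sum_eq_single i]
  · ring
  · intro j _ hj
    rw [hu j i hj]
    ring
  · simp

/-- Coordinate-free form of `sum_quadratic_lattice_pos`. -/
theorem sum_bilinear_lattice_pos {V ι : Type*} [AddCommGroup V] [Module ℚ V] [Fintype ι]
    (B : V →ₗ[ℚ] V →ₗ[ℚ] ℚ) (v : Module.Basis ι ℚ V)
    (hv : ∀ i j, i ≠ j → B (v i) (v j) = 0) (hv0 : ∀ i, B (v i) (v i) ≠ 0)
    (hs : ∑ i, (SignType.sign (B (v i) (v i)) : ℤ) = 0) (M Λ : AddSubgroup V)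
    (hΛ : ∀ i, v i ∈ Λ) (hM : ∀ w, w ∈ M ↔ ∀ z ∈ Λ, ∃ n : ℤ, B w z = n)
    (hq : ∀ z ∈ Λ, ∃ n : ℤ, B z z = 2 * n)
    {S : Type*} [AddCommGroup S] [Fintype S] (ρ : M →+ S) (hρ : Function.Surjective ρ)
    (hρ0 : ∀ (i : ι) (w : M), (w : V) = v i → ρ w = 0) (Ψ : S → ℂ)
    (hΨ : ∀ w : M, Ψ (ρ w) = ratExp (B w w / 2)) :
    ∃ r : ℝ, 0 < r ∧ ∑ s, Ψ s = r := by
  classical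
  choose a ha using fun i => hq (v i) (hΛ i)
  let T : (ι → ℚ) ≃ₗ[ℚ] V := v.equivFun.symm
  have hT : ∀ w, T w = ∑ i, w i • v i := fun w => v.equivFun_symm_apply w
  have hTs : ∀ i, T (Pi.single i 1) = v i := fun i => by
    rw [hT, Finset.sum_eq_single i] <;> simp +contextual
  have hB : ∀ w z, B (T w) (T z) = ∑ i, 2 * a i * w i * z i := by
    intro w z
    rw [hT, hT, apply_sum_smul_sum_smul_of_orthogonal B v hv]
    refine Finset.sum_congr rfl fun i _ => ?_
    rw [ha]
    ring
  have hB2 : ∀ w, B (T w) (T w) = 2 * ∑ i, a i * w i ^ 2 := by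
    intro w
    rw [hB, Finset.mul_sum]
    refine Finset.sum_congr rfl fun i _ => ?_
    ring
  have hcomap : ∀ w : M.comap (T : (ι → ℚ) →+ V), T (w : ι → ℚ) ∈ M := fun w => w.2
  refine sum_quadratic_lattice_pos a ?_ ?_ (M.comap (T : (ι → ℚ) →+ V))
    (Λ.comap (T : (ι → ℚ) →+ V)) ?_ ?_ ?_ (ρ.comp ((T : (ι → ℚ) →+ V).addSubgroupComap M)) ?_ ?_
    Ψ ?_
  · intro i h
    apply hv0 i
    rw [ha, h]
    simp
  · rw [← hs]
    refine Finset.sum_congr rfl fun i _ => ?_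
    rw [ha, Int.sign_eq_sign]
    rcases lt_trichotomy (a i) 0 with h | h | h
    · rw [sign_neg h, sign_neg]
      have : (a i : ℚ) < 0 := by exact_mod_cast h
      linarith
    · simp [h]
    · rw [sign_pos h, sign_pos]
      have : (0 : ℚ) < a i := by exact_mod_cast h
      linarith
  · intro i
    change T (Pi.single i 1) ∈ Λ
    rw [hTs]
    exact hΛ i
  · intro w
    change T w ∈ M ↔ ∀ z, T z ∈ Λ → _
    rw [hM]
    constructor
    · intro h z hz
      obtain ⟨n, hn⟩ := h _ hz
      exact ⟨n, by rw [← hn, hB]⟩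
    · intro h z hz
      obtain ⟨n, hn⟩ := h (T.symm z) (by rwa [T.apply_symm_apply])
      exact ⟨n, by rw [← hn, ← hB, T.apply_symm_apply]⟩
  · intro z hz
    obtain ⟨n, hn⟩ := hq (T z) hz
    refine ⟨n, ?_⟩
    rw [hB2] at hn
    linarith
  · refine hρ.comp ?_
    rintro ⟨w, hw⟩
    refine ⟨⟨T.symm w, ?_⟩, ?_⟩
    · change T (T.symm w) ∈ M
      rwa [T.apply_symm_apply]
    · exact Subtype.ext (T.apply_symm_apply w)
  · rintro i ⟨w, hw⟩ h
    refine hρ0 i _ ?_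
    change T w = _
    rw [← hTs, ← h]
  · rintro ⟨w, hw⟩
    refine (hΨ _).trans ?_
    congr 1
    change B (T w) (T w) / 2 = _
    rw [hB2]
    ring

theorem trace_natCast_mul (K : Type*) [Field K] [NumberField K] (n : ℕ) (x : K) :
    Algebra.trace ℚ K (n * x) = n * Algebra.trace ℚ K x := by
  rw [← nsmul_eq_mul, map_nsmul, nsmul_eq_mul]

theorem exists_basis_trace_orthogonal (K : Type*) [Field K] [NumberField K] {l : K} (hl : l ≠ 0) :
    ∃ e : Module.Basis (Fin (Module.finrank ℚ K)) ℚ K,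
      (∀ i j, i ≠ j → Algebra.trace ℚ K (l * e i * e j) = 0) ∧
      ∀ i, Algebra.trace ℚ K (l * e i * e i) ≠ 0 := by
  let B : LinearMap.BilinForm ℚ K := LinearMap.mk₂ ℚ (fun x y => Algebra.trace ℚ K (l * x * y))
    (fun x y z => by simp only [mul_add, add_mul, map_add])
    (fun c x y => by simp only [mul_smul_comm, smul_mul_assoc, map_smul])
    (fun x y z => by simp only [mul_add, map_add])
    (fun c x y => by simp only [mul_smul_comm, map_smul])
  have hB : ∀ x y, B x y = Algebra.trace ℚ K (l * x * y) := fun x y => rfl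
  have hsymm : LinearMap.IsSymm B := ⟨fun x y => by
    rw [RingHom.id_apply, hB, hB]
    congr 1
    ring⟩
  have := invertibleOfNonzero (two_ne_zero' ℚ)
  obtain ⟨e, he⟩ := LinearMap.BilinForm.exists_orthogonal_basis hsymm
  have he' : ∀ i j, i ≠ j → B (e i) (e j) = 0 := fun i j hij => he hij
  refine ⟨e, he', fun i hi => ?_⟩
  have h0 : B (e i) = 0 := by
    refine e.ext fun j => ?_
    by_cases hij : i = j
    · subst hij
      exact hi
    · exact he' i j hij
  have h1 : B (e i) (1 / (l * e i)) = 0 := by rw [h0]; rfl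
  rw [hB, mul_one_div_cancel (mul_ne_zero hl (e.ne_zero i)), Algebra.trace_eq_matrix_trace e] at h1
  simp [Module.finrank_pos.ne'] at h1

theorem exists_nat_mul_mem_ideal (K : Type*) [Field K] [NumberField K] (s : Finset K)
    {I : Ideal (𝓞 K)} (hI : I ≠ ⊥) :
    ∃ N : ℕ, N ≠ 0 ∧ ∀ x ∈ s, ∃ y ∈ I, (N : K) * x = algebraMap (𝓞 K) K y := by
  obtain ⟨b, hb⟩ := IsLocalization.exist_integer_multiples_of_finset (nonZeroDivisors (𝓞 K)) s
  have hb0 : (b : 𝓞 K) ≠ 0 := nonZeroDivisors.coe_ne_zero b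
  have hJ : Ideal.span {(b : 𝓞 K)} * I ≠ ⊥ := mul_ne_zero (by simp) hI
  refine ⟨Ideal.absNorm (Ideal.span {(b : 𝓞 K)} * I), Ideal.absNorm_eq_zero_iff.not.2 hJ,
    fun x hx => ?_⟩
  obtain ⟨h, hh, hbh⟩ := Ideal.mem_span_singleton_mul.1 (Ideal.absNorm_mem
    (Ideal.span {(b : 𝓞 K)} * I))
  obtain ⟨z, hz⟩ := hb x hx
  refine ⟨h * z, I.mul_mem_right _ hh, ?_⟩
  have h1 : algebraMap (𝓞 K) K b * algebraMap (𝓞 K) K h =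
      (Ideal.absNorm (Ideal.span {(b : 𝓞 K)} * I) : K) := by
    rw [← map_mul, hbh, map_natCast]
  rw [← h1, map_mul, hz]
  change _ = algebraMap (𝓞 K) K h * ((b : 𝓞 K) • x)
  rw [Algebra.smul_def]
  ring

theorem sum_binary_form_pos (K : Type*) [Field K] [NumberField K] {a δ : 𝓞 K} (ha0 : a ≠ 0)
    (hδ : δ ≠ 0) (ha : ∀ σ : K →+* ℝ, 0 < σ (algebraMap (𝓞 K) K a)) {H : Ideal (𝓞 K)}
    (hH : H ≠ ⊥)
    (hdual : ∀ w : K, (∀ h ∈ H, ∃ n : ℤ, Algebra.trace ℚ K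
      (w * algebraMap (𝓞 K) K h / algebraMap (𝓞 K) K δ) = n) ↔
        ∃ o : 𝓞 K, algebraMap (𝓞 K) K o = w)
    {α t γ : 𝓞 K} (hα : α ≠ 0) (hd : 4 * (α * γ) = t ^ 2 - a)
    [Fintype (𝓞 K ⧸ Ideal.span {a} * H)] (ψ : 𝓞 K ⧸ Ideal.span {a} * H → ℂ)
    (hψ : ∀ z : 𝓞 K, ψ (Ideal.Quotient.mk _ z) = ratExp (Algebra.trace ℚ K
      (algebraMap (𝓞 K) K z / algebraMap (𝓞 K) K (a * δ)))) :
    ∃ r : ℝ, 0 < r ∧ ∑ w : (𝓞 K ⧸ Ideal.span {a} * H) × (𝓞 K ⧸ Ideal.span {a} * H),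
      ψ (Ideal.Quotient.mk _ α * w.1 ^ 2 + Ideal.Quotient.mk _ t * w.1 * w.2 +
        Ideal.Quotient.mk _ γ * w.2 ^ 2) = r := by
  classical
  let ι := algebraMap (𝓞 K) K
  have hι : Function.Injective ι := FaithfulSMul.algebraMap_injective _ _
  have hne : ∀ {x : 𝓞 K}, x ≠ 0 → ι x ≠ 0 := fun h => (map_ne_zero_iff ι hι).2 h
  have hdK : 4 * (ι α * ι γ) = ι t ^ 2 - ι a := by
    have := congrArg ι hd
    simpa only [map_mul, map_sub, map_pow, map_ofNat] using this
  have ha0K := hne ha0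
  have hδK := hne hδ
  have hαK := hne hα
  let l : K := 1 / (ι α * ι a * ι δ)
  have hl : l ≠ 0 := one_div_ne_zero (mul_ne_zero (mul_ne_zero hαK ha0K) hδK)
  obtain ⟨e, he, he0⟩ := exists_basis_trace_orthogonal K hl
  obtain ⟨e', he', he0'⟩ := exists_basis_trace_orthogonal K (mul_ne_zero hl ha0K)
  have hsign := sum_sign_trace_form_eq K l (ι a) ha e e' he he0 he' he0'
  obtain ⟨N, hN0, hN⟩ := exists_nat_mul_mem_ideal K
    (Finset.univ.image (fun i => e i / ι α) ∪ (Finset.univ.image (fun i => -(ι t * e' i / ι α)) ∪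
      Finset.univ.image (fun i => 2 * e' i)))
    (I := Ideal.span {a} * H) (mul_ne_zero (by simpa using ha0) hH)
  have hNK : (N : K) ≠ 0 := Nat.cast_ne_zero.2 hN0
  have hNe : ∀ i, ∃ y ∈ H, N * (e i / ι α) = ι (a * y) := fun i => by
    obtain ⟨y, hy, h⟩ := hN (e i / ι α) (by simp)
    obtain ⟨z, hz, rfl⟩ := Ideal.mem_span_singleton_mul.1 hy
    exact ⟨z, hz, h⟩
  have hNe' : ∀ i, ∃ y ∈ H, N * (-(ι t * e' i / ι α)) = ι (a * y) := fun i => by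
    obtain ⟨y, hy, h⟩ := hN (-(ι t * e' i / ι α)) (by simp)
    obtain ⟨z, hz, rfl⟩ := Ideal.mem_span_singleton_mul.1 hy
    exact ⟨z, hz, h⟩
  have hNe'' : ∀ i, ∃ y ∈ H, N * (2 * e' i) = ι (a * y) := fun i => by
    obtain ⟨y, hy, h⟩ := hN (2 * e' i) (by simp)
    obtain ⟨z, hz, rfl⟩ := Ideal.mem_span_singleton_mul.1 hy
    exact ⟨z, hz, h⟩
  let B : K × K →ₗ[ℚ] K × K →ₗ[ℚ] ℚ := LinearMap.mk₂ ℚ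
    (fun x y => Algebra.trace ℚ K ((2 * ι α * x.1 * y.1 + ι t * (x.1 * y.2 + x.2 * y.1) +
      2 * ι γ * x.2 * y.2) / (ι a * ι δ)))
    (fun x y z => by
      rw [← map_add]; congr 1; simp only [Prod.fst_add, Prod.snd_add]; ring)
    (fun c x y => by
      rw [← map_smul]; congr 1; simp only [Prod.smul_fst, Prod.smul_snd]
      simp only [Algebra.smul_def]; ring)
    (fun x y z => by
      rw [← map_add]; congr 1; simp only [Prod.fst_add, Prod.snd_add]; ring)
    (fun c x y => by
      rw [← map_smul]; congr 1; simp only [Prod.smul_fst, Prod.smul_snd]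
      simp only [Algebra.smul_def]; ring)
  have hB : ∀ x y, B x y = Algebra.trace ℚ K ((2 * ι α * x.1 * y.1 +
      ι t * (x.1 * y.2 + x.2 * y.1) + 2 * ι γ * x.2 * y.2) / (ι a * ι δ)) := fun x y => rfl
  let φ : (K × K) ≃ₗ[ℚ] (K × K) :=
    { toFun := fun x => (N * (x.1 - ι t * x.2) / ι α, 2 * N * x.2)
      invFun := fun x => ((ι α * x.1 + ι t * x.2 / 2) / N, x.2 / (2 * N))
      map_add' := fun x y => by
        refine Prod.ext ?_ ?_ <;> simp only [Prod.fst_add, Prod.snd_add] <;> ring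
      map_smul' := fun c x => by
        refine Prod.ext ?_ ?_ <;>
          simp only [Prod.smul_fst, Prod.smul_snd, RingHom.id_apply] <;>
            simp only [Algebra.smul_def] <;> ring
      left_inv := fun x => by
        refine Prod.ext ?_ ?_ <;> dsimp only <;> field_simp
        ring
      right_inv := fun x => by
        refine Prod.ext ?_ ?_ <;> dsimp only <;> field_simp
        ring }
  have hφ : ∀ x, φ x = (N * (x.1 - ι t * x.2) / ι α, 2 * N * x.2) := fun x => rfl
  let v := (e.prod e').map φ
  have hvl : ∀ i, v (Sum.inl i) = (N * e i / ι α, 0) := fun i => by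
    simp [v, hφ]
  have hvr : ∀ i, v (Sum.inr i) = (N * (- (ι t * e' i)) / ι α, 2 * N * e' i) := fun i => by
    simp [v, hφ]
  have hBll : ∀ i j, B (v (Sum.inl i)) (v (Sum.inl j)) =
      ((2 * N ^ 2 : ℕ) : ℚ) * Algebra.trace ℚ K (l * e i * e j) := by
    intro i j
    rw [hvl, hvl, hB, ← trace_natCast_mul]
    congr 1
    simp only [l]
    push_cast
    field_simp
    ring
  have hBlr : ∀ i j, B (v (Sum.inl i)) (v (Sum.inr j)) = 0 := by
    intro i j
    rw [hvl, hvr, hB, ← map_zero (Algebra.trace ℚ K)]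
    congr 1
    field_simp
    ring
  have hBrl : ∀ i j, B (v (Sum.inr i)) (v (Sum.inl j)) = 0 := by
    intro i j
    rw [hvl, hvr, hB, ← map_zero (Algebra.trace ℚ K)]
    congr 1
    field_simp
    ring
  have hBrr : ∀ i j, B (v (Sum.inr i)) (v (Sum.inr j)) =
      -(((2 * N ^ 2 : ℕ) : ℚ) * Algebra.trace ℚ K (l * ι a * e' i * e' j)) := by
    intro i j
    rw [hvr, hvr, hB, ← trace_natCast_mul, ← map_neg]
    congr 1
    simp only [l]
    push_cast
    field_simp
    linear_combination (e' i * e' j) * hdK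
  have hc : (0 : ℚ) < ((2 * N ^ 2 : ℕ) : ℚ) := by positivity
  let Λ : AddSubgroup (K × K) :=
    { carrier := {z | ∃ x ∈ H, ∃ y ∈ H, z = (ι (2 * γ * x - t * y), ι (2 * α * y - t * x))}
      zero_mem' := ⟨0, H.zero_mem, 0, H.zero_mem, by simp; rfl⟩
      add_mem' := by
        rintro _ _ ⟨x, hx, y, hy, rfl⟩ ⟨x', hx', y', hy', rfl⟩
        refine ⟨x + x', H.add_mem hx hx', y + y', H.add_mem hy hy', ?_⟩
        refine Prod.ext ?_ ?_ <;> simp only [Prod.mk_add_mk, ← map_add] <;> congr 1 <;> ring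
      neg_mem' := by
        rintro _ ⟨x, hx, y, hy, rfl⟩
        refine ⟨-x, H.neg_mem hx, -y, H.neg_mem hy, ?_⟩
        refine Prod.ext ?_ ?_ <;> simp only [Prod.neg_mk, ← map_neg] <;> congr 1 <;> ring }
  have hmemΛ : ∀ z, z ∈ Λ ↔ ∃ x ∈ H, ∃ y ∈ H,
      z = (ι (2 * γ * x - t * y), ι (2 * α * y - t * x)) := fun z => Iff.rfl
  have haH : ∀ x ∈ H, ∀ y ∈ H, (ι (a * x), ι (a * y)) ∈ Λ := by
    intro x hx y hy
    rw [hmemΛ]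
    refine ⟨-(2 * α * x + t * y), H.neg_mem (H.add_mem (H.mul_mem_left _ hx)
      (H.mul_mem_left _ hy)), -(t * x + 2 * γ * y), H.neg_mem (H.add_mem (H.mul_mem_left _ hx)
      (H.mul_mem_left _ hy)), ?_⟩
    refine Prod.ext ?_ ?_ <;> dsimp only <;> congr 1
    · linear_combination x * hd
    · linear_combination y * hd
  have hv : ∀ i, ∃ x ∈ H, ∃ y ∈ H, v i = (ι (a * x), ι (a * y)) := by
    rintro (i | i)
    · obtain ⟨x, hx, h⟩ := hNe i
      exact ⟨x, hx, 0, H.zero_mem, by rw [hvl, ← h]; simp [mul_div_assoc]⟩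
    · obtain ⟨x, hx, h⟩ := hNe' i
      obtain ⟨y, hy, h'⟩ := hNe'' i
      refine ⟨x, hx, y, hy, ?_⟩
      rw [hvr, ← h, ← h']
      refine Prod.ext ?_ ?_ <;> dsimp only <;> ring
  let f : 𝓞 K × 𝓞 K →+ K × K := (ι : 𝓞 K →+ K).prodMap (ι : 𝓞 K →+ K)
  have hf : Function.Injective f := fun x y h =>
    Prod.ext (hι (congrArg Prod.fst h)) (hι (congrArg Prod.snd h))
  have hfa : ∀ x, f x = (ι x.1, ι x.2) := fun x => rfl
  let E := AddMonoidHom.ofInjective hf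
  let m : 𝓞 K →+ 𝓞 K ⧸ Ideal.span {a} * H := (Ideal.Quotient.mk (Ideal.span {a} * H)).toAddMonoidHom
  let ρ : f.range →+ (𝓞 K ⧸ Ideal.span {a} * H) × (𝓞 K ⧸ Ideal.span {a} * H) :=
    (m.prodMap m).comp (E.symm : f.range →+ 𝓞 K × 𝓞 K)
  have hρ : ∀ x (w : f.range), (w : K × K) = f x →
      ρ w = (Ideal.Quotient.mk _ x.1, Ideal.Quotient.mk _ x.2) := by
    intro x w h
    have : w = E x := Subtype.ext h
    subst this
    change (m.prodMap m) (E.symm (E x)) = _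
    rw [E.symm_apply_apply]
    rfl
  have hBΛ : ∀ w x y, B w (ι (2 * γ * x - t * y), ι (2 * α * y - t * x)) =
      -Algebra.trace ℚ K (w.1 * ι x / ι δ) - Algebra.trace ℚ K (w.2 * ι y / ι δ) := by
    intro w x y
    rw [hB, ← map_neg, ← map_sub]
    congr 1
    simp only [map_sub, map_mul, map_ofNat]
    field_simp
    linear_combination (w.1 * ι x + w.2 * ι y) * hdK
  refine sum_bilinear_lattice_pos B v ?_ ?_ ?_ f.range Λ ?_ ?_ ?_ ρ ?_ ?_
    (fun w => ψ (Ideal.Quotient.mk _ α * w.1 ^ 2 + Ideal.Quotient.mk _ t * w.1 * w.2 +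
        Ideal.Quotient.mk _ γ * w.2 ^ 2)) ?_
  · rintro (i | i) (j | j) hij
    · rw [hBll, he i j (fun h => hij (by rw [h])), mul_zero]
    · exact hBlr i j
    · exact hBrl i j
    · rw [hBrr, he' i j (fun h => hij (by rw [h])), mul_zero, neg_zero]
  · rintro (i | i)
    · rw [hBll]
      exact mul_ne_zero hc.ne' (he0 i)
    · rw [hBrr]
      exact neg_ne_zero.2 (mul_ne_zero hc.ne' (he0' i))
  · simp only [Fintype.sum_sum_type, hBll, hBrr, sign_mul, sign_pos hc, one_mul, Left.sign_neg]
    simp only [SignType.coe_neg, Finset.sum_neg_distrib]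
    rw [hsign, add_neg_cancel]
  · intro i
    obtain ⟨x, hx, y, hy, h⟩ := hv i
    rw [h]
    exact haH x hx y hy
  · intro w
    constructor
    · rintro ⟨o, rfl⟩ z ⟨x, hx, y, hy, rfl⟩
      obtain ⟨n1, h1⟩ := (hdual (ι o.1)).2 ⟨_, rfl⟩ x hx
      obtain ⟨n2, h2⟩ := (hdual (ι o.2)).2 ⟨_, rfl⟩ y hy
      refine ⟨-n1 - n2, ?_⟩
      rw [hBΛ, hfa]
      dsimp only
      rw [h1, h2]
      push_cast
      rfl
    · intro h
      obtain ⟨o1, h1⟩ := (hdual w.1).1 fun x hx => by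
        obtain ⟨n, hn⟩ := h _ ((hmemΛ _).2 ⟨x, hx, 0, H.zero_mem, rfl⟩)
        rw [hBΛ] at hn
        refine ⟨-n, ?_⟩
        push_cast
        rw [← hn]
        simp [ι]
      obtain ⟨o2, h2⟩ := (hdual w.2).1 fun x hx => by
        obtain ⟨n, hn⟩ := h _ ((hmemΛ _).2 ⟨0, H.zero_mem, x, hx, rfl⟩)
        rw [hBΛ] at hn
        refine ⟨-n, ?_⟩
        push_cast
        rw [← hn]
        simp [ι]
      exact ⟨(o1, o2), Prod.ext h1 h2⟩
  · rintro z ⟨x, hx, y, hy, rfl⟩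
    have hmem : γ * x ^ 2 - t * x * y + α * y ^ 2 ∈ H := by
      have : γ * x ^ 2 - t * x * y + α * y ^ 2 = (γ * x - t * y) * x + α * y * y := by ring
      rw [this]
      exact H.add_mem (H.mul_mem_left _ hx) (H.mul_mem_left _ hy)
    obtain ⟨n, hn⟩ := (hdual 1).2 ⟨1, map_one _⟩ _ hmem
    refine ⟨-n, ?_⟩
    rw [hBΛ]
    push_cast
    rw [mul_neg, ← hn, ← map_neg, ← map_sub,
      show (2 : ℚ) = ((2 : ℕ) : ℚ) by norm_num, ← trace_natCast_mul, ← map_neg]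
    congr 1
    simp only [ι, map_sub, map_mul, map_ofNat, map_add, map_pow]
    push_cast
    ring
  · rintro ⟨x, y⟩
    obtain ⟨x, rfl⟩ := Ideal.Quotient.mk_surjective x
    obtain ⟨y, rfl⟩ := Ideal.Quotient.mk_surjective y
    exact ⟨⟨f (x, y), (x, y), rfl⟩, hρ (x, y) _ rfl⟩
  · rintro i w hw
    obtain ⟨x, hx, y, hy, h⟩ := hv i
    rw [hρ (a * x, a * y) w (by rw [hw, h, hfa])]
    refine Prod.ext ?_ ?_ <;> refine Ideal.Quotient.eq_zero_iff_mem.2 ?_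
    · exact Ideal.mul_mem_mul (Ideal.mem_span_singleton_self a) hx
    · exact Ideal.mul_mem_mul (Ideal.mem_span_singleton_self a) hy
  · rintro ⟨_, o, rfl⟩
    rw [hρ o _ rfl]
    dsimp only
    simp only [← map_pow, ← map_mul, ← map_add]
    rw [hψ]
    congr 1
    rw [hB, hfa, eq_div_iff two_ne_zero, mul_comm, show (2 : ℚ) = ((2 : ℕ) : ℚ) by norm_num,
      ← trace_natCast_mul]
    congr 1
    simp only [ι, map_mul, map_add, map_pow]
    push_cast
    ring

theorem forall_mul_mem_differentIdeal_iff (K : Type*) [Field K] [NumberField K] (x : K) :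
    (∀ d ∈ differentIdeal ℤ (𝓞 K), ∃ o : 𝓞 K, algebraMap (𝓞 K) K o = x * algebraMap (𝓞 K) K d) ↔
      ∀ o : 𝓞 K, ∃ n : ℤ, Algebra.trace ℚ K (x * algebraMap (𝓞 K) K o) = n := by
  have h1 : ((differentIdeal ℤ (𝓞 K) : Ideal (𝓞 K)) : FractionalIdeal (nonZeroDivisors (𝓞 K)) K)⁻¹
      = FractionalIdeal.dual ℤ ℚ 1 := by
    rw [coeIdeal_differentIdeal ℤ ℚ K (𝓞 K), inv_inv]
  have h2 : ((differentIdeal ℤ (𝓞 K) : Ideal (𝓞 K)) : FractionalIdeal (nonZeroDivisors (𝓞 K)) K)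
      ≠ 0 := by
    rw [coeIdeal_differentIdeal ℤ ℚ K (𝓞 K)]
    simp
  have h3 : x ∈ ((differentIdeal ℤ (𝓞 K) : Ideal (𝓞 K)) :
      FractionalIdeal (nonZeroDivisors (𝓞 K)) K)⁻¹ ↔ 
        x ∈ FractionalIdeal.dual ℤ ℚ (1 : FractionalIdeal (nonZeroDivisors (𝓞 K)) K) := by rw [h1]
  rw [FractionalIdeal.mem_inv_iff h2, FractionalIdeal.mem_dual
    (one_ne_zero' (FractionalIdeal (nonZeroDivisors (𝓞 K)) K))] at h3
  constructor
  · intro h o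
    obtain ⟨n, hn⟩ := h3.1 (by
      intro y hy
      obtain ⟨d, hd, rfl⟩ := (FractionalIdeal.mem_coeIdeal _).1 hy
      obtain ⟨o, ho⟩ := h d hd
      exact (FractionalIdeal.mem_one_iff _).2 ⟨o, ho⟩) (algebraMap (𝓞 K) K o)
        ((FractionalIdeal.mem_one_iff _).2 ⟨o, rfl⟩)
    exact ⟨n, hn.symm⟩
  · intro h d hd
    refine (FractionalIdeal.mem_one_iff _).1 (h3.2 ?_ _ (FractionalIdeal.mem_coeIdeal_of_mem _ hd))
    intro y hy
    obtain ⟨o, rfl⟩ := (FractionalIdeal.mem_one_iff _).1 hy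
    obtain ⟨n, hn⟩ := h o
    exact ⟨n, hn.symm⟩

theorem trace_dual_of_span_eq_mul (K : Type*) [Field K] [NumberField K] {δ : 𝓞 K} (hδ : δ ≠ 0)
    {H : Ideal (𝓞 K)} (hH : Ideal.span {δ} = differentIdeal ℤ (𝓞 K) * H) (w : K) :
    (∀ h ∈ H, ∃ n : ℤ, Algebra.trace ℚ K
      (w * algebraMap (𝓞 K) K h / algebraMap (𝓞 K) K δ) = n) ↔
        ∃ o : 𝓞 K, algebraMap (𝓞 K) K o = w := by
  have hδK : algebraMap (𝓞 K) K δ ≠ 0 := by simpa using hδ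
  constructor
  · intro h
    have h1 : ∀ z ∈ differentIdeal ℤ (𝓞 K) * H, ∃ o : 𝓞 K,
        algebraMap (𝓞 K) K o = w * algebraMap (𝓞 K) K z / algebraMap (𝓞 K) K δ := by
      intro z hz
      refine Submodule.mul_induction_on hz ?_ ?_
      · intro d hd y hy
        have h2 := (forall_mul_mem_differentIdeal_iff K
          (w * algebraMap (𝓞 K) K y / algebraMap (𝓞 K) K δ)).2 (fun o => by
            obtain ⟨n, hn⟩ := h (y * o) (H.mul_mem_right _ hy)
            refine ⟨n, ?_⟩
            rw [← hn, map_mul (algebraMap (𝓞 K) K)]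
            congr 1
            ring) d hd
        obtain ⟨o, ho⟩ := h2
        refine ⟨o, ?_⟩
        rw [ho, map_mul]
        ring
      · rintro x y ⟨o, ho⟩ ⟨o', ho'⟩
        refine ⟨o + o', ?_⟩
        rw [map_add, ho, ho', map_add]
        ring
    obtain ⟨o, ho⟩ := h1 δ (hH ▸ Ideal.mem_span_singleton_self δ)
    exact ⟨o, by rw [ho, mul_div_cancel_right₀ _ hδK]⟩
  · rintro ⟨o, rfl⟩ h hh
    have h2 := (forall_mul_mem_differentIdeal_iff K
      (algebraMap (𝓞 K) K h / algebraMap (𝓞 K) K δ)).1 (fun d hd => by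
        have h3 : d * h ∈ Ideal.span {δ} := hH ▸ Ideal.mul_mem_mul hd hh
        obtain ⟨c, hc⟩ := Ideal.mem_span_singleton.1 h3
        refine ⟨c, ?_⟩
        have := congrArg (algebraMap (𝓞 K) K) hc
        rw [map_mul, map_mul] at this
        field_simp
        linear_combination -this) o
    obtain ⟨n, hn⟩ := h2
    refine ⟨n, ?_⟩
    rw [← hn]
    congr 1
    ring

theorem exists_different_generator (K : Type*) [Field K] [NumberField K] {m : 𝓞 K}
    (hm : ¬ IsUnit m) (hm0 : m ≠ 0) : ∃ (δ : 𝓞 K) (H : Ideal (𝓞 K)), δ ≠ 0 ∧ H ≠ ⊥ ∧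
      Ideal.span {δ} = differentIdeal ℤ (𝓞 K) * H ∧ IsCoprime (Ideal.span {m}) H := by
  have hD : differentIdeal ℤ (𝓞 K) ≠ 0 := differentIdeal_ne_bot
  have hm' : Ideal.span {m} ≠ 0 := by simpa using hm0
  obtain ⟨δ, hδ⟩ := IsDedekindDomain.exists_sup_span_eq
    (I := Ideal.span {m} * differentIdeal ℤ (𝓞 K)) Ideal.mul_le_right (mul_ne_zero hm' hD)
  have hle : Ideal.span {δ} ≤ differentIdeal ℤ (𝓞 K) := hδ ▸ le_sup_right
  obtain ⟨H, hH⟩ := Ideal.dvd_iff_le.2 hle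
  have hcop : Ideal.span {m} ⊔ H = ⊤ := by
    rw [hH, mul_comm (Ideal.span {m}), ← Ideal.mul_sup] at hδ
    have : differentIdeal ℤ (𝓞 K) * (Ideal.span {m} ⊔ H) = differentIdeal ℤ (𝓞 K) * 1 := by
      rw [hδ, mul_one]
    rw [mul_left_cancel₀ hD this, Ideal.one_eq_top]
  have hH0 : H ≠ ⊥ := by
    rintro rfl
    rw [sup_bot_eq, Ideal.span_singleton_eq_top] at hcop
    exact hm hcop
  refine ⟨δ, H, ?_, hH0, hH, Ideal.isCoprime_iff_sup_eq.2 hcop⟩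
  rintro rfl
  rw [Ideal.span_singleton_eq_bot.2 rfl] at hH
  exact mul_ne_zero hD hH0 hH.symm

theorem exists_addChar_quotient (K : Type*) [Field K] [NumberField K] {a δ : 𝓞 K} (ha0 : a ≠ 0)
    (hδ : δ ≠ 0) {H : Ideal (𝓞 K)}
    (htr : ∀ h ∈ H, ∃ n : ℤ, Algebra.trace ℚ K (algebraMap (𝓞 K) K h / algebraMap (𝓞 K) K δ) = n) :
    ∃ ψ : AddChar (𝓞 K ⧸ Ideal.span {a} * H) ℂ, ∀ z : 𝓞 K, ψ (Ideal.Quotient.mk _ z) =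
      ratExp (Algebra.trace ℚ K (algebraMap (𝓞 K) K z / algebraMap (𝓞 K) K (a * δ))) := by
  have haK : algebraMap (𝓞 K) K a ≠ 0 := by simpa using ha0
  have hδK : algebraMap (𝓞 K) K δ ≠ 0 := by simpa using hδ
  let f : 𝓞 K → ℂ := fun z =>
    ratExp (Algebra.trace ℚ K (algebraMap (𝓞 K) K z / algebraMap (𝓞 K) K (a * δ)))
  have hadd : ∀ x y, f (x + y) = f x * f y := fun x y => by
    simp only [f]
    rw [map_add, add_div, map_add, ratExp_add]
  have hone : ∀ x ∈ Ideal.span {a} * H, f x = 1 := by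
    intro x hx
    obtain ⟨h, hh, rfl⟩ := Ideal.mem_span_singleton_mul.1 hx
    rw [ratExp_eq_one_iff]
    obtain ⟨n, hn⟩ := htr h hh
    refine ⟨n, ?_⟩
    rw [← hn]
    congr 1
    rw [map_mul, map_mul]
    field_simp
  have hwd : ∀ x y, Ideal.Quotient.mk (Ideal.span {a} * H) x = Ideal.Quotient.mk _ y →
      f x = f y := by
    intro x y hxy
    rw [← sub_add_cancel x y, hadd, hone _ (Ideal.Quotient.eq.1 hxy), one_mul]
  let s := Function.surjInv (Ideal.Quotient.mk_surjective (I := Ideal.span {a} * H))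
  have hs : ∀ r, Ideal.Quotient.mk (Ideal.span {a} * H) (s r) = r := Function.surjInv_eq _
  refine ⟨⟨fun r => f (s r), ?_, ?_⟩, ?_⟩
  · exact hone _ (Ideal.Quotient.eq_zero_iff_mem.1 (hs 0))
  · intro x y
    rw [← hadd]
    exact hwd _ _ (by rw [map_add, hs, hs, hs])
  · intro z
    exact hwd _ _ (hs _)

theorem not_isSquare_mod_contradiction (K : Type*) [Field K] [NumberField K] {a : 𝓞 K}
    (haP : (Ideal.span {a}).IsPrime) (ha0 : a ≠ 0) (h2 : (2 : 𝓞 K) ∉ Ideal.span {a})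
    (ha : ∀ σ : K →+* ℝ, 0 < σ (algebraMap (𝓞 K) K a)) {N t N' : 𝓞 K}
    (hd : t ^ 2 - a = 4 * (N * N')) (hN : N ∉ Ideal.span {a})
    (hNsq : ¬ IsSquare (Ideal.Quotient.mk (Ideal.span {a}) N)) : False := by
  classical
  have hspan0 : Ideal.span {a} ≠ ⊥ := by simpa using ha0
  have hmax : (Ideal.span {a}).IsMaximal := haP.isMaximal hspan0
  have hN0 : N ≠ 0 := by rintro rfl; exact hN (Ideal.zero_mem _)
  have hau : ¬ IsUnit a := fun h => haP.ne_top (Ideal.span_singleton_eq_top.2 h)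
  obtain ⟨δ, H, hδ, hH0, hH, hcop⟩ := exists_different_generator K (m := 2 * a * N)
    (fun h => hau (isUnit_of_dvd_unit ⟨2 * N, by ring⟩ h))
    (mul_ne_zero (mul_ne_zero two_ne_zero ha0) hN0)
  have hdual := trace_dual_of_span_eq_mul K hδ hH
  have hcopx : ∀ x : 𝓞 K, x ∣ 2 * a * N → IsCoprime (Ideal.span {x}) H := fun x hx => by
    obtain ⟨c, hc⟩ := hx
    rw [hc, ← Ideal.span_singleton_mul_span_singleton] at hcop
    exact hcop.of_mul_left_left
  have hcopa : IsCoprime (Ideal.span {a}) H := hcopx a ⟨2 * N, by ring⟩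
  have hunitH : ∀ x : 𝓞 K, x ∣ 2 * a * N → IsUnit (Ideal.Quotient.mk H x) := fun x hx => by
    obtain ⟨u, hu, v, hv, huv⟩ := Ideal.isCoprime_iff_exists.1 (hcopx x hx)
    obtain ⟨c, rfl⟩ := Ideal.mem_span_singleton.1 hu
    refine IsUnit.of_mul_eq_one (Ideal.Quotient.mk H c) ?_
    rw [← map_mul, ← map_one (Ideal.Quotient.mk H), Ideal.Quotient.eq, ← huv]
    simpa using hv
  let := Ideal.Quotient.field (Ideal.span {a})
  have hunita : ∀ x : 𝓞 K, x ∉ Ideal.span {a} → IsUnit (Ideal.Quotient.mk (Ideal.span {a}) x) :=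
    fun x hx => isUnit_iff_ne_zero.2 (fun h => hx (Ideal.Quotient.eq_zero_iff_mem.1 h))
  let e := Ideal.quotientMulEquivQuotientProd (Ideal.span {a}) H hcopa
  have he1 : ∀ x : 𝓞 K, (e (Ideal.Quotient.mk _ x)).1 = Ideal.Quotient.mk _ x := fun x => rfl
  have he2 : ∀ x : 𝓞 K, (e (Ideal.Quotient.mk _ x)).2 = Ideal.Quotient.mk _ x := fun x => rfl
  have hunit : ∀ x : 𝓞 K, x ∉ Ideal.span {a} → x ∣ 2 * a * N →
      IsUnit (Ideal.Quotient.mk (Ideal.span {a} * H) x) := by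
    intro x hx hx'
    rw [← MulEquiv.isUnit_map e, Prod.isUnit_iff, he1, he2]
    exact ⟨hunita x hx, hunitH x hx'⟩
  have := Ideal.finiteQuotientOfFreeOfNeBot (Ideal.span {a} * H) (mul_ne_zero hspan0 hH0)
  have := Ideal.finiteQuotientOfFreeOfNeBot (Ideal.span {a}) hspan0
  have := Ideal.finiteQuotientOfFreeOfNeBot H hH0
  let := Fintype.ofFinite (𝓞 K ⧸ Ideal.span {a} * H)
  let := Fintype.ofFinite (𝓞 K ⧸ Ideal.span {a})
  let := Fintype.ofFinite (𝓞 K ⧸ H)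
  obtain ⟨ψ, hψ⟩ := exists_addChar_quotient K ha0 hδ (H := H) (fun h hh => by
    obtain ⟨n, hn⟩ := (hdual 1).2 ⟨1, map_one _⟩ h hh
    exact ⟨n, by rw [← hn, one_mul]⟩)
  obtain ⟨r, hr, hS⟩ := sum_binary_form_pos K ha0 hδ ha hH0 hdual (α := 1) (t := t) (γ := N * N')
    one_ne_zero (by rw [hd, one_mul]) ψ hψ
  obtain ⟨r', hr', hS'⟩ := sum_binary_form_pos K ha0 hδ ha hH0 hdual (α := N) (t := t) (γ := N')
    hN0 (by rw [hd]) ψ hψ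
  refine not_both_sums_pos e ?_ (Ideal.Quotient.mk _ a) (Ideal.Quotient.mk _ N)
    (Ideal.Quotient.mk _ t) (Ideal.Quotient.mk _ (N * N')) (Ideal.Quotient.mk _ N') ?_ ?_ ?_ ?_ ?_
    ?_ ψ ?_ r r' hr hr' ?_ hS'
  · have := hunit 2 h2 ⟨a * N, by ring⟩
    rwa [map_ofNat] at this
  · rw [he1]
    exact Ideal.Quotient.eq_zero_iff_mem.2 (Ideal.mem_span_singleton_self a)
  · rw [he2]
    exact hunitH a ⟨2 * N, by ring⟩
  · exact hunit N hN ⟨2 * a, by ring⟩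
  · rw [he1]
    exact hNsq
  · rw [← map_pow, ← map_sub, hd, map_mul _ 4, map_ofNat]
  · rw [← map_pow, ← map_sub, hd, map_mul, map_mul _ N, map_ofNat]
  · by_contra! h
    have h1 : ∃ o : 𝓞 K, algebraMap (𝓞 K) K o = 1 / algebraMap (𝓞 K) K a := by
      refine (hdual _).1 fun z hz => ?_
      have h3 := h (Ideal.Quotient.mk _ z)
      have h4 : e.symm (Ideal.Quotient.mk _ z, 0) = Ideal.Quotient.mk _ z := by
        rw [RingEquiv.symm_apply_eq]
        refine Prod.ext (he1 z).symm ?_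
        rw [he2]
        exact (Ideal.Quotient.eq_zero_iff_mem.2 hz).symm
      rw [h4, hψ, ratExp_eq_one_iff] at h3
      obtain ⟨n, hn⟩ := h3
      refine ⟨n, ?_⟩
      rw [← hn, map_mul]
      congr 1
      field_simp
    obtain ⟨o, ho⟩ := h1
    have haK : algebraMap (𝓞 K) K a ≠ 0 := by simpa using ha0
    rw [eq_div_iff haK, ← map_mul, ← map_one (algebraMap (𝓞 K) K)] at ho
    exact hau (IsUnit.of_mul_eq_one o
      (by rw [mul_comm]; exact FaithfulSMul.algebraMap_injective (𝓞 K) K ho))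
  · rw [← hS]
    refine Finset.sum_congr rfl fun w _ => ?_
    rw [map_one, one_mul]

section Dedekind

variable {R : Type*} [CommRing R] [IsDedekindDomain R]

/-- `a` is a square modulo every power of the prime `v`. -/
def IsAdicSquare (v : HeightOneSpectrum R) (a : R) : Prop :=
  ∀ k : ℕ, ∃ t : R, t ^ 2 - a ∈ v.asIdeal ^ k

theorem exists_hensel_step {v : HeightOneSpectrum R} {a t : R} (h2 : (2 : R) ∉ v.asIdeal)
    (ha : a ∉ v.asIdeal) {k : ℕ} (ht : t ^ 2 - a ∈ v.asIdeal ^ (k + 1)) :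
    ∃ s : R, s ^ 2 - a ∈ v.asIdeal ^ (k + 2) ∧ s - t ∈ v.asIdeal ^ (k + 1) := by
  have htv : 2 * t ∉ v.asIdeal := by
    rw [v.isPrime.mul_mem_iff_mem_or_mem, not_or]
    refine ⟨h2, fun h => ha ?_⟩
    have h1 := Ideal.pow_le_self (Nat.succ_ne_zero k) ht
    have h3 := sub_mem (Ideal.mul_mem_right t _ h) h1
    rwa [show t * t - (t ^ 2 - a) = a by ring] at h3
  obtain ⟨u, i, hi, hu⟩ := v.isMaximal.exists_inv htv
  refine ⟨t - (t ^ 2 - a) * u, ?_, ?_⟩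
  · have h4 : (t - (t ^ 2 - a) * u) ^ 2 - a =
        (t ^ 2 - a) * i + (t ^ 2 - a) * (t ^ 2 - a) * u ^ 2 := by
      have : i = 1 - u * (2 * t) := by rw [← hu]; ring
      rw [this]; ring
    rw [h4]
    refine add_mem ?_ (Ideal.mul_mem_right _ _ ?_)
    · rw [pow_succ]
      exact Ideal.mul_mem_mul ht hi
    · rw [pow_succ]
      exact Ideal.mul_mem_mul ht (Ideal.pow_le_self (Nat.succ_ne_zero k) ht)
  · rw [sub_sub_cancel_left, neg_mem_iff]
    exact Ideal.mul_mem_right _ _ ht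

theorem exists_hensel_sequence {v : HeightOneSpectrum R} {a x : R} (h2 : (2 : R) ∉ v.asIdeal)
    (ha : a ∉ v.asIdeal) (hx : x ^ 2 - a ∈ v.asIdeal) :
    ∃ f : ℕ → R, ∀ k, f k ^ 2 - a ∈ v.asIdeal ^ (k + 1) ∧ f (k + 1) - f k ∈ v.asIdeal ^ (k + 1) := by
  choose s hs hs' using fun (k : ℕ) (t : {t : R // t ^ 2 - a ∈ v.asIdeal ^ (k + 1)}) =>
    exists_hensel_step h2 ha t.2
  let F : ∀ k : ℕ, {t : R // t ^ 2 - a ∈ v.asIdeal ^ (k + 1)} := fun k =>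
    Nat.rec ⟨x, by simpa using hx⟩ (fun k t => ⟨s k t, hs k t⟩) k
  refine ⟨fun k => (F k).1, fun k => ⟨(F k).2, ?_⟩⟩
  exact hs' k (F k)

theorem IsAdicSquare.of_sq_sub_mem {v : HeightOneSpectrum R} {a x : R} (h2 : (2 : R) ∉ v.asIdeal)
    (ha : a ∉ v.asIdeal) (hx : x ^ 2 - a ∈ v.asIdeal) : IsAdicSquare v a := by
  obtain ⟨f, hf⟩ := exists_hensel_sequence h2 ha hx
  exact fun k => ⟨f k, Ideal.pow_le_pow_right (Nat.le_succ k) (hf k).1⟩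

theorem exists_sq_sub_mem {a : R} (I : Ideal R) (hI : I ≠ 0)
    (h : ∀ v : HeightOneSpectrum R, v.asIdeal ∣ I → IsAdicSquare v a) :
    ∃ t : R, t ^ 2 - a ∈ I := by
  revert hI h
  refine UniqueFactorizationMonoid.induction_on_coprime I ?_ ?_ ?_ ?_
  · exact fun h => absurd rfl h
  · intro x hx _ _
    rw [Ideal.isUnit_iff] at hx
    exact ⟨0, by simp [hx]⟩
  · intro p i hp _ h
    rcases Nat.eq_zero_or_pos i with rfl | hi
    · exact ⟨0, by simp⟩
    · exact h ⟨p, Ideal.isPrime_of_prime hp, hp.ne_zero⟩ (dvd_pow_self _ hi.ne') i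
  · intro x y hxy hx hy h0 h
    obtain ⟨t, ht⟩ := hx (left_ne_zero_of_mul h0) fun v hv => h v (hv.mul_right y)
    obtain ⟨s, hs⟩ := hy (right_ne_zero_of_mul h0) fun v hv => h v (hv.mul_left x)
    have hc : IsCoprime x y := by
      rw [Ideal.isCoprime_iff_gcd]
      have := hxy (gcd_dvd_left x y) (gcd_dvd_right x y)
      rwa [Ideal.isUnit_iff, ← Ideal.one_eq_top] at this
    obtain ⟨i, hi, j, hj, hij⟩ := Ideal.isCoprime_iff_exists.1 hc
    refine ⟨t * j + s * i, ?_⟩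
    rw [Ideal.mul_eq_inf_of_isCoprime hc]
    have hj1 : j = 1 - i := by rw [← hij]; ring
    have hi1 : i = 1 - j := by rw [← hij]; ring
    constructor
    · have : (t * j + s * i) ^ 2 - a = (t ^ 2 - a) + i * ((s - t) * (2 * t + (s - t) * i)) := by
        rw [hj1]; ring
      rw [this]
      exact add_mem ht (Ideal.mul_mem_right _ _ hi)
    · have : (t * j + s * i) ^ 2 - a = (s ^ 2 - a) + j * ((t - s) * (2 * s + (t - s) * j)) := by
        rw [hi1]; ring
      rw [this]
      exact add_mem hs (Ideal.mul_mem_right _ _ hj)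

theorem exists_eq_sq_mul_squarefree (I : Ideal R) (hI : I ≠ 0) :
    ∃ J L : Ideal R, I = J ^ 2 * L ∧ Squarefree L := by
  revert hI
  refine WfDvdMonoid.induction_on_irreducible I ?_ ?_ ?_
  · exact fun h => absurd rfl h
  · exact fun u hu _ => ⟨1, u, by rw [one_pow, one_mul], hu.squarefree⟩
  · intro x p hx hp ih _
    obtain ⟨J, L, hJ, hL⟩ := ih hx
    by_cases hpL : p ∣ L
    · obtain ⟨L', rfl⟩ := hpL
      exact ⟨p * J, L', by rw [hJ]; ring, hL.squarefree_of_dvd (Dvd.intro_left p rfl)⟩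
    · refine ⟨J, p * L, by rw [hJ]; ring, ?_⟩
      exact squarefree_mul_iff.2 ⟨(hp.isRelPrime_iff_not_dvd).2 hpL, hp.squarefree, hL⟩

theorem odd_multiplicity_of_dvd_squarefree {J L p : Ideal R} (hJ : J ≠ 0) (hp : Prime p)
    (hL : Squarefree L) (hpL : p ∣ L) : Odd (multiplicity p (J ^ 2 * L)) := by
  have hL0 : L ≠ 0 := hL.ne_zero
  have hf : ∀ {X : Ideal R}, X ≠ 0 → FiniteMultiplicity p X := fun hX =>
    FiniteMultiplicity.of_prime_left hp hX
  have h1 : multiplicity p L = 1 := by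
    refine (hf hL0).multiplicity_eq_iff.2 ⟨by simpa using hpL, fun h => hp.not_isUnit (hL p ?_)⟩
    rwa [← pow_two]
  rw [multiplicity_mul hp (hf (mul_ne_zero (pow_ne_zero 2 hJ) hL0)),
    FiniteMultiplicity.multiplicity_pow hp (hf hJ), h1]
  exact ⟨_, rfl⟩

theorem even_multiplicity_of_isSquare_valuation {K : Type*} [Field K] [Algebra R K]
    [IsFractionRing R K] {v : HeightOneSpectrum R} {r : R} (hr : r ≠ 0)
    (h : IsSquare (v.valuation K (algebraMap R K r))) :
    Even (multiplicity v.asIdeal (Ideal.span {r})) := by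
  rw [v.valuation_of_algebraMap, v.intValuation_eq_exp_neg_multiplicity hr] at h
  obtain ⟨y, hy⟩ := h
  have hy0 : y ≠ 0 := by
    rintro rfl
    simp at hy
  have := congrArg WithZero.log hy
  rw [WithZero.log_exp, WithZero.log_mul hy0 hy0] at this
  have h2 : Even (-(multiplicity v.asIdeal (Ideal.span {r}) : ℤ)) := ⟨_, this⟩
  rw [even_neg] at h2
  exact_mod_cast h2

end Dedekind

theorem exists_sq_sub_mem_of_norm_form {R : Type*} [CommRing R] [IsDedekindDomain R] {a x y : R}
    {v : HeightOneSpectrum R} {J F : Ideal R} (hJ0 : J ≠ 0)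
    (hx : Ideal.span {y} ⊔ Ideal.span {x} = J) (hF : Ideal.span {x ^ 2 - a * y ^ 2} = J ^ 2 * F)
    (hv : v.asIdeal ∣ F) : ∃ z, z ^ 2 - a ∈ v.asIdeal := by
  have hxJ : x ∈ J := by
    rw [← hx]
    exact Ideal.mem_sup_right (Ideal.mem_span_singleton_self x)
  have hyJ : y ∈ J := by
    rw [← hx]
    exact Ideal.mem_sup_left (Ideal.mem_span_singleton_self y)
  have hJv : J * v.asIdeal ≠ 0 := mul_ne_zero hJ0 v.ne_bot
  obtain ⟨β, hβ⟩ := IsDedekindDomain.exists_sup_span_eq (I := J * v.asIdeal) (J := J)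
    Ideal.mul_le_left hJv
  have hβJ : β ∈ J := by
    rw [← hβ]
    exact Ideal.mem_sup_right (Ideal.mem_span_singleton_self β)
  obtain ⟨J', hJ'⟩ := Ideal.dvd_span_singleton.2 hβJ
  have hJ'v : ¬ J' ≤ v.asIdeal := by
    intro h
    have h3 : J * v.asIdeal = J := by
      refine le_antisymm Ideal.mul_le_left ?_
      conv_lhs => rw [← hβ]
      rw [hJ']
      exact sup_le le_rfl (Ideal.mul_mono_right h)
    exact v.isPrime.ne_top (((mul_right_eq_self₀.1 h3).resolve_right hJ0).trans Ideal.one_eq_top)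
  obtain ⟨κ, hκ, hκv⟩ := SetLike.not_le_iff_exists.1 hJ'v
  have hβ0 : β ≠ 0 := by
    rintro rfl
    rw [Ideal.span_singleton_zero] at hJ'
    rcases mul_eq_zero.1 hJ'.symm with h | h
    · exact hJ0 h
    · exact hJ'v (h ▸ bot_le)
  have hdiv : ∀ z ∈ J, ∃ z₀, κ * z = β * z₀ := by
    intro z hz
    have : z * κ ∈ Ideal.span {β} := hJ' ▸ Ideal.mul_mem_mul hz hκ
    rw [mul_comm]
    exact Ideal.mem_span_singleton'.1 this |>.imp fun z₀ h => by rw [← h, mul_comm]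
  obtain ⟨x₀, hx₀⟩ := hdiv x hxJ
  obtain ⟨y₀, hy₀⟩ := hdiv y hyJ
  have hG : x₀ ^ 2 - a * y₀ ^ 2 ∈ v.asIdeal := by
    have h3 : κ ^ 2 * (x ^ 2 - a * y ^ 2) = β ^ 2 * (x₀ ^ 2 - a * y₀ ^ 2) := by
      have : κ ^ 2 * (x ^ 2 - a * y ^ 2) = (κ * x) ^ 2 - a * (κ * y) ^ 2 := by ring
      rw [this, hx₀, hy₀]; ring
    have h4 : κ ^ 2 * (x ^ 2 - a * y ^ 2) ∈ J' ^ 2 * (J ^ 2 * v.asIdeal) := by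
      refine Ideal.mul_mem_mul (Ideal.pow_mem_pow hκ 2) ?_
      refine Ideal.mul_mono_right (Ideal.le_of_dvd hv) ?_
      rw [← hF]
      exact Ideal.mem_span_singleton_self _
    rw [h3, show J' ^ 2 * (J ^ 2 * v.asIdeal) = (J * J') ^ 2 * v.asIdeal by ring, ← hJ',
      ← Ideal.dvd_span_singleton, Ideal.span_singleton_pow, ← Ideal.span_singleton_mul_span_singleton] at h4
    have h5 : Ideal.span {β ^ 2} ≠ 0 := by simpa using hβ0
    exact Ideal.dvd_span_singleton.1 ((mul_dvd_mul_iff_left h5).1 h4)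
  have hy₀v : y₀ ∉ v.asIdeal := by
    intro h
    have hx₀v : x₀ ∈ v.asIdeal := by
      refine v.isPrime.mem_of_pow_mem 2 ?_
      have := add_mem hG (Ideal.mul_mem_left _ a (Ideal.pow_mem_of_mem _ h 2 two_pos))
      rwa [sub_add_cancel] at this
    have h6 : J * Ideal.span {κ} ≤ J * (J' * v.asIdeal) := by
      rw [← mul_assoc, ← hJ', ← hx, Ideal.sup_mul, Ideal.span_singleton_mul_span_singleton,
        Ideal.span_singleton_mul_span_singleton, mul_comm y, mul_comm x, hx₀, hy₀]
      refine sup_le ?_ ?_ <;> rw [Ideal.span_singleton_le_iff_mem]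
      · exact Ideal.mul_mem_mul (Ideal.mem_span_singleton_self β) h
      · exact Ideal.mul_mem_mul (Ideal.mem_span_singleton_self β) hx₀v
    rw [← Ideal.dvd_iff_le, mul_dvd_mul_iff_left hJ0, Ideal.dvd_iff_le] at h6
    exact hκv (Ideal.mul_le_right (h6 (Ideal.mem_span_singleton_self κ)))
  obtain ⟨w, i, hi, hw⟩ := v.isMaximal.exists_inv hy₀v
  refine ⟨x₀ * w, ?_⟩
  have h7 : (x₀ * w) ^ 2 - a = w ^ 2 * (x₀ ^ 2 - a * y₀ ^ 2) + i * (a * (i - 2)) := by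
    have : i = 1 - w * y₀ := by rw [← hw]; ring
    rw [this]; ring
  rw [h7]
  exact add_mem (Ideal.mul_mem_left _ _ hG) (Ideal.mul_mem_right _ _ hi)

theorem exists_norm_form_span_eq {R : Type*} [CommRing R] [IsDedekindDomain R] {a : R}
    {va : HeightOneSpectrum R} (hva : va.asIdeal = Ideal.span {a})
    (h2 : ∀ v : HeightOneSpectrum R, (2 : R) ∈ v.asIdeal → IsAdicSquare v a)
    {J : Ideal R} (hJ : ¬ J ≤ va.asIdeal) :
    ∃ x y : R, ∃ F : Ideal R, Ideal.span {x ^ 2 - a * y ^ 2} = J ^ 2 * F ∧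
      x ∉ va.asIdeal ∧ x ^ 2 - a * y ^ 2 ∉ va.asIdeal ∧
      ∀ v : HeightOneSpectrum R, v.asIdeal ∣ F → IsAdicSquare v a := by
  have hava : a ∈ va.asIdeal := by rw [hva]; exact Ideal.mem_span_singleton_self a
  have hJ0 : J ≠ 0 := by rintro rfl; exact hJ bot_le
  have haJ0 : va.asIdeal * J ≠ ⊥ := mul_ne_zero va.ne_bot hJ0
  obtain ⟨y, hy, hy0⟩ := Submodule.exists_mem_ne_zero_of_ne_bot haJ0
  have hyJ : y ∈ J := Ideal.mul_le_right hy
  have hyva : y ∈ va.asIdeal := Ideal.mul_le_left hy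
  obtain ⟨x, hx⟩ := IsDedekindDomain.exists_sup_span_eq (I := Ideal.span {y}) (J := J)
    ((Ideal.span_singleton_le_iff_mem _).2 hyJ) (by simpa using hy0)
  have hxJ : x ∈ J := by
    rw [← hx]
    exact Ideal.mem_sup_right (Ideal.mem_span_singleton_self x)
  have hxva : x ∉ va.asIdeal := fun h => hJ (by
    rw [← hx]
    exact sup_le ((Ideal.span_singleton_le_iff_mem _).2 hyva)
      ((Ideal.span_singleton_le_iff_mem _).2 h))
  have hFva : x ^ 2 - a * y ^ 2 ∉ va.asIdeal := fun h => hxva (by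
    have := add_mem h (Ideal.mul_mem_right (y ^ 2) _ hava)
    rw [sub_add_cancel] at this
    exact va.isPrime.mem_of_pow_mem 2 this)
  have hFJ : x ^ 2 - a * y ^ 2 ∈ J ^ 2 :=
    sub_mem (Ideal.pow_mem_pow hxJ 2) (Ideal.mul_mem_left _ _ (Ideal.pow_mem_pow hyJ 2))
  obtain ⟨F, hF⟩ := Ideal.dvd_span_singleton.2 hFJ
  refine ⟨x, y, F, hF, hxva, hFva, fun v hv => ?_⟩
  by_cases h2v : (2 : R) ∈ v.asIdeal
  · exact h2 v h2v
  have hFv : x ^ 2 - a * y ^ 2 ∈ v.asIdeal := by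
    rw [← Ideal.dvd_span_singleton, hF]
    exact hv.mul_left _
  have hav : a ∉ v.asIdeal := by
    intro h
    have h3 : va.asIdeal ≤ v.asIdeal := by
      rw [hva]
      exact (Ideal.span_singleton_le_iff_mem _).2 h
    rw [va.isMaximal.eq_of_le v.isPrime.ne_top h3] at hFva
    exact hFva hFv
  obtain ⟨z, hz⟩ := exists_sq_sub_mem_of_norm_form hJ0 hx hF hv
  exact IsAdicSquare.of_sq_sub_mem h2v hav hz

theorem exists_pow_isPrincipal (K : Type*) [Field K] [NumberField K] {L : Ideal (𝓞 K)}
    (hL : L ≠ 0) : ∃ (k : ℕ) (z : 𝓞 K), L ^ (k + 1) = Ideal.span {z} := by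
  have hL' : L ∈ nonZeroDivisors (Ideal (𝓞 K)) := mem_nonZeroDivisors_of_ne_zero hL
  refine ⟨Nat.card (ClassGroup (𝓞 K)) - 1, ?_⟩
  rw [Nat.sub_add_cancel Nat.card_pos]
  have h1 : ClassGroup.mk0 (⟨L, hL'⟩ ^ Nat.card (ClassGroup (𝓞 K))) = 1 := by
    rw [map_pow, pow_card_eq_one']
  rw [SubmonoidClass.mk_pow, ClassGroup.mk0_eq_one_iff] at h1
  exact h1.principal

theorem isSquare_mk_of_mul {R : Type*} [CommRing R] {I : Ideal R} [I.IsMaximal] {m q N N' w : R}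
    (hq : q ∉ I) (hN : N - m * q ^ 2 ∈ I) (hN' : N' ∉ I) (h : N * N' - w ^ 2 ∈ I)
    (hsq : IsSquare (Ideal.Quotient.mk I N')) : IsSquare (Ideal.Quotient.mk I m) := by
  let := Ideal.Quotient.field I
  rw [← Ideal.Quotient.eq_zero_iff_mem, map_sub, sub_eq_zero] at hN h
  rw [← Ideal.Quotient.eq_zero_iff_mem] at hq hN'
  obtain ⟨r, hr⟩ := hsq
  rw [map_mul, hN, hr, map_mul, map_pow, map_pow] at h
  have hr0 : r ≠ 0 := by
    rintro rfl
    exact hN' (by rw [hr, mul_zero])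
  refine ⟨Ideal.Quotient.mk I w / (Ideal.Quotient.mk I q * r), ?_⟩
  field_simp
  rw [← h]
  ring

theorem not_isSquare_local_contradiction (K : Type*) [Field K] [NumberField K] {a : 𝓞 K}
    {va : HeightOneSpectrum (𝓞 K)} (hva : va.asIdeal = Ideal.span {a})
    (h2va : (2 : 𝓞 K) ∉ va.asIdeal) (ha : ∀ σ : K →+* ℝ, 0 < σ (algebraMap (𝓞 K) K a))
    (h2 : ∀ v : HeightOneSpectrum (𝓞 K), (2 : 𝓞 K) ∈ v.asIdeal → IsAdicSquare v a)
    {n : K} {m : 𝓞 K} (hnm : va.valuation K (n - algebraMap (𝓞 K) K m) < 1)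
    (hm : ¬ IsSquare (Ideal.Quotient.mk va.asIdeal m))
    (hloc : ∀ v : HeightOneSpectrum (𝓞 K), v ≠ va →
      IsSquare (v.valuation K n) ∨ IsAdicSquare v a) : False := by
  have hmva : m ∉ va.asIdeal := fun h => hm (by
    rw [Ideal.Quotient.eq_zero_iff_mem.2 h]; exact ⟨0, by simp⟩)
  have hn1 : va.valuation K n ≤ 1 := by
    have := Valuation.map_add_le (va.valuation K) hnm.le (va.valuation_le_one m)
    rwa [sub_add_cancel] at this
  obtain ⟨p, ⟨q, hq⟩, hpq⟩ := va.exists_primeCompl_mul_eq_of_integer n hn1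
  simp only at hpq
  replace hq : q ∉ va.asIdeal := hq
  have hN : p * q - m * q ^ 2 ∈ va.asIdeal := by
    rw [show p * q - m * q ^ 2 = (p - m * q) * q by ring]
    refine Ideal.mul_mem_right _ _ ?_
    rw [← va.valuation_lt_one_iff_mem (K := K)]
    change va.valuation K (algebraMap (𝓞 K) K (p - m * q)) < 1
    rw [map_sub, ← hpq, map_mul, ← sub_mul, map_mul]
    exact mul_lt_one_of_lt_of_le hnm (va.valuation_le_one q)
  have hNva : p * q ∉ va.asIdeal := by
    intro h
    have h1 := sub_mem h hN
    rw [sub_sub_cancel, va.isPrime.mul_mem_iff_mem_or_mem] at h1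
    exact h1.elim hmva fun h => hq (va.isPrime.mem_of_pow_mem 2 h)
  have hN0 : p * q ≠ 0 := fun h => hNva (h ▸ zero_mem _)
  obtain ⟨J, L, hJL, hL⟩ := exists_eq_sq_mul_squarefree (Ideal.span {p * q}) (by simpa using hN0)
  have hspan0 : J ^ 2 * L ≠ 0 := by rw [← hJL]; simpa using hN0
  have hJ0 : J ≠ 0 := fun h => hspan0 (by rw [h]; simp)
  have hNmem : p * q ∈ J ^ 2 * L := by rw [← hJL]; exact Ideal.mem_span_singleton_self _
  have hLsq : ∀ v : HeightOneSpectrum (𝓞 K), v.asIdeal ∣ L → IsAdicSquare v a := by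
    intro v hv
    refine (hloc v ?_).resolve_left fun hsq => ?_
    · rintro rfl
      exact hNva (Ideal.le_of_dvd (hv.mul_left _) hNmem)
    · have h1 := odd_multiplicity_of_dvd_squarefree hJ0 v.prime hL hv
      rw [← hJL, ← Nat.not_even_iff_odd] at h1
      refine h1 (even_multiplicity_of_isSquare_valuation (K := K) hN0 ?_)
      rw [map_mul, ← hpq, mul_assoc, map_mul, map_mul]
      exact hsq.mul ⟨_, rfl⟩
  have hJva : ¬ J ≤ va.asIdeal := fun h =>
    hNva (h (Ideal.pow_le_self two_ne_zero (Ideal.mul_le_left hNmem)))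
  obtain ⟨x, y, F, hF, hxva, hFva, hFsq⟩ := exists_norm_form_span_eq hva h2 hJva
  obtain ⟨k, z, hz⟩ := exists_pow_isPrincipal K hL.ne_zero
  have hzva : z ∉ va.asIdeal := by
    intro h
    rw [← Ideal.dvd_span_singleton, ← hz] at h
    exact hNva (Ideal.le_of_dvd ((va.prime.dvd_of_dvd_pow h).mul_left _) hNmem)
  have hprod : Ideal.span {z ^ 2 * (x ^ 2 - a * y ^ 2)} =
      Ideal.span {p * q} * (L ^ (2 * k + 1) * F) := by
    rw [← Ideal.span_singleton_mul_span_singleton, ← Ideal.span_singleton_pow, ← hz, hF, hJL]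
    ring
  obtain ⟨N', hN'⟩ : p * q ∣ z ^ 2 * (x ^ 2 - a * y ^ 2) := by
    rw [← Ideal.mem_span_singleton]
    refine Ideal.mul_le_left (J := L ^ (2 * k + 1) * F) ?_
    rw [← hprod]
    exact Ideal.mem_span_singleton_self _
  have hN'F : Ideal.span {N'} = L ^ (2 * k + 1) * F := by
    rw [hN', ← Ideal.span_singleton_mul_span_singleton] at hprod
    exact mul_left_cancel₀ (by simpa using hN0) hprod
  have hN'va : N' ∉ va.asIdeal := by
    intro h
    have h1 := Ideal.mul_mem_left _ (p * q) h
    rw [← hN', va.isPrime.mul_mem_iff_mem_or_mem] at h1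
    exact h1.elim (fun h => hzva (va.isPrime.mem_of_pow_mem 2 h)) hFva
  have hN'0 : N' ≠ 0 := fun h => hN'va (h ▸ zero_mem _)
  obtain ⟨t, ht⟩ := exists_sq_sub_mem (a := a) (Ideal.span {4 * N'}) (by simpa using hN'0) (by
    intro v hv
    rw [← Ideal.span_singleton_mul_span_singleton, v.prime.dvd_mul] at hv
    rcases hv with hv | hv
    · rw [Ideal.dvd_span_singleton, show (4 : 𝓞 K) = 2 ^ 2 by norm_num] at hv
      exact h2 v (v.isPrime.mem_of_pow_mem 2 hv)
    · rw [hN'F, v.prime.dvd_mul] at hv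
      exact hv.elim (fun h => hLsq v (v.prime.dvd_of_dvd_pow h)) (hFsq v))
  obtain ⟨N'', hN''⟩ := Ideal.mem_span_singleton.1 ht
  have ha0 : a ≠ 0 := by
    rintro rfl
    exact va.ne_bot (by simpa using hva)
  have hmax := va.isMaximal
  have hnsq : ¬ IsSquare (Ideal.Quotient.mk va.asIdeal N') := fun hsq =>
    hm (isSquare_mk_of_mul (w := z * x) hq hN hN'va (by
      rw [← hN', show z ^ 2 * (x ^ 2 - a * y ^ 2) - (z * x) ^ 2 = a * (-(z ^ 2 * y ^ 2)) by ring,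
        hva]
      exact Ideal.mul_mem_right _ _ (Ideal.mem_span_singleton_self a)) hsq)
  rw [hva] at hnsq h2va hN'va
  exact not_isSquare_mod_contradiction K (hva ▸ va.isPrime) ha0 h2va ha
    (hN''.trans (mul_assoc _ _ _)) hN'va hnsq

section Completion

variable {K : Type*} [Field K] [NumberField K] {v : HeightOneSpectrum (𝓞 K)}

theorem norm_algebraMap_adicCompletion_lt_iff (x y : K) :
    ‖algebraMap K (v.adicCompletion K) x‖ < ‖algebraMap K (v.adicCompletion K) y‖ ↔
      v.valuation K x < v.valuation K y := by
  change ‖FinitePlace.embedding v x‖ < ‖FinitePlace.embedding v y‖ ↔ _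
  rw [FinitePlace.norm_embedding', FinitePlace.norm_embedding', NNReal.coe_lt_coe]
  exact (WithZeroMulInt.toNNReal_strictMono (HeightOneSpectrum.one_lt_absNorm_nnreal v)).lt_iff_lt

theorem norm_algebraMap_adicCompletion_le_iff (x y : K) :
    ‖algebraMap K (v.adicCompletion K) x‖ ≤ ‖algebraMap K (v.adicCompletion K) y‖ ↔
      v.valuation K x ≤ v.valuation K y := by
  rw [← not_lt, norm_algebraMap_adicCompletion_lt_iff, not_lt]

theorem isAdicSquare_of_isSquare_adicCompletion {a : 𝓞 K}
    (h : IsSquare (algebraMap K (v.adicCompletion K) (algebraMap (𝓞 K) K a))) :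
    IsAdicSquare v a := by
  intro k
  obtain ⟨y, hy⟩ := h
  obtain ⟨ϖ, hϖ⟩ := v.valuation_exists_uniformizer K
  have hϖ0 : ϖ ≠ 0 := by
    rintro rfl
    rw [map_zero] at hϖ
    exact WithZero.exp_ne_zero hϖ.symm
  obtain ⟨x, hx⟩ : ∃ x : K, v.valuation K (x ^ 2 - algebraMap (𝓞 K) K a) < v.valuation K (ϖ ^ k) := by
    have hopen : IsOpen {z : v.adicCompletion K |
        ‖z ^ 2 - algebraMap K (v.adicCompletion K) (algebraMap (𝓞 K) K a)‖ <
          ‖algebraMap K (v.adicCompletion K) (ϖ ^ k)‖} :=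
      isOpen_lt (by fun_prop) continuous_const
    obtain ⟨x, hx⟩ := (HeightOneSpectrum.denseRange_algebraMap K v).exists_mem_open hopen
      ⟨y, by
        rw [Set.mem_ofPred_eq, hy, pow_two, sub_self, norm_zero, norm_pos_iff]
        simpa using fun h => absurd h hϖ0⟩
    refine ⟨x, ?_⟩
    rw [← norm_algebraMap_adicCompletion_lt_iff]
    simpa using hx
  have hϖk : v.valuation K (ϖ ^ k) = WithZero.exp (-(k : ℤ)) := by
    rw [map_pow, hϖ, ← WithZero.exp_nsmul]
    simp
  have hϖk1 : v.valuation K (ϖ ^ k) ≤ 1 := by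
    rw [hϖk, ← WithZero.exp_zero, WithZero.exp_le_exp]
    simp
  have hx1 : v.valuation K x ≤ 1 := by
    have h1 := Valuation.map_add_le (v.valuation K) (hx.le.trans hϖk1) (v.valuation_le_one a)
    rw [sub_add_cancel, map_pow] at h1
    exact (pow_le_one_iff two_ne_zero).1 h1
  obtain ⟨t, ht⟩ := v.exists_valuation_sub_lt_of_integer hx1
    (Units.mk0 (v.valuation K (ϖ ^ k)) (by simpa using fun h => absurd h hϖ0))
  rw [Units.val_mk0] at ht
  refine ⟨t, ?_⟩
  rw [← v.intValuation_le_pow_iff_mem, ← v.valuation_of_algebraMap (K := K), ← hϖk]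
  change v.valuation K (algebraMap (𝓞 K) K (t ^ 2 - a)) ≤ _
  have h2 : algebraMap (𝓞 K) K (t ^ 2 - a) = (algebraMap (𝓞 K) K t - x) *
      (algebraMap (𝓞 K) K t + x) + (x ^ 2 - algebraMap (𝓞 K) K a) := by
    rw [map_sub, map_pow]; ring
  rw [h2]
  refine Valuation.map_add_le _ ?_ hx.le
  rw [map_mul]
  exact mul_le_of_le_of_le_one ht.le
    (Valuation.map_add_le (v.valuation K) (v.valuation_le_one t) hx1)

theorem isSquare_adicCompletion_of_sq_sub_mem {a x : 𝓞 K} (h2 : (2 : 𝓞 K) ∉ v.asIdeal)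
    (ha : a ∉ v.asIdeal) (hx : x ^ 2 - a ∈ v.asIdeal) :
    IsSquare (algebraMap K (v.adicCompletion K) (algebraMap (𝓞 K) K a)) := by
  obtain ⟨f, hf⟩ := exists_hensel_sequence h2 ha hx
  obtain ⟨ϖ, hϖ⟩ := v.valuation_exists_uniformizer K
  let φ := (algebraMap K (v.adicCompletion K)).comp (algebraMap (𝓞 K) K)
  let r : ℝ := ‖algebraMap K (v.adicCompletion K) ϖ‖
  have hr1 : r < 1 := by
    have h1 := (norm_algebraMap_adicCompletion_lt_iff (v := v) ϖ 1).2 (by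
      rw [hϖ, map_one, ← WithZero.exp_zero, WithZero.exp_lt_exp]
      simp)
    rwa [map_one, norm_one] at h1
  have hr0 : 0 ≤ r := norm_nonneg _
  have hle : ∀ (z : 𝓞 K) (k : ℕ), z ∈ v.asIdeal ^ k → ‖φ z‖ ≤ r ^ k := by
    intro z k hz
    rw [← norm_pow, ← map_pow]
    refine (norm_algebraMap_adicCompletion_le_iff _ _).2 ?_
    rw [map_pow, hϖ, ← WithZero.exp_nsmul]
    have h1 := (v.intValuation_le_pow_iff_mem z k).2 hz
    rw [← v.valuation_of_algebraMap (K := K)] at h1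
    simpa using h1
  have hc : CauchySeq (fun k => φ (f k)) := by
    refine cauchySeq_of_le_geometric r r hr1 fun k => ?_
    rw [dist_comm, dist_eq_norm, ← map_sub, ← pow_succ']
    exact hle _ _ (hf k).2
  obtain ⟨L, hL⟩ := cauchySeq_tendsto_of_complete hc
  refine ⟨L, ?_⟩
  have h1 : Filter.Tendsto (fun k => φ (f k ^ 2 - a)) Filter.atTop (nhds (L ^ 2 - φ a)) := by
    simp only [map_sub, map_pow]
    exact (hL.pow 2).sub tendsto_const_nhds
  have h3 : Filter.Tendsto (fun k => φ (f k ^ 2 - a)) Filter.atTop (nhds 0) := by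
    refine squeeze_zero_norm (fun k => hle _ _ (hf k).1) ?_
    exact (tendsto_pow_atTop_nhds_zero_of_lt_one hr0 hr1).comp (Filter.tendsto_add_atTop_nat 1)
  have h4 := tendsto_nhds_unique h1 h3
  rw [sub_eq_zero, pow_two] at h4
  exact h4.symm

end Completion

section ResidueSquares

variable {K Γ : Type*} [Field K] [LinearOrderedCommGroupWithZero Γ] {v : Valuation K Γ}

/-- `u` is not congruent to a square modulo the valuation `v`. -/
def NotSqMod (v : Valuation K Γ) (u : K) : Prop := ∀ e : K, ¬ v (e ^ 2 - u) < 1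

theorem NotSqMod.congr {u w : K} (hu : NotSqMod v u) (h : v (w - u) < 1) : NotSqMod v w := by
  intro e he
  refine hu e ?_
  rw [show e ^ 2 - u = (e ^ 2 - w) + (w - u) by ring]
  exact Valuation.map_add_lt _ he h

theorem NotSqMod.mul_sq {u w : K} (hu : NotSqMod v u) (hw : v w = 1) : NotSqMod v (u * w ^ 2) := by
  intro e he
  have hw0 : w ≠ 0 := by
    rintro rfl
    simp at hw
  refine hu (e / w) ?_
  rw [show e ^ 2 - u * w ^ 2 = ((e / w) ^ 2 - u) * w ^ 2 by field_simp] at he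
  simpa [hw] using he

theorem NotSqMod.mul {u q e : K} (hu : NotSqMod v u) (hu1 : v u ≤ 1) (hq : v q = 1)
    (he : v (e ^ 2 - q) < 1) : NotSqMod v (u * q) := by
  have he1 : v e = 1 := by
    have h1 : v (e ^ 2) = v q := by
      refine Valuation.map_eq_of_sub_lt v ?_
      rwa [hq]
    rw [map_pow, hq] at h1
    exact (pow_eq_one_iff.1 h1).resolve_right two_ne_zero
  refine (hu.mul_sq he1).congr ?_
  rw [← mul_sub, map_mul, Valuation.map_sub_swap]
  exact (mul_le_of_le_one_left' hu1).trans_lt he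

theorem NotSqMod.isSquare_sq_sub {u x : K} (hu : NotSqMod v u) (hu1 : v u = 1) :
    IsSquare (v (x ^ 2 - u)) ∧ x ^ 2 - u ≠ 0 := by
  refine ⟨?_, fun h => hu x (by rw [h, map_zero]; exact zero_lt_one)⟩
  rcases le_or_gt (v x) 1 with hx | hx
  · have h1 : v (x ^ 2 - u) ≤ 1 := by
      refine (Valuation.map_sub v _ _).trans (max_le ?_ hu1.le)
      rw [map_pow]
      exact pow_le_one' hx 2
    rw [le_antisymm h1 (not_lt.1 (hu x))]
    exact ⟨1, (one_mul 1).symm⟩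
  · refine ⟨v x, ?_⟩
    rw [← pow_two, ← map_pow]
    refine Valuation.map_eq_of_sub_lt v ?_
    rw [sub_sub_cancel_left, Valuation.map_neg, hu1, map_pow]
    exact one_lt_pow₀ hx two_ne_zero

theorem isSquare_of_isSquare_div_sq {x w : K} (hw : w ≠ 0) (h : IsSquare (v (x / w ^ 2))) :
    IsSquare (v x) := by
  have : x = x / w ^ 2 * w ^ 2 := by field_simp
  rw [this, map_mul, map_pow]
  exact h.mul (IsSquare.sq _)

theorem isSquare_or_exists_sq_sub_lt {a b c d x y z s : K} {k : ℕ} (ha : v a = 1) (hb : v b = 1)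
    (hc : v (2 * c) = 1) (hc1 : v c ≤ 1) (hd : v d ≤ 1) (hy : v y ≤ 1) (hz : v z ≤ 1)
    (hyz : v y = 1 ∨ v z = 1) {D A : K} (hD : D = (a * b) ^ k * y ^ 2 - z ^ 2)
    (hA : A = a ^ (2 * k + 1) * y ^ 4 + b * c ^ 2 * d * D ^ 2)
    (hs : a * s ^ 2 = b * ((x ^ 2 - A) * (x ^ 2 - A - 2 * c * D ^ 2))) :
    IsSquare (v (x ^ 2 - A)) ∨ ∃ e, v (e ^ 2 - a) < 1 := by
  by_cases hsq : IsSquare (v (x ^ 2 - A))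
  · exact Or.inl hsq
  refine Or.inr ?_
  have hD1 : v D ≤ 1 := by
    rw [hD]
    refine (Valuation.map_sub v _ _).trans (max_le ?_ ?_)
    · simpa [ha, hb] using pow_le_one' hy 2
    · simpa using pow_le_one' hz 2
  have hbcd : v (b * c ^ 2 * d) ≤ 1 := by
    rw [map_mul, map_mul, hb, one_mul, map_pow]
    exact mul_le_one' (pow_le_one' hc1 2) hd
  have hA1 : v A ≤ 1 := by
    rw [hA]
    refine Valuation.map_add_le v ?_ ?_
    · simpa [ha] using pow_le_one' hy 4
    · rw [map_mul, map_pow]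
      exact mul_le_one' hbcd (pow_le_one' hD1 2)
  have hx : v x ≤ 1 := by
    by_contra! hx
    refine hsq ⟨v x, ?_⟩
    rw [← pow_two, ← map_pow]
    refine Valuation.map_eq_of_sub_lt v ?_
    rw [sub_sub_cancel_left, Valuation.map_neg, map_pow]
    exact hA1.trans_lt (one_lt_pow₀ hx two_ne_zero)
  have hu1 : v (x ^ 2 - A) ≤ 1 := by
    refine (Valuation.map_sub v _ _).trans (max_le ?_ hA1)
    rw [map_pow]
    exact pow_le_one' hx 2
  have hu : v (x ^ 2 - A) < 1 := lt_of_le_of_ne hu1 fun h => hsq (by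
    rw [h]; exact ⟨1, (one_mul 1).symm⟩)
  have hδ : v (2 * c * D ^ 2) = v D ^ 2 := by rw [map_mul, hc, one_mul, map_pow]
  have hδ1 : v (2 * c * D ^ 2) ≤ 1 := by
    rw [hδ]
    exact pow_le_one' hD1 2
  have hw : v (x ^ 2 - A - 2 * c * D ^ 2) < 1 := by
    refine lt_of_le_of_ne ((Valuation.map_sub v _ _).trans (max_le hu1 hδ1)) fun h => hsq ?_
    have h1 := congrArg v hs
    rw [map_mul, ha, one_mul, map_mul, hb, one_mul, map_mul, h, mul_one, map_pow] at h1
    rw [← h1]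
    exact IsSquare.sq _
  have hDlt : v D < 1 := by
    have h1 : v (2 * c * D ^ 2) < 1 := by
      rw [← sub_sub_cancel (x ^ 2 - A) (2 * c * D ^ 2)]
      exact (Valuation.map_sub v _ _).trans_lt (max_lt hu hw)
    rw [hδ] at h1
    by_contra! h
    exact h1.not_ge (one_le_pow₀ h)
  have hy1 : v y = 1 := by
    refine hyz.elim id fun hz1 => le_antisymm hy ?_
    by_contra! hy'
    have h1 : v (z ^ 2) < 1 := by
      rw [show z ^ 2 = (a * b) ^ k * y ^ 2 - D by rw [hD]; ring]
      refine (Valuation.map_sub v _ _).trans_lt (max_lt ?_ hDlt)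
      simpa [ha, hb] using pow_lt_one' hy' two_ne_zero
    simp [hz1] at h1
  have hy0 : y ≠ 0 := by
    rintro rfl
    simp at hy1
  have ha0 : a ≠ 0 := by
    rintro rfl
    simp at ha
  refine ⟨x / (a ^ k * y ^ 2), ?_⟩
  have h1 : (x / (a ^ k * y ^ 2)) ^ 2 - a =
      ((x ^ 2 - A) + b * c ^ 2 * d * D ^ 2) / (a ^ k * y ^ 2) ^ 2 := by
    rw [hA]
    field_simp
    ring
  rw [h1, map_div₀]
  have h2 : v ((a ^ k * y ^ 2) ^ 2) = 1 := by simp [ha, hy1]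
  rw [h2, div_one]
  refine Valuation.map_add_lt v hu ?_
  rw [map_mul, map_pow]
  exact (mul_le_of_le_one_left' hbcd).trans_lt (pow_lt_one' hDlt two_ne_zero)

end ResidueSquares

section UniformizerPlaces

variable {K : Type*} [Field K] {v : Valuation K (WithZero (Multiplicative ℤ))}

theorem WithZero.not_isSquare_exp_of_odd {n : ℤ} (hn : Odd n) :
    ¬ IsSquare (WithZero.exp n : WithZero (Multiplicative ℤ)) := by
  rintro ⟨y, hy⟩
  have hy0 : y ≠ 0 := by
    rintro rfl
    simp at hy
  have := congrArg WithZero.log hy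
  rw [WithZero.log_exp, WithZero.log_mul hy0 hy0] at this
  exact Int.not_even_iff_odd.2 hn ⟨_, this⟩

theorem WithZero.le_exp_neg_one_of_lt_one {x : WithZero (Multiplicative ℤ)} (hx : x < 1) :
    x ≤ WithZero.exp (-1) := by
  rcases eq_or_ne x 0 with rfl | h0
  · exact zero_le
  · rw [← WithZero.exp_log h0] at hx ⊢
    rw [← WithZero.exp_zero, WithZero.exp_lt_exp] at hx
    rw [WithZero.exp_le_exp]
    omega

theorem isSquare_sq_sub_at_c {a b c d x y z : K} {k : ℕ} (ha : v a = 1) (hb : v b = 1)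
    (hc : v c = WithZero.exp (-1)) (hd : v d = 1) (hna : NotSqMod v a) (hnbd : NotSqMod v (b * d))
    (hyz : ¬ (y = 0 ∧ z = 0)) {D A : K} (hD : D = (a * b) ^ k * y ^ 2 - z ^ 2)
    (hA : A = a ^ (2 * k + 1) * y ^ 4 + b * c ^ 2 * d * D ^ 2) :
    IsSquare (v (x ^ 2 - A)) ∧ x ^ 2 - A ≠ 0 := by
  have hc1 : v c < 1 := by
    rw [hc, ← WithZero.exp_zero, WithZero.exp_lt_exp]
    simp
  have hc0 : c ≠ 0 := by
    rintro rfl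
    rw [map_zero] at hc
    exact WithZero.exp_ne_zero hc.symm
  suffices h : ∃ w : K, w ≠ 0 ∧ v (A / w ^ 2) = 1 ∧ NotSqMod v (A / w ^ 2) by
    obtain ⟨w, hw, h1, hn⟩ := h
    have h2 := hn.isSquare_sq_sub (x := x / w) h1
    have h3 : (x / w) ^ 2 - A / w ^ 2 = (x ^ 2 - A) / w ^ 2 := by field_simp
    rw [h3] at h2
    exact ⟨isSquare_of_isSquare_div_sq hw h2.1, fun h => h2.2 (by rw [h, zero_div])⟩
  have key : ∀ {p u : K}, NotSqMod v u → v u = 1 → v (p - u) < 1 → v p = 1 ∧ NotSqMod v p := by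
    intro p u hu hu1 h
    refine ⟨?_, hu.congr h⟩
    rw [← hu1]
    exact Valuation.map_eq_of_sub_lt v (by rwa [hu1])
  rcases le_or_gt (v z) (v y) with hle | hlt
  · have hy0 : y ≠ 0 := by
      rintro rfl
      rw [map_zero, le_zero_iff, map_eq_zero] at hle
      exact hyz ⟨rfl, hle⟩
    have hzy : v (z / y) ≤ 1 := by
      rw [map_div₀]
      exact div_le_one_of_le₀ hle zero_le
    have hn := hna.mul_sq (w := a ^ k) (by simp [ha])
    refine ⟨y ^ 2, pow_ne_zero 2 hy0, key hn (by simp [ha]) ?_⟩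
    have h1 : A / (y ^ 2) ^ 2 - a * (a ^ k) ^ 2 =
        b * d * c ^ 2 * ((a * b) ^ k - (z / y) ^ 2) ^ 2 := by
      rw [hA, hD]
      field_simp
      ring
    have h2 : v ((a * b) ^ k - (z / y) ^ 2) ≤ 1 := by
      refine (Valuation.map_sub v _ _).trans (max_le (by simp [ha, hb]) ?_)
      rw [map_pow]
      exact pow_le_one' hzy 2
    rw [h1, map_mul, map_mul, map_mul, hb, hd, one_mul, one_mul, map_pow, map_pow]
    exact (mul_le_of_le_one_right' (pow_le_one' h2 2)).trans_lt (pow_lt_one' hc1 two_ne_zero)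
  · have hz0 : z ≠ 0 := by
      rintro rfl
      rw [map_zero] at hlt
      exact not_lt_zero hlt
    have hyz1 : v (y / z) < 1 := by
      rw [map_div₀]
      exact (div_lt_one₀ (lt_of_le_of_lt zero_le hlt)).2 hlt
    have hw : v (y / (z * c)) ≤ 1 := by
      rw [show y / (z * c) = y / z / c by field_simp, map_div₀]
      refine div_le_one_of_le₀ ?_ zero_le
      rw [hc]
      exact WithZero.le_exp_neg_one_of_lt_one hyz1
    refine ⟨z ^ 2 * c, mul_ne_zero (pow_ne_zero 2 hz0) hc0, key hnbd (by simp [hb, hd]) ?_⟩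
    have h1 : A / (z ^ 2 * c) ^ 2 - b * d = a ^ (2 * k + 1) * (y / (z * c)) ^ 4 * c ^ 2 +
        b * d * (((a * b) ^ k * (y / z) ^ 2 - 2) * ((a * b) ^ k * (y / z) ^ 2)) := by
      rw [hA, hD]
      field_simp
      ring
    have h3 : v ((a * b) ^ k * (y / z) ^ 2) < 1 := by
      simpa [ha, hb] using pow_lt_one' hyz1 two_ne_zero
    have h4 : v (2 : K) ≤ 1 := by
      rw [← one_add_one_eq_two]
      exact Valuation.map_add_le v (map_one v).le (map_one v).le
    rw [h1]
    refine Valuation.map_add_lt v ?_ ?_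
    · rw [map_mul, map_mul, map_pow, ha, one_pow, one_mul, map_pow, map_pow]
      exact (mul_le_of_le_one_left' (pow_le_one' hw 4)).trans_lt (pow_lt_one' hc1 two_ne_zero)
    · rw [map_mul, map_mul, hb, hd, one_mul, one_mul, map_mul]
      exact (mul_le_of_le_one_left' ((Valuation.map_sub v _ _).trans (max_le h3.le h4))).trans_lt h3

theorem ne_zero_and_div_sq_lt_at_a {a b y z : K} {k : ℕ} (ha : v a = WithZero.exp (-1))
    (hb : v b = 1) (hk : Odd k) (hyz : ¬ (y = 0 ∧ z = 0)) {D : K}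
    (hD : D = (a * b) ^ k * y ^ 2 - z ^ 2) :
    D ≠ 0 ∧ v (a ^ (2 * k + 1) * y ^ 4 / D ^ 2) < 1 := by
  rcases eq_or_ne y 0 with rfl | hy
  · have hz : z ≠ 0 := fun h => hyz ⟨rfl, h⟩
    refine ⟨?_, by simp⟩
    rw [hD]
    simpa using hz
  have ha1 : v a < 1 := by
    rw [ha, ← WithZero.exp_zero, WithZero.exp_lt_exp]
    simp
  have ha0 : a ≠ 0 := by
    rintro rfl
    rw [map_zero] at ha
    exact WithZero.exp_ne_zero ha.symm
  have hvk : v ((a * b) ^ k) = WithZero.exp (-(k : ℤ)) := by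
    rw [map_pow, map_mul, hb, mul_one, ha, ← WithZero.exp_nsmul]
    simp
  have hne : v ((a * b) ^ k * y ^ 2) ≠ v (z ^ 2) := by
    intro h
    have h1 : v ((a * b) ^ k) = v (z / y) ^ 2 := by
      rw [← map_pow, div_pow, map_div₀, ← h, map_mul,
        mul_div_cancel_right₀ _ (by simpa using hy)]
    rw [hvk] at h1
    exact WithZero.not_isSquare_exp_of_odd (by simpa using hk) (h1 ▸ IsSquare.sq _)
  have hle : v ((a * b) ^ k * y ^ 2) ≤ v D := by
    rw [hD, sub_eq_add_neg, Valuation.map_add_of_distinct_val v (by rwa [Valuation.map_neg])]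
    exact le_max_left _ _
  have hpos : 0 < v ((a * b) ^ k * y ^ 2) := by
    rw [map_mul, hvk]
    rw [map_pow]
    exact mul_pos WithZero.exp_pos (pow_pos (zero_lt_iff.2 (by simpa using hy)) 2)
  have hvD : 0 < v D := hpos.trans_le hle
  have hD0 : D ≠ 0 := by
    intro h
    rw [h, map_zero] at hvD
    exact lt_irrefl _ hvD
  refine ⟨hD0, ?_⟩
  rw [map_div₀, div_lt_one₀ (by rw [map_pow]; exact pow_pos hvD 2)]
  refine lt_of_lt_of_le ?_ (show v ((a * b) ^ k * y ^ 2) ^ 2 ≤ v (D ^ 2) by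
    rw [map_pow]; exact pow_le_pow_left₀ zero_le hle 2)
  have h1 : v (a ^ (2 * k + 1) * y ^ 4) = v a * v ((a * b) ^ k * y ^ 2) ^ 2 := by
    rw [show a ^ (2 * k + 1) * y ^ 4 = a * (a ^ k * y ^ 2) ^ 2 by ring, map_mul, map_pow, mul_pow]
    simp only [map_mul, map_pow, hb, one_pow, mul_one]
  rw [h1]
  exact mul_lt_of_lt_one_left (pow_pos hpos 2) ha1

end UniformizerPlaces

section LocalToGlobal

variable {K : Type u} [Field K] [NumberField K]

theorem notMem_of_ne_of_asIdeal_eq_span {v w : HeightOneSpectrum (𝓞 K)} {a : 𝓞 K}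
    (hv : v.asIdeal = Ideal.span {a}) (h : w ≠ v) : a ∉ w.asIdeal := by
  intro ha
  refine h (HeightOneSpectrum.ext ?_)
  refine (v.isMaximal.eq_of_le w.isPrime.ne_top ?_).symm
  rw [hv]
  exact (Ideal.span_singleton_le_iff_mem _).2 ha

theorem valuation_eq_one_of_notMem {v : HeightOneSpectrum (𝓞 K)} {a : 𝓞 K} (h : a ∉ v.asIdeal) :
    v.valuation K (algebraMap (𝓞 K) K a) = 1 :=
  v.valuation_eq_one_iff_notMem.2 h

theorem valuation_generator {v : HeightOneSpectrum (𝓞 K)} {a : 𝓞 K}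
    (hv : v.asIdeal = Ideal.span {a}) :
    v.valuation K (algebraMap (𝓞 K) K a) = WithZero.exp (-1) := by
  rw [v.valuation_of_algebraMap]
  refine v.intValuation_singleton ?_ hv
  rintro rfl
  exact v.ne_bot (by simpa using hv)

theorem exists_sq_sub_mem_of_valuation_lt {v : HeightOneSpectrum (𝓞 K)} {m : 𝓞 K} {e : K}
    (h : v.valuation K (e ^ 2 - algebraMap (𝓞 K) K m) < 1) :
    ∃ t : 𝓞 K, t ^ 2 - m ∈ v.asIdeal := by
  have he : v.valuation K e ≤ 1 := by
    have h1 := Valuation.map_add_le (v.valuation K) h.le (v.valuation_le_one m)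
    rw [sub_add_cancel, map_pow] at h1
    exact (pow_le_one_iff two_ne_zero).1 h1
  obtain ⟨t, ht⟩ := v.exists_valuation_sub_lt_of_integer he 1
  rw [Units.val_one] at ht
  refine ⟨t, ?_⟩
  rw [← v.valuation_lt_one_iff_mem (K := K)]
  change v.valuation K (algebraMap (𝓞 K) K (t ^ 2 - m)) < 1
  have h2 : algebraMap (𝓞 K) K (t ^ 2 - m) = (algebraMap (𝓞 K) K t + e) *
      (algebraMap (𝓞 K) K t - e) + (e ^ 2 - algebraMap (𝓞 K) K m) := by
    rw [map_sub, map_pow]; ring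
  rw [h2]
  refine Valuation.map_add_lt _ ?_ h
  rw [map_mul]
  exact (mul_le_of_le_one_left' (Valuation.map_add_le (v.valuation K) (v.valuation_le_one t)
    he)).trans_lt ht

theorem notSqMod_of_not_isSquare {v : HeightOneSpectrum (𝓞 K)} {m : 𝓞 K}
    (h2 : (2 : 𝓞 K) ∉ v.asIdeal) (hm : m ∉ v.asIdeal)
    (h : ¬ IsSquare (intToAdicCompletion v m)) :
    NotSqMod (v.valuation K) (algebraMap (𝓞 K) K m) := by
  intro e he
  obtain ⟨t, ht⟩ := exists_sq_sub_mem_of_valuation_lt he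
  exact h (isSquare_adicCompletion_of_sq_sub_mem h2 hm ht)

theorem exists_sq_sub_lt_of_isSquare {v : HeightOneSpectrum (𝓞 K)} {m : 𝓞 K}
    (h : IsSquare (intToAdicCompletion v m)) :
    ∃ e : K, v.valuation K (e ^ 2 - algebraMap (𝓞 K) K m) < 1 := by
  obtain ⟨t, ht⟩ := isAdicSquare_of_isSquare_adicCompletion h 1
  refine ⟨algebraMap (𝓞 K) K t, ?_⟩
  rw [pow_one, ← v.valuation_lt_one_iff_mem (K := K)] at ht
  rw [← map_pow, ← map_sub]
  exact ht

theorem NotSqMod.not_isSquare_mk {v : HeightOneSpectrum (𝓞 K)} {m : 𝓞 K}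
    (h : NotSqMod (v.valuation K) (algebraMap (𝓞 K) K m)) :
    ¬ IsSquare (Ideal.Quotient.mk v.asIdeal m) := by
  rintro ⟨r, hr⟩
  obtain ⟨t, rfl⟩ := Ideal.Quotient.mk_surjective r
  refine h (algebraMap (𝓞 K) K t) ?_
  rw [← map_pow, ← map_sub]
  refine (v.valuation_lt_one_iff_mem (K := K) _).2 ?_
  rw [← Ideal.Quotient.eq_zero_iff_mem, map_sub, map_pow, hr, pow_two, sub_self]

end LocalToGlobal

section LocalAnalysis

variable {K : Type u} [Field K] [NumberField K] {g : ℕ} {a b c d : 𝓞 K}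
  {va vb vc vd : HeightOneSpectrum (𝓞 K)}

theorem Params.isSquare_sq_sub_at_c (hP : Params K g a b c d va vb vc vd) {k : ℕ} {x y z D A : K}
    (hyz : ¬ (y = 0 ∧ z = 0))
    (hD : D = (algebraMap (𝓞 K) K a * algebraMap (𝓞 K) K b) ^ k * y ^ 2 - z ^ 2)
    (hA : A = algebraMap (𝓞 K) K a ^ (2 * k + 1) * y ^ 4 +
      algebraMap (𝓞 K) K b * algebraMap (𝓞 K) K c ^ 2 * algebraMap (𝓞 K) K d * D ^ 2) :
    IsSquare (vc.valuation K (x ^ 2 - A)) ∧ x ^ 2 - A ≠ 0 := by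
  obtain ⟨hab, hac, had, hbc, hbd, hcd⟩ := hP.distinct
  have hac' := notMem_of_ne_of_asIdeal_eq_span hP.span_a hac.symm
  have hbc' := notMem_of_ne_of_asIdeal_eq_span hP.span_b hbc.symm
  have hdc' := notMem_of_ne_of_asIdeal_eq_span hP.span_d hcd
  have h2 := hP.not_dvd_two.2.2.1
  have hd1 := valuation_eq_one_of_notMem (K := K) hdc'
  have hb1 := valuation_eq_one_of_notMem (K := K) hbc'
  obtain ⟨e, he⟩ := exists_sq_sub_lt_of_isSquare hP.d_sq_c
  exact _root_.isSquare_sq_sub_at_c (valuation_eq_one_of_notMem hac') hb1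
    (valuation_generator hP.span_c) hd1 (notSqMod_of_not_isSquare h2 hac' hP.a_nsq_c)
    ((notSqMod_of_not_isSquare h2 hbc' hP.b_nsq_c).mul hb1.le hd1 he) hyz hD hA

theorem Params.isSquare_valuation_or_isAdicSquare (hP : Params K g a b c d va vb vc vd) {k : ℕ}
    {x y z s D A : K} (hyz : ¬ (y = 0 ∧ z = 0))
    (hD : D = (algebraMap (𝓞 K) K a * algebraMap (𝓞 K) K b) ^ k * y ^ 2 - z ^ 2)
    (hA : A = algebraMap (𝓞 K) K a ^ (2 * k + 1) * y ^ 4 +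
      algebraMap (𝓞 K) K b * algebraMap (𝓞 K) K c ^ 2 * algebraMap (𝓞 K) K d * D ^ 2)
    (hs : algebraMap (𝓞 K) K a * s ^ 2 = algebraMap (𝓞 K) K b *
      ((x ^ 2 - A) * (x ^ 2 - A - 2 * algebraMap (𝓞 K) K c * D ^ 2)))
    {v : HeightOneSpectrum (𝓞 K)} (hv : v ≠ va) :
    IsSquare (v.valuation K (x ^ 2 - A)) ∨ IsAdicSquare v a := by
  by_cases h2 : (2 : 𝓞 K) ∈ v.asIdeal
  · exact Or.inr (isAdicSquare_of_isSquare_adicCompletion (hP.sq_ab_bad v (Or.inl h2)).1)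
  by_cases hvb : v = vb
  · subst hvb
    exact Or.inr (isAdicSquare_of_isSquare_adicCompletion hP.a_sq_b)
  by_cases hvc : v = vc
  · subst hvc
    exact Or.inl (hP.isSquare_sq_sub_at_c hyz hD hA).1
  have ha := notMem_of_ne_of_asIdeal_eq_span hP.span_a hv
  have hb := notMem_of_ne_of_asIdeal_eq_span hP.span_b hvb
  have hc := notMem_of_ne_of_asIdeal_eq_span hP.span_c hvc
  have h2c : (2 * c : 𝓞 K) ∉ v.asIdeal := fun h =>
    (v.isPrime.mem_or_mem h).elim h2 hc
  have h2c' : v.valuation K (2 * algebraMap (𝓞 K) K c) = 1 := by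
    rw [← valuation_eq_one_of_notMem (K := K) h2c, map_mul (algebraMap (𝓞 K) K), map_ofNat]
  obtain ⟨w, hw, hy, hz, hyz1⟩ : ∃ w : K, w ≠ 0 ∧ v.valuation K (y / w) ≤ 1 ∧
      v.valuation K (z / w) ≤ 1 ∧ (v.valuation K (y / w) = 1 ∨ v.valuation K (z / w) = 1) := by
    rcases le_total (v.valuation K y) (v.valuation K z) with h | h
    · have hz0 : z ≠ 0 := by
        rintro rfl
        rw [map_zero, le_zero_iff, map_eq_zero] at h
        exact hyz ⟨h, rfl⟩
      refine ⟨z, hz0, ?_, ?_, Or.inr ?_⟩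
      · rw [map_div₀]
        exact div_le_one_of_le₀ h zero_le
      · rw [div_self hz0, map_one]
      · rw [div_self hz0, map_one]
    · have hy0 : y ≠ 0 := by
        rintro rfl
        rw [map_zero, le_zero_iff, map_eq_zero] at h
        exact hyz ⟨rfl, h⟩
      refine ⟨y, hy0, ?_, ?_, Or.inl ?_⟩
      · rw [div_self hy0, map_one]
      · rw [map_div₀]
        exact div_le_one_of_le₀ h zero_le
      · rw [div_self hy0, map_one]
  have key := isSquare_or_exists_sq_sub_lt (v := v.valuation K) (x := x / w ^ 2) (s := s / w ^ 4)
    (y := y / w) (z := z / w) (D := D / w ^ 2) (A := A / w ^ 4) (k := k)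
    (valuation_eq_one_of_notMem ha) (valuation_eq_one_of_notMem hb) h2c' (v.valuation_le_one c)
    (v.valuation_le_one d) hy hz hyz1 (by rw [hD]; field_simp) (by rw [hA]; field_simp)
    (by field_simp; linear_combination hs)
  rcases key with h | ⟨e, he⟩
  · refine Or.inl (isSquare_of_isSquare_div_sq (w := w ^ 2) (pow_ne_zero 2 hw) ?_)
    rwa [show (x ^ 2 - A) / (w ^ 2) ^ 2 = (x / w ^ 2) ^ 2 - A / w ^ 4 by field_simp]
  · obtain ⟨t, ht⟩ := exists_sq_sub_mem_of_valuation_lt he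
    exact Or.inr (IsAdicSquare.of_sq_sub_mem h2 ha ht)

theorem Params.false_of_solution (hP : Params K g a b c d va vb vc vd) {k : ℕ} (hk : Odd k)
    {x y z s D A : K} (hyz : ¬ (y = 0 ∧ z = 0))
    (hD : D = (algebraMap (𝓞 K) K a * algebraMap (𝓞 K) K b) ^ k * y ^ 2 - z ^ 2)
    (hA : A = algebraMap (𝓞 K) K a ^ (2 * k + 1) * y ^ 4 +
      algebraMap (𝓞 K) K b * algebraMap (𝓞 K) K c ^ 2 * algebraMap (𝓞 K) K d * D ^ 2)
    (hs : algebraMap (𝓞 K) K a * s ^ 2 = algebraMap (𝓞 K) K b *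
      ((x ^ 2 - A) * (x ^ 2 - A - 2 * algebraMap (𝓞 K) K c * D ^ 2))) : False := by
  obtain ⟨hab, hac, -⟩ := hP.distinct
  have h2 := hP.not_dvd_two.1
  have hb := notMem_of_ne_of_asIdeal_eq_span hP.span_b hab
  have hc := notMem_of_ne_of_asIdeal_eq_span hP.span_c hac
  have hb1 := valuation_eq_one_of_notMem (K := K) hb
  have hc1 := valuation_eq_one_of_notMem (K := K) hc
  have h21 := valuation_eq_one_of_notMem (K := K) h2
  have ha1 := valuation_generator (K := K) hP.span_a
  have hD0 : D ≠ 0 := (ne_zero_and_div_sq_lt_at_a ha1 hb1 hk hyz hD).1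
  have hu0 := (hP.isSquare_sq_sub_at_c (x := x) hyz hD hA).2
  have hloc := fun v hv => hP.isSquare_valuation_or_isAdicSquare hyz hD hA hs (v := v) hv
  obtain ⟨e, he⟩ := exists_sq_sub_lt_of_isSquare (v := va) (m := 2) (by
    rw [intToAdicCompletion, map_ofNat, map_ofNat]
    exact hP.sq_two_a)
  obtain ⟨f, hf⟩ := exists_sq_sub_lt_of_isSquare hP.b_sq_a
  have hn2c : NotSqMod (va.valuation K) (algebraMap (𝓞 K) K (c * 2)) := by
    rw [map_mul]
    exact (notSqMod_of_not_isSquare h2 hc hP.c_nsq_a).mul hc1.le h21 he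
  have h2c1 : va.valuation K (algebraMap (𝓞 K) K (c * 2)) = 1 := by
    rw [map_mul, map_mul, hc1, h21, one_mul]
  have hn2cb : NotSqMod (va.valuation K) (algebraMap (𝓞 K) K (c * 2 * b)) := by
    rw [map_mul]
    exact hn2c.mul h2c1.le hb1 hf
  have hglob : ∀ {n : K} {m : 𝓞 K}, va.valuation K (n - algebraMap (𝓞 K) K m) < 1 →
      NotSqMod (va.valuation K) (algebraMap (𝓞 K) K m) →
      (∀ v, v ≠ va → IsSquare (v.valuation K n) ∨ IsAdicSquare v a) → False := fun h1 h3 h4 =>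
    not_isSquare_local_contradiction K hP.span_a h2 (fun σ => (hP.pos_real σ).1)
      (fun v hv => isAdicSquare_of_isSquare_adicCompletion (hP.sq_ab_bad v (Or.inl hv)).1) h1
      h3.not_isSquare_mk h4
  set α := algebraMap (𝓞 K) K a
  set β := algebraMap (𝓞 K) K b
  set γ := algebraMap (𝓞 K) K c
  have hγ : algebraMap (𝓞 K) K (c * 2) = 2 * γ := by rw [map_mul, map_ofNat, mul_comm]
  have hγβ : algebraMap (𝓞 K) K (c * 2 * b) = 2 * γ * β := by rw [map_mul, hγ]
  set U := (x ^ 2 - A) / D ^ 2 with hU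
  have hU0 : U ≠ 0 := div_ne_zero hu0 (pow_ne_zero 2 hD0)
  have hlocU : ∀ v, v ≠ va → IsSquare (v.valuation K U) ∨ IsAdicSquare v a := by
    intro v hv
    refine (hloc v hv).imp_left fun h => ?_
    rw [hU, map_div₀, map_pow]
    exact h.div (IsSquare.sq _)
  have hS : α * (s / D ^ 2) ^ 2 = β * (U * (U - 2 * γ)) := by
    rw [hU]
    field_simp
    linear_combination hs
  generalize s / D ^ 2 = S at hS
  by_cases hW : U - 2 * γ = 0
  · exact hglob (n := U) (m := c * 2) (by rw [hγ, hW, map_zero]; exact zero_lt_one) hn2c hlocU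
  have hvS := congrArg (va.valuation K) hS
  rw [map_mul, map_mul, map_mul, map_pow, ha1, hb1, one_mul] at hvS
  have hcase : va.valuation K U < 1 ∨ va.valuation K (U - 2 * γ) < 1 := by
    rw [hγ] at h2c1
    by_contra! hcon
    have hUW : va.valuation K U = va.valuation K (U - 2 * γ) := by
      by_cases hlt : 1 < va.valuation K U
      · refine (Valuation.map_sub_eq_of_lt_left (va.valuation K) ?_).symm
        rwa [h2c1]
      · have h1 := le_antisymm (not_lt.1 hlt) hcon.1
        rw [h1]
        refine le_antisymm hcon.2 ?_
        exact (Valuation.map_sub (va.valuation K) _ _).trans (max_le h1.le h2c1.le)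
    rw [← hUW] at hvS
    have hS0 : va.valuation K S ≠ 0 := by
      intro h
      rw [h, zero_pow two_ne_zero, mul_zero] at hvS
      exact mul_ne_zero ((Valuation.ne_zero_iff (va.valuation K)).2 hU0)
        ((Valuation.ne_zero_iff (va.valuation K)).2 hU0) hvS.symm
    refine WithZero.not_isSquare_exp_of_odd (n := -1) (by decide) ?_
    refine ⟨va.valuation K U / va.valuation K S, ?_⟩
    rw [div_mul_div_comm, ← hvS, ← pow_two, mul_div_cancel_right₀ _ (pow_ne_zero 2 hS0)]
  rcases hcase with h | h
  · refine hglob (n := -β * (U - 2 * γ)) (m := c * 2 * b) ?_ hn2cb ?_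
    · rw [hγβ, show -β * (U - 2 * γ) - 2 * γ * β = -(β * U) by ring, Valuation.map_neg, map_mul,
        hb1, one_mul]
      exact h
    · intro v hv
      refine (hlocU v hv).imp_left fun hUs => ?_
      have hvS := congrArg (v.valuation K) hS
      have hav : v.valuation K α = 1 :=
        valuation_eq_one_of_notMem (notMem_of_ne_of_asIdeal_eq_span hP.span_a hv)
      rw [map_mul, hav, one_mul, map_pow] at hvS
      have : v.valuation K (-β * (U - 2 * γ)) = v.valuation K S ^ 2 / v.valuation K U := by
        rw [hvS, eq_div_iff ((Valuation.ne_zero_iff _).2 hU0), ← map_mul, ← Valuation.map_neg]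
        congr 1
        ring
      rw [this]
      exact (IsSquare.sq _).div hUs
  · exact hglob (n := U) (m := c * 2) (by rw [hγ]; exact h) hn2c hlocU

end LocalAnalysis

section OddDegree

open Polynomial IntermediateField

theorem exists_algebraMap_eq_of_sq_eq {F L : Type*} [Field F] [Field L] [Algebra F L]
    [FiniteDimensional F L] (hodd : Odd (Module.finrank F L)) {s : L} {q : F}
    (h : s ^ 2 = algebraMap F L q) : ∃ r : F, algebraMap F L r = s := by
  have hint : IsIntegral F s := Algebra.IsIntegral.isIntegral s
  have h1 : Odd (minpoly F s).natDegree := hodd.of_dvd_nat (minpoly.degree_dvd hint)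
  have h2 : (minpoly F s).natDegree ≤ 2 := by
    have h3 : minpoly F s ∣ X ^ 2 - C q := minpoly.dvd F s (by simp [h])
    have h4 := natDegree_le_of_dvd h3 (X_pow_sub_C_ne_zero two_pos q)
    rwa [natDegree_X_pow_sub_C] at h4
  have h5 : (minpoly F s).natDegree = 1 := by
    obtain ⟨k, hk⟩ := h1
    omega
  exact minpoly.natDegree_eq_one_iff.1 h5

theorem exists_irreducible_odd_natDegree_dvd {K : Type*} [Field K] {R : K[X]}
    (hR : Odd R.natDegree) : ∃ m : K[X], Irreducible m ∧ Odd m.natDegree ∧ m ∣ R := by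
  revert hR
  refine WfDvdMonoid.induction_on_irreducible R ?_ ?_ ?_
  · intro h
    simp at h
  · intro u hu h
    rw [natDegree_eq_zero_of_isUnit hu] at h
    simp at h
  · intro x p hx hp ih h
    by_cases hpo : Odd p.natDegree
    · exact ⟨p, hp, hpo, dvd_mul_right p x⟩
    · rw [natDegree_mul hp.ne_zero hx, Nat.odd_add] at h
      obtain ⟨m, hm, hmo, hmx⟩ := ih (by
        rw [← Nat.not_even_iff_odd]
        exact fun he => hpo (h.2 he))
      exact ⟨m, hm, hmo, hmx.mul_left p⟩

variable {K : Type*} [Field K] {a b A B : K}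

theorem natDegree_mul_sq_sub_mul_quartic (ha : a ≠ 0) (hb : b ≠ 0) (hab : ¬ IsSquare (a * b))
    (P : K[X]) : C a * P ^ 2 - C b * ((X ^ 2 - C A) * (X ^ 2 - C B)) ≠ 0 ∧
      Even (C a * P ^ 2 - C b * ((X ^ 2 - C A) * (X ^ 2 - C B))).natDegree ∧
      (C a * P ^ 2 - C b * ((X ^ 2 - C A) * (X ^ 2 - C B))).natDegree ≤
        max (2 * P.natDegree) 4 := by
  have hmon : ((X ^ 2 - C A) * (X ^ 2 - C B) : K[X]).Monic :=
    (monic_X_pow_sub_C A two_ne_zero).mul (monic_X_pow_sub_C B two_ne_zero)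
  have hdeg : ((X ^ 2 - C A) * (X ^ 2 - C B) : K[X]).natDegree = 4 := by
    rw [(monic_X_pow_sub_C A two_ne_zero).natDegree_mul (monic_X_pow_sub_C B two_ne_zero),
      natDegree_X_pow_sub_C, natDegree_X_pow_sub_C]
  generalize ((X ^ 2 - C A) * (X ^ 2 - C B) : K[X]) = f at hmon hdeg
  have hbf : (C b * f).natDegree = 4 := by rw [natDegree_C_mul hb, hdeg]
  have haP : (C a * P ^ 2).natDegree = 2 * P.natDegree := by
    rw [natDegree_C_mul ha, natDegree_pow]
  have hle : (C a * P ^ 2 - C b * f).natDegree ≤ max (2 * P.natDegree) 4 := by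
    rw [← haP, ← hbf]
    exact natDegree_sub_le _ _
  have hne : ∀ {p : K[X]}, 0 < p.natDegree → p ≠ 0 := by
    rintro p hp rfl
    simp at hp
  rcases lt_trichotomy (2 * P.natDegree) 4 with h | h | h
  · have h1 : (C a * P ^ 2 - C b * f).natDegree = 4 := by
      rw [natDegree_sub_eq_right_of_natDegree_lt (by rw [haP, hbf]; exact h), hbf]
    exact ⟨hne (by omega), by rw [h1]; decide, hle⟩
  · have h1 : (C a * P ^ 2 - C b * f).coeff 4 ≠ 0 := by
      have hP2 : (P ^ 2).coeff 4 = P.coeff 2 ^ 2 := by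
        rw [show 4 = 2 * 2 from rfl]
        exact coeff_pow_of_natDegree_le (by omega)
      have hf4 : f.coeff 4 = 1 := by rw [← hdeg]; exact hmon.coeff_natDegree
      rw [coeff_sub, coeff_C_mul, coeff_C_mul, hP2, hf4, mul_one]
      intro h0
      exact hab ⟨a * P.coeff 2, by linear_combination (-a) * h0⟩
    have h2 : (C a * P ^ 2 - C b * f).natDegree = 4 :=
      le_antisymm (by rwa [h, max_self] at hle) (le_natDegree_of_ne_zero h1)
    exact ⟨hne (by omega), by rw [h2]; decide, hle⟩
  · have h1 : (C a * P ^ 2 - C b * f).natDegree = 2 * P.natDegree := by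
      rw [natDegree_sub_eq_left_of_natDegree_lt (by rw [haP, hbf]; exact h), haP]
    exact ⟨hne (by omega), by rw [h1]; exact even_two_mul _, hle⟩

theorem exists_solution_of_irreducible_dvd (ha : a ≠ 0) (hb : b ≠ 0) (hab : ¬ IsSquare (a * b))
    {n : ℕ} {m P : K[X]} (hm : Irreducible m) (hn : m.natDegree = n) (hodd : Odd n)
    (h : m ∣ C a * P ^ 2 - C b * ((X ^ 2 - C A) * (X ^ 2 - C B))) :
    ∃ s x : K, a * s ^ 2 = b * ((x ^ 2 - A) * (x ^ 2 - B)) := by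
  induction n using Nat.strong_induction_on generalizing m P with
  | _ n ih =>
    rcases eq_or_ne n 1 with rfl | hn1
    · obtain ⟨x, hx⟩ := exists_root_of_degree_eq_one
        ((degree_eq_iff_natDegree_eq_of_pos one_pos).2 hn)
      refine ⟨P.eval x, x, sub_eq_zero.1 ?_⟩
      have h1 := hx.dvd h
      simpa using h1
    · have hn3 : 3 ≤ n := by
        obtain ⟨k, rfl⟩ := hodd
        omega
      have hmod : m ∣ C a * (P % m) ^ 2 - C b * ((X ^ 2 - C A) * (X ^ 2 - C B)) := by
        have h1 : m ∣ P % m - P := by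
          refine ⟨-(P / m), ?_⟩
          linear_combination EuclideanDomain.mod_add_div P m
        have h2 := (h1.mul_left (C a * (P % m + P))).add h
        convert h2 using 1
        ring
      obtain ⟨hQ0, hQe, hQle⟩ := natDegree_mul_sq_sub_mul_quartic (A := A) (B := B) ha hb hab (P % m)
      have hlt : (P % m).natDegree < n := by
        rw [← hn]
        exact natDegree_mod_lt P (by omega)
      obtain ⟨R, hR⟩ := hmod
      have hR0 : R ≠ 0 := by
        rintro rfl
        exact hQ0 (by rw [hR, mul_zero])
      have hdeg := congrArg natDegree hR
      rw [natDegree_mul hm.ne_zero hR0, hn] at hdeg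
      have hRodd : Odd R.natDegree := by
        rw [hdeg, Nat.even_add'] at hQe
        exact hQe.1 hodd
      obtain ⟨m', hm', hm'o, hm'R⟩ := exists_irreducible_odd_natDegree_dvd hRodd
      refine ih m'.natDegree ?_ hm' rfl hm'o (P := P % m) ?_
      · have := natDegree_le_of_dvd hm'R hR0
        omega
      · rw [hR]
        exact hm'R.mul_left m

theorem exists_solution_of_odd_finrank {L : Type*} [Field L] [Algebra K L] [FiniteDimensional K L]
    (hodd : Odd (Module.finrank K L)) (ha : a ≠ 0) (hb : b ≠ 0) (hab : ¬ IsSquare (a * b))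
    {s x : L} (h : algebraMap K L a * s ^ 2 = algebraMap K L b *
      ((x ^ 2 - algebraMap K L A) * (x ^ 2 - algebraMap K L B))) :
    ∃ s x : K, a * s ^ 2 = b * ((x ^ 2 - A) * (x ^ 2 - B)) := by
  have hint : IsIntegral K x := Algebra.IsIntegral.isIntegral x
  have haL : algebraMap K L a ≠ 0 := by simpa using ha
  have hmul := Module.finrank_mul_finrank K K⟮x⟯ L
  have hodd' : Odd (Module.finrank K⟮x⟯ L) := hodd.of_dvd_nat ⟨_, by rw [← hmul, mul_comm]⟩
  have hq : s ^ 2 = algebraMap K⟮x⟯ L (algebraMap K K⟮x⟯ (b / a) *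
      ((AdjoinSimple.gen K x ^ 2 - algebraMap K K⟮x⟯ A) *
        (AdjoinSimple.gen K x ^ 2 - algebraMap K K⟮x⟯ B))) := by
    rw [map_mul, map_mul, map_sub, map_sub, map_pow, AdjoinSimple.algebraMap_gen,
      ← IsScalarTower.algebraMap_apply, ← IsScalarTower.algebraMap_apply,
      ← IsScalarTower.algebraMap_apply, map_div₀]
    field_simp
    linear_combination h
  obtain ⟨r, hr⟩ := exists_algebraMap_eq_of_sq_eq hodd' hq
  have hs : s ∈ K⟮x⟯ := by
    rw [← hr]
    exact r.2
  rw [← IntermediateField.mem_toSubalgebra,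
    adjoin_simple_toSubalgebra_of_isAlgebraic hint.isAlgebraic,
    Algebra.adjoin_singleton_eq_range_aeval] at hs
  obtain ⟨P, hP⟩ := hs
  replace hP : aeval x P = s := hP
  refine exists_solution_of_irreducible_dvd (P := P) ha hb hab (minpoly.irreducible hint) rfl
    (hodd.of_dvd_nat (minpoly.degree_dvd hint)) (minpoly.dvd K x ?_)
  simp only [map_sub, map_mul, map_pow, aeval_C, aeval_X, hP]
  rw [h, sub_self]

end OddDegree

section Curve

theorem XPoint.exists_solution {K L : Type*} [Field K] [Field L] [Algebra K L]
    [FiniteDimensional K L] (hodd : Odd (Module.finrank K L)) {g : ℕ} (hg : Odd g) {a b A B : K}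
    (ha : a ≠ 0) (hb : b ≠ 0) (hab : ¬ IsSquare (a * b))
    (h : XPoint g (algebraMap K L a) (algebraMap K L b) (algebraMap K L A) (algebraMap K L B)) :
    ∃ s x : K, a * s ^ 2 = b * ((x ^ 2 - A) * (x ^ 2 - B)) := by
  obtain ⟨m, hm⟩ : ∃ m, g + 1 = m * 2 := by
    obtain ⟨k, rfl⟩ := hg
    exact ⟨k + 1, by ring⟩
  rcases h with ⟨s, t, h⟩ | ⟨S, T, h⟩
  · rw [hm, pow_mul] at h
    exact exists_solution_of_odd_finrank hodd ha hb hab h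
  · rw [hm, pow_mul] at h
    generalize T ^ m = x at h
    by_cases hx : x = 0
    · rw [hx] at h
      obtain ⟨r, hr⟩ := exists_algebraMap_eq_of_sq_eq hodd (s := algebraMap K L a * S)
        (q := a * b) (by rw [map_mul]; linear_combination (algebraMap K L a) * h)
      refine absurd ⟨r, (algebraMap K L).injective ?_⟩ hab
      rw [map_mul (algebraMap K L) r r, hr, map_mul]
      linear_combination -(algebraMap K L a) * h
    · refine exists_solution_of_odd_finrank hodd ha hb hab (s := S / x ^ 2) (x := 1 / x) ?_
      field_simp
      linear_combination h

variable {K : Type u} [Field K] [NumberField K] {g : ℕ} {a b c d : 𝓞 K}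
  {va vb vc vd : HeightOneSpectrum (𝓞 K)}

theorem Params.not_xPoint_and_xNoZeroCycleDegOne (hP : Params K g a b c d va vb vc vd)
    (hg : Odd g) {k : ℕ} (hk : Odd k) {y z D A B : K} (hyz : ¬ (y = 0 ∧ z = 0))
    (hD : D = (algebraMap (𝓞 K) K a * algebraMap (𝓞 K) K b) ^ k * y ^ 2 - z ^ 2)
    (hA : A = algebraMap (𝓞 K) K a ^ (2 * k + 1) * y ^ 4 +
      algebraMap (𝓞 K) K b * algebraMap (𝓞 K) K c ^ 2 * algebraMap (𝓞 K) K d * D ^ 2)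
    (hB : B = A + 2 * algebraMap (𝓞 K) K c * D ^ 2) :
    ¬ XPoint g (algebraMap (𝓞 K) K a) (algebraMap (𝓞 K) K b) A B ∧
      XNoZeroCycleDegOne K g (algebraMap (𝓞 K) K a) (algebraMap (𝓞 K) K b) A B := by
  have hva : va.valuation K (algebraMap (𝓞 K) K a) = WithZero.exp (-1) :=
    valuation_generator hP.span_a
  have hvb : va.valuation K (algebraMap (𝓞 K) K b) = 1 :=
    valuation_eq_one_of_notMem (notMem_of_ne_of_asIdeal_eq_span hP.span_b hP.distinct.1)
  have ha : algebraMap (𝓞 K) K a ≠ 0 :=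
    (Valuation.ne_zero_iff (va.valuation K)).1 (by rw [hva]; exact WithZero.exp_ne_zero)
  have hb : algebraMap (𝓞 K) K b ≠ 0 :=
    (Valuation.ne_zero_iff (va.valuation K)).1 (by rw [hvb]; exact one_ne_zero)
  have hab : ¬ IsSquare (algebraMap (𝓞 K) K a * algebraMap (𝓞 K) K b) := by
    intro h
    refine WithZero.not_isSquare_exp_of_odd (n := -1) (by decide) ?_
    have h1 := h.map (va.valuation K)
    rwa [map_mul, hva, hvb, mul_one] at h1
  have key : ∀ (L : Type u) [Field L] [Algebra K L] [FiniteDimensional K L],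
      Odd (Module.finrank K L) → ¬ XPoint g (algebraMap K L (algebraMap (𝓞 K) K a))
        (algebraMap K L (algebraMap (𝓞 K) K b)) (algebraMap K L A) (algebraMap K L B) := by
    intro L _ _ _ hodd h
    obtain ⟨s, x, hs⟩ := h.exists_solution hodd hg ha hb hab
    refine hP.false_of_solution hk hyz hD hA (x := x) (s := s) ?_
    rw [hs, hB]
    ring
  refine ⟨key K (by rw [Module.finrank_self]; exact odd_one), ?_⟩
  intro r _ L _ _ _ n hpt hsum
  have heven : Even (∑ i, n i * (Module.finrank K (L i) : ℤ)) := by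
    refine Finset.even_sum _ fun i _ => Even.mul_left ?_ _
    rw [Int.even_coe_nat, ← Nat.not_odd_iff_even]
    exact fun h => key (L i) h (hpt i)
  rw [hsum] at heven
  exact Int.not_even_one heven

end Curve

/-- Theorem 5.1(2) for the hyperelliptic curves: if `g` is odd then for every
`θ ∈ K ∪ {∞}` the curve `X_θ` has no `K`-rational point and no zero-cycle of
degree 1. -/
theorem stmt17 (K : Type u) [Field K] [NumberField K] (h g : ℕ) (hg1 : 1 ≤ g)
    (hgodd : Odd g) (a b c d : 𝓞 K)
    (va vb vc vd : HeightOneSpectrum (𝓞 K)) (hP : Params K g a b c d va vb vc vd) :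
    (∀ θ : K,
      ¬ XPoint g (algebraMap (𝓞 K) K a) (algebraMap (𝓞 K) K b)
          (Aval (algebraMap (𝓞 K) K a) (algebraMap (𝓞 K) K b) (algebraMap (𝓞 K) K c)
            (algebraMap (𝓞 K) K d) h g θ)
          (Bval (algebraMap (𝓞 K) K a) (algebraMap (𝓞 K) K b) (algebraMap (𝓞 K) K c)
            (algebraMap (𝓞 K) K d) h g θ) ∧
      XNoZeroCycleDegOne K g (algebraMap (𝓞 K) K a) (algebraMap (𝓞 K) K b)
          (Aval (algebraMap (𝓞 K) K a) (algebraMap (𝓞 K) K b) (algebraMap (𝓞 K) K c)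
            (algebraMap (𝓞 K) K d) h g θ)
          (Bval (algebraMap (𝓞 K) K a) (algebraMap (𝓞 K) K b) (algebraMap (𝓞 K) K c)
            (algebraMap (𝓞 K) K d) h g θ)) ∧
    (¬ XPoint g (algebraMap (𝓞 K) K a) (algebraMap (𝓞 K) K b)
        (Ainf (algebraMap (𝓞 K) K a) (algebraMap (𝓞 K) K b) (algebraMap (𝓞 K) K c)
          (algebraMap (𝓞 K) K d) h)
        (Binf (algebraMap (𝓞 K) K a) (algebraMap (𝓞 K) K b) (algebraMap (𝓞 K) K c)
          (algebraMap (𝓞 K) K d) h) ∧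
      XNoZeroCycleDegOne K g (algebraMap (𝓞 K) K a) (algebraMap (𝓞 K) K b)
        (Ainf (algebraMap (𝓞 K) K a) (algebraMap (𝓞 K) K b) (algebraMap (𝓞 K) K c)
          (algebraMap (𝓞 K) K d) h)
        (Binf (algebraMap (𝓞 K) K a) (algebraMap (𝓞 K) K b) (algebraMap (𝓞 K) K c)
          (algebraMap (𝓞 K) K d) h)) := by
  have hk : Odd (2 * h + 1) := ⟨h, rfl⟩
  refine ⟨fun θ => ?_, ?_⟩
  · obtain ⟨m, hm⟩ : ∃ m, g + 1 = m * 2 := by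
      obtain ⟨k, rfl⟩ := hgodd
      exact ⟨k + 1, by ring⟩
    have hm' : 2 * g + 2 = m * 4 := by omega
    refine hP.not_xPoint_and_xNoZeroCycleDegOne hgodd hk (y := θ ^ m) (z := 1)
      (D := Dval (algebraMap (𝓞 K) K a) (algebraMap (𝓞 K) K b) h g θ)
      (fun h0 => one_ne_zero h0.2) ?_ ?_ ?_
    · rw [Dval, hm, pow_mul, mul_pow, one_pow]
    · rw [Aval, hm', pow_mul θ]
      ring
    · rw [Aval, Bval]
      ring
  · refine hP.not_xPoint_and_xNoZeroCycleDegOne hgodd hk (y := 1) (z := 0)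
      (D := Dinf (algebraMap (𝓞 K) K a) (algebraMap (𝓞 K) K b) h)
      (fun h0 => one_ne_zero h0.1) ?_ ?_ ?_
    · rw [Dinf, mul_pow]
      ring
    · rw [Ainf]
      ring
    · rw [Ainf, Binf]
      ring
end

section
/- The polynomial A_θ · B_θ ∈ K[θ] (a polynomial of degree 4g+4 in the variable θ) is separable; that is, it has no multiple root in an algebraic closure of K. -/
open NumberField Polynomial

/-- `a, b, c, d ∈ 𝓞 K` generate pairwise distinct nonzero prime ideals,
none of which divides `(2)`. -/
def GoodParams (K : Type*) [Field K] [NumberField K] (a b c d : 𝓞 K) : Prop :=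
  (Ideal.span {a} : Ideal (𝓞 K)).IsPrime ∧ (Ideal.span {b} : Ideal (𝓞 K)).IsPrime ∧
  (Ideal.span {c} : Ideal (𝓞 K)).IsPrime ∧ (Ideal.span {d} : Ideal (𝓞 K)).IsPrime ∧
  a ≠ 0 ∧ b ≠ 0 ∧ c ≠ 0 ∧ d ≠ 0 ∧
  (Ideal.span {a} : Ideal (𝓞 K)) ≠ Ideal.span {b} ∧
  (Ideal.span {a} : Ideal (𝓞 K)) ≠ Ideal.span {c} ∧
  (Ideal.span {a} : Ideal (𝓞 K)) ≠ Ideal.span {d} ∧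
  (Ideal.span {b} : Ideal (𝓞 K)) ≠ Ideal.span {c} ∧
  (Ideal.span {b} : Ideal (𝓞 K)) ≠ Ideal.span {d} ∧
  (Ideal.span {c} : Ideal (𝓞 K)) ≠ Ideal.span {d} ∧
  ¬ a ∣ 2 ∧ ¬ b ∣ 2 ∧ ¬ c ∣ 2 ∧ ¬ d ∣ 2

/-- The polynomial `A_θ = a^{4h+3} θ^{2g+2} + b c² d (a^{2h+1} b^{2h+1} θ^{g+1} − 1)²`
in the indeterminate `θ`. -/
noncomputable def Apoly (K : Type*) [Field K] [NumberField K] (a b c d : 𝓞 K)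
    (h g : ℕ) : Polynomial K :=
  C ((algebraMap (𝓞 K) K a) ^ (4 * h + 3)) * X ^ (2 * g + 2) +
    C (algebraMap (𝓞 K) K b * (algebraMap (𝓞 K) K c) ^ 2 * algebraMap (𝓞 K) K d) *
      (C ((algebraMap (𝓞 K) K a) ^ (2 * h + 1) * (algebraMap (𝓞 K) K b) ^ (2 * h + 1)) *
          X ^ (g + 1) - 1) ^ 2

/-- The polynomial
`B_θ = a^{4h+3} θ^{2g+2} + (b c² d + 2c)(a^{2h+1} b^{2h+1} θ^{g+1} − 1)²`
in the indeterminate `θ`. -/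
noncomputable def Bpoly (K : Type*) [Field K] [NumberField K] (a b c d : 𝓞 K)
    (h g : ℕ) : Polynomial K :=
  C ((algebraMap (𝓞 K) K a) ^ (4 * h + 3)) * X ^ (2 * g + 2) +
    C (algebraMap (𝓞 K) K b * (algebraMap (𝓞 K) K c) ^ 2 * algebraMap (𝓞 K) K d +
        2 * algebraMap (𝓞 K) K c) *
      (C ((algebraMap (𝓞 K) K a) ^ (2 * h + 1) * (algebraMap (𝓞 K) K b) ^ (2 * h + 1)) *
          X ^ (g + 1) - 1) ^ 2

section Auxiliary

variable {F : Type*} [Field F]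

/-- For nonzero `P` and `m`, the polynomial `P X ^ (2 g + 2) + m (t X ^ (g + 1) - 1) ^ 2` is
separable in characteristic zero. -/
theorem separable_C_mul_X_pow_add_C_mul_sq [CharZero F] {P m : F} (t : F) (g : ℕ) (hP : P ≠ 0) (hm : m ≠ 0) :
    (C P * X ^ (2 * g + 2) + C m * (C t * X ^ (g + 1) - 1) ^ 2 : F[X]).Separable := by
  rw [Polynomial.Separable,
    Polynomial.isCoprime_iff_aeval_ne_zero_of_isAlgClosed F (AlgebraicClosure F)]
  intro x
  by_contra! hx
  obtain ⟨h1, h2⟩ := hx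
  have hP' : algebraMap F (AlgebraicClosure F) P ≠ 0 := by simpa using hP
  have hm' : algebraMap F (AlgebraicClosure F) m ≠ 0 := by simpa using hm
  simp [derivative_pow] at h1 h2
  rw [map_ofNat] at h2
  generalize algebraMap F (AlgebraicClosure F) P = p at *
  generalize algebraMap F (AlgebraicClosure F) m = q at *
  generalize algebraMap F (AlgebraicClosure F) t = s at *
  have hx0 : x ≠ 0 := by
    rintro rfl
    simp at h1
    exact hm' h1
  have hg : (g + 1 : AlgebraicClosure F) ≠ 0 := Nat.cast_add_one_ne_zero g
  have hy : x ^ (g + 1) ≠ 0 := pow_ne_zero _ hx0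
  have h3 : p * x ^ (g + 1) + q * s * (s * x ^ (g + 1) - 1) = 0 := by
    have : 2 * (g + 1 : AlgebraicClosure F) * x ^ g *
        (p * x ^ (g + 1) + q * s * (s * x ^ (g + 1) - 1)) = 0 := by
      linear_combination h2
    simpa [hg, hx0] using this
  have h4 : s * x ^ (g + 1) - 1 = 0 := by
    have : q * (s * x ^ (g + 1) - 1) = 0 := by
      linear_combination x ^ (g + 1) * h3 - h1
    simpa [hm'] using this
  rw [h4, mul_zero, add_zero] at h3
  exact mul_ne_zero hP' hy h3

/-- Two polynomials `P X ^ (2 g + 2) + m (t X ^ (g + 1) - 1) ^ 2` with the same `P ≠ 0` and `t`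
and distinct values of `m` are coprime. -/
theorem isCoprime_C_mul_X_pow_add_C_mul_sq {P m m' : F} (t : F) (g : ℕ) (hP : P ≠ 0)
    (hm : m ≠ m') :
    IsCoprime (C P * X ^ (2 * g + 2) + C m * (C t * X ^ (g + 1) - 1) ^ 2 : F[X])
      (C P * X ^ (2 * g + 2) + C m' * (C t * X ^ (g + 1) - 1) ^ 2) := by
  rw [Polynomial.isCoprime_iff_aeval_ne_zero_of_isAlgClosed F (AlgebraicClosure F)]
  intro x
  by_contra! hx
  obtain ⟨h1, h2⟩ := hx
  have hP' : algebraMap F (AlgebraicClosure F) P ≠ 0 := by simpa using hP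
  have hm' : algebraMap F (AlgebraicClosure F) m - algebraMap F (AlgebraicClosure F) m' ≠ 0 := by
    rw [sub_ne_zero]
    exact fun h => hm ((algebraMap F (AlgebraicClosure F)).injective h)
  simp only [map_add, map_mul, map_pow, map_sub, map_one, aeval_C, aeval_X] at h1 h2
  have h3 : algebraMap F (AlgebraicClosure F) t * x ^ (g + 1) - 1 = 0 := by
    have := mul_eq_zero.mp (show (algebraMap F (AlgebraicClosure F) m -
      algebraMap F (AlgebraicClosure F) m') *
      (algebraMap F (AlgebraicClosure F) t * x ^ (g + 1) - 1) ^ 2 = 0 by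
        linear_combination h1 - h2)
    exact pow_eq_zero_iff two_ne_zero |>.mp (this.resolve_left hm')
  have hx0 : x ≠ 0 := by
    rintro rfl
    simp at h3
  rw [h3] at h1
  simp [hP', hx0] at h1

end Auxiliary

/-- Lemma 6.3: the polynomial `A_θ · B_θ ∈ K[θ]` is separable, i.e. it has no
multiple root in an algebraic closure of `K`. -/
theorem stmt19 (K : Type*) [Field K] [NumberField K] (h g : ℕ) (hg1 : 1 ≤ g)
    (a b c d : 𝓞 K) (hP : GoodParams K a b c d) :
    (Apoly K a b c d h g * Bpoly K a b c d h g).Separable := by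
  obtain ⟨-, -, -, -, ha, hb, hc, hd, -, -, -, -, -, -, -, -, hc2, -⟩ := hP
  have ne (x : 𝓞 K) (hx : x ≠ 0) : algebraMap (𝓞 K) K x ≠ 0 := by simpa using hx
  have hP := pow_ne_zero (4 * h + 3) (ne a ha)
  have hm := mul_ne_zero (mul_ne_zero (ne b hb) (pow_ne_zero 2 (ne c hc))) (ne d hd)
  have hm' : algebraMap (𝓞 K) K b * (algebraMap (𝓞 K) K c) ^ 2 * algebraMap (𝓞 K) K d +
      2 * algebraMap (𝓞 K) K c ≠ 0 := by
    have : c * (b * c * d + 2) ≠ 0 := by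
      refine mul_ne_zero hc fun h0 => hc2 ⟨-(b * d), ?_⟩
      linear_combination h0
    have := ne _ this
    simp only [map_mul, map_add, map_ofNat] at this
    intro h0
    exact this (by linear_combination h0)
  refine (separable_C_mul_X_pow_add_C_mul_sq _ g hP hm).mul
    (separable_C_mul_X_pow_add_C_mul_sq _ g hP hm')
    (isCoprime_C_mul_X_pow_add_C_mul_sq _ g hP fun h0 => ?_)
  exact mul_ne_zero two_ne_zero (ne c hc) (by linear_combination -h0)
end
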